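/- arXiv:2502.09807 — 3 statements merged into one kernel-verified Lean document; each statement's English description precedes it below -/
import Mathlib

section
/- Let n ≥ 2 and fix τ_ψ with 1/n ≤ τ_ψ ≤ 2/(n-1). For τ_φ > 0 write D(τ_φ) = dim_H W_n(q ↦ q^{-τ_ψ}, q ↦ q^{-τ_φ}). Then D(τ_φ) → n - 1 as τ_φ → ∞. -/
open MeasureTheory Filter Set

/-- The unit cube `[0,1]^n` in `ℝ^n` (with the maximum norm). -/
def unitCube (n : ℕ) : Set (Fin n → ℝ) := Set.univ.pi fun _ => Set.Icc (0 : ℝ) 1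

/-- `W_n(ψ, φ)`: the set of `x ∈ [0,1]^n` such that
`(1-φ(q))·ψ(q)/q < ‖x - p/q‖ < ψ(q)/q` for infinitely many pairs `(p,q) ∈ ℤ^n × ℕ`. -/
def Wpsiphi (n : ℕ) (ψ φ : ℕ → ℝ) : Set (Fin n → ℝ) :=
  {x ∈ unitCube n |
    {pq : (Fin n → ℤ) × ℕ | 0 < pq.2 ∧
      (1 - φ pq.2) * (ψ pq.2 / pq.2) < ‖x - fun i => (pq.1 i : ℝ) / pq.2‖ ∧
      ‖x - fun i => (pq.1 i : ℝ) / pq.2‖ < ψ pq.2 / pq.2}.Infinite}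

lemma exists_lt_denominator_of_infinite {n : ℕ} {S : Set ((Fin n → ℤ) × ℕ)} (hS : S.Infinite)
    (hb : ∀ pq ∈ S, ∀ i, -(pq.2 : ℤ) ≤ pq.1 i ∧ pq.1 i ≤ 2 * pq.2) (N : ℕ) :
    ∃ pq ∈ S, N < pq.2 := by
  by_contra! h
  refine hS (((Set.Finite.pi' fun _ : Fin n => Set.finite_Icc (-(N : ℤ)) (2 * N)).prod
    (Set.finite_Iic N)).subset fun pq hpq => ⟨fun i => ?_, h pq hpq⟩)
  have h1 := hb pq hpq i
  have h2 := h pq hpq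
  constructor <;> omega

lemma rpow_neg_div_self_le_one {q : ℕ} (hq : 0 < q) {τ : ℝ} (hτ : 0 ≤ τ) :
    (q : ℝ) ^ (-τ) / q ≤ 1 := by
  have h1 : (1 : ℝ) ≤ q := by exact_mod_cast hq
  rw [div_le_one (by linarith)]
  exact (Real.rpow_le_one_of_one_le_of_nonpos h1 (by linarith)).trans h1

lemma neg_le_and_le_two_mul_of_abs_sub_div_lt {x : ℝ} (hx : x ∈ Set.Icc (0 : ℝ) 1) {q : ℕ}
    (hq : 0 < q) {p : ℤ} (h : |x - p / q| < 1) : -(q : ℤ) ≤ p ∧ p ≤ 2 * q := by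
  have hq' : (0 : ℝ) < q := by exact_mod_cast hq
  obtain ⟨h1, h2⟩ := abs_lt.1 h
  have e : (p : ℝ) = p / q * q := by field_simp
  constructor
  · have : (-(q : ℝ)) ≤ p := by rw [e]; nlinarith [hx.1]
    exact_mod_cast this
  · have : (p : ℝ) ≤ 2 * q := by rw [e]; nlinarith [hx.2]
    exact_mod_cast this

/-- The points whose `i`-th coordinate is `δ`-close to `c` and whose other coordinates are `δ`-close
to the grid point `g / K`. -/
def gridBox (d : ℕ) (K : ℕ) (δ c : ℝ) (i : Fin (d + 1)) (g : Fin d → Fin (K + 1)) :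
    Set (Fin (d + 1) → ℝ) :=
  {x | |x i - c| ≤ δ ∧ ∀ j, |x (i.succAbove j) - (g j : ℕ) / (K : ℝ)| ≤ δ}

lemma ediam_gridBox_le {d K : ℕ} {δ c : ℝ} (hδ : 0 ≤ δ) (i : Fin (d + 1))
    (g : Fin d → Fin (K + 1)) : Metric.ediam (gridBox d K δ c i g) ≤ ENNReal.ofReal (2 * δ) := by
  refine Metric.ediam_le_of_forall_dist_le fun x hx y hy => ?_
  rw [dist_pi_le_iff (by linarith), Fin.forall_iff_succAbove i]
  have key : ∀ a b c : ℝ, |a - c| ≤ δ → |b - c| ≤ δ → dist a b ≤ 2 * δ := fun a b c h1 h2 => by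
    rw [Real.dist_eq, abs_le]
    rw [abs_le] at h1 h2
    constructor <;> linarith
  exact ⟨key _ _ _ hx.1 hy.1, fun j => key _ _ _ (hx.2 j) (hy.2 j)⟩

lemma exists_mem_gridBox {d K : ℕ} (hK : 0 < K) {δ c : ℝ} (hKδ : 1 / (K : ℝ) ≤ δ)
    {x : Fin (d + 1) → ℝ} (hx : x ∈ unitCube (d + 1)) {i : Fin (d + 1)} (hi : |x i - c| ≤ δ) :
    ∃ g, x ∈ gridBox d K δ c i g := by
  have hK' : (0 : ℝ) < K := by exact_mod_cast hK
  have hx' : ∀ j, x j ∈ Set.Icc (0 : ℝ) 1 := fun j => hx j (mem_univ j)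
  have hlt : ∀ j, ⌊x (i.succAbove j) * K⌋₊ < K + 1 := fun j => by
    rw [Nat.floor_lt (by have := (hx' (i.succAbove j)).1; positivity)]
    push_cast
    nlinarith [(hx' (i.succAbove j)).2]
  refine ⟨fun j => ⟨_, hlt j⟩, hi, fun j => le_trans ?_ hKδ⟩
  have h0 := (hx' (i.succAbove j)).1
  have h1 := Nat.floor_le (a := x (i.succAbove j) * K) (by positivity)
  have h2 := Nat.lt_floor_add_one (x (i.succAbove j) * K)
  have e : x (i.succAbove j) = x (i.succAbove j) * K / K := by field_simp
  rw [e, ← sub_div, abs_div, abs_of_pos hK']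
  dsimp only
  gcongr
  rw [abs_le]
  constructor <;> linarith

lemma exists_abs_sub_le_of_mem_shell {ι : Type*} [Fintype ι] [Nonempty ι] {x y : ι → ℝ} {R φ : ℝ}
    (h1 : (1 - φ) * R < ‖x - y‖) (h2 : ‖x - y‖ < R) :
    ∃ i, ∃ ε : Bool, |x i - (y i + (bif ε then R else -R))| ≤ φ * R := by
  obtain ⟨i, hi⟩ : ∃ i, ‖(x - y) i‖ = ‖x - y‖ := by
    obtain ⟨i, -, hi⟩ := Finset.exists_mem_eq_sup' (Finset.univ_nonempty (α := ι))
      (fun i => ‖(x - y) i‖)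
    refine ⟨i, le_antisymm (norm_le_pi_norm _ i) ?_⟩
    rw [pi_norm_le_iff_of_nonempty, ← hi]
    exact fun j => Finset.le_sup' (fun i => ‖(x - y) i‖) (Finset.mem_univ j)
  rw [← hi, Real.norm_eq_abs, Pi.sub_apply] at h1 h2
  refine ⟨i, decide (0 ≤ x i - y i), ?_⟩
  rcases le_or_gt 0 (x i - y i) with h | h
  · rw [abs_of_nonneg h] at h1 h2
    simp only [h, decide_true, cond_true]
    rw [abs_le]
    constructor <;> nlinarith
  · rw [abs_of_neg h] at h1 h2
    simp only [not_le.2 h, decide_false, cond_false]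
    rw [abs_le]
    constructor <;> nlinarith

lemma card_mul_rpow_le {d K q : ℕ} (hq : 0 < q) {s τ δ : ℝ} (hs : d < s) (hτ : 3 ≤ (s - d) * τ)
    (hδ : 0 < δ) (hδ1 : δ ≤ 1) (hδτ : δ ≤ (q : ℝ) ^ (-τ)) (hK : (K : ℝ) ≤ 1 / δ + 1) :
    ((d + 1 : ℕ) * ((3 * q + 1 : ℕ) * (2 * ((K + 1) ^ d : ℕ))) : ℝ) * (2 * δ) ^ s ≤
      ((d + 1) * 8 * 3 ^ d * 2 ^ s) * (1 / (q : ℝ) ^ 2) := by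
  have hq1 : (1 : ℝ) ≤ q := by exact_mod_cast hq
  have hq0 : (0 : ℝ) < q := by linarith
  have hK1 : ((K : ℝ) + 1) ≤ 3 / δ := by
    have : 1 ≤ 1 / δ := by rw [le_div_iff₀ hδ]; linarith
    have e : 3 / δ = 1 / δ + 2 * (1 / δ) := by ring
    linarith
  have hpow : ((K : ℝ) + 1) ^ d ≤ 3 ^ d / δ ^ d := by
    rw [← div_pow]; gcongr
  have h3 : (2 * δ) ^ s = 2 ^ s * (δ ^ (s - d) * δ ^ d) := by
    rw [Real.mul_rpow (by norm_num) hδ.le, ← Real.rpow_natCast δ d, ← Real.rpow_add hδ]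
    congr 2; ring
  have h4 : δ ^ (s - d) ≤ (1 / (q : ℝ) ^ 3) := by
    calc δ ^ (s - d) ≤ ((q : ℝ) ^ (-τ)) ^ (s - d) := by
          apply Real.rpow_le_rpow hδ.le hδτ; linarith
      _ = (q : ℝ) ^ (-((s - d) * τ)) := by rw [← Real.rpow_mul hq0.le]; ring_nf
      _ ≤ (q : ℝ) ^ (-(3 : ℝ)) := by
          apply Real.rpow_le_rpow_of_exponent_le hq1; linarith
      _ = 1 / (q : ℝ) ^ 3 := by
          rw [Real.rpow_neg hq0.le, one_div]; norm_cast
  have h5 : (3 * (q : ℝ) + 1) ≤ 4 * q := by linarith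
  push_cast
  rw [h3]
  calc ((d : ℝ) + 1) * ((3 * q + 1) * (2 * (K + 1) ^ d)) * (2 ^ s * (δ ^ (s - d) * δ ^ d))
      ≤ ((d : ℝ) + 1) * ((4 * q) * (2 * (3 ^ d / δ ^ d))) *
        (2 ^ s * (1 / (q : ℝ) ^ 3 * δ ^ d)) := by gcongr
    _ = _ := by field_simp; ring

theorem dimH_Wpsiphi_le {d : ℕ} {τψ τφ : ℝ} (hψ : 0 ≤ τψ) (hφ : 1 ≤ τφ) {s : NNReal}
    (hs : (d : ℝ) < s) (h : 3 ≤ ((s : ℝ) - d) * τφ) :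
    dimH (Wpsiphi (d + 1) (fun q => (q : ℝ) ^ (-τψ)) (fun q => (q : ℝ) ^ (-τφ))) ≤ s := by
  apply dimH_le_of_hausdorffMeasure_ne_top
  set R : ℕ → ℝ := fun q => (q : ℝ) ^ (-τψ) / q with hR
  set δ : ℕ → ℝ := fun q => (q : ℝ) ^ (-τφ) * R q with hδdef
  set K : ℕ → ℕ := fun q => ⌈1 / δ q⌉₊ with hKdef
  have hRpos : ∀ q, 0 < q → 0 < R q := fun q hq => by
    have : (0 : ℝ) < q := by exact_mod_cast hq
    simp only [hR]; positivity
  have hδpos : ∀ q, 0 < q → 0 < δ q := fun q hq => by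
    have : (0 : ℝ) < q := by exact_mod_cast hq
    have := hRpos q hq
    simp only [hδdef]; positivity
  have hδle : ∀ q, 0 < q → δ q ≤ (q : ℝ) ^ (-τφ) := fun q hq =>
    mul_le_of_le_one_right (by positivity) (rpow_neg_div_self_le_one hq hψ)
  have hδinv : ∀ q, 0 < q → δ q ≤ (q : ℝ)⁻¹ := fun q hq => by
    refine (hδle q hq).trans ?_
    rw [← Real.rpow_neg_one]
    exact Real.rpow_le_rpow_of_exponent_le (by exact_mod_cast hq) (by linarith)
  have hδone : ∀ q, 0 < q → δ q ≤ 1 := fun q hq =>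
    (hδinv q hq).trans (inv_le_one_of_one_le₀ (by exact_mod_cast hq))
  have hKpos : ∀ q, 0 < q → 0 < K q := fun q hq =>
    Nat.ceil_pos.2 (by have := hδpos q hq; positivity)
  let J : ℕ → Type := fun q =>
    Fin (d + 1) × (Finset.Icc (-(q : ℤ)) (2 * q)) × Bool × (Fin d → Fin (K q + 1))
  let T : (q : ℕ) → J q → Set (Fin (d + 1) → ℝ) := fun q a =>
    gridBox d (K q) (δ q) ((a.2.1 : ℤ) / (q : ℝ) + (bif a.2.2.1 then R q else -R q)) a.1 a.2.2.2
  have hcard : ∀ q, (Fintype.card (J q) : ℝ) =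
      ((d + 1 : ℕ) * ((3 * q + 1 : ℕ) * (2 * ((K q + 1) ^ d : ℕ))) : ℝ) := fun q => by
    have : Fintype.card (J q) = (d + 1) * ((3 * q + 1) * (2 * ((K q + 1) ^ d))) := by
      simp only [J, Fintype.card_prod, Fintype.card_fin, Fintype.card_coe, Int.card_Icc,
        Fintype.card_bool, Fintype.card_pi, Finset.prod_const, Finset.card_univ]
      congr 3
      omega
    rw [this]; push_cast; ring
  set C : ℝ := (d + 1) * 8 * 3 ^ d * 2 ^ (s : ℝ) with hC
  have hsum : ∀ q, 0 < q → ∑' a : J q, Metric.ediam (T q a) ^ (s : ℝ) ≤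
      ENNReal.ofReal (C * (1 / (q : ℝ) ^ 2)) := fun q hq => by
    calc ∑' a : J q, Metric.ediam (T q a) ^ (s : ℝ)
        ≤ ∑' a : J q, ENNReal.ofReal ((2 * δ q) ^ (s : ℝ)) := by
          refine ENNReal.tsum_le_tsum fun a => ?_
          rw [← ENNReal.ofReal_rpow_of_nonneg (by have := hδpos q hq; positivity) s.coe_nonneg]
          gcongr
          exact ediam_gridBox_le (hδpos q hq).le _ _
      _ = ENNReal.ofReal ((Fintype.card (J q) : ℝ) * (2 * δ q) ^ (s : ℝ)) := by
          rw [tsum_fintype, Finset.sum_const, Finset.card_univ, nsmul_eq_mul,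
            ENNReal.ofReal_mul (by positivity), ENNReal.ofReal_natCast]
      _ ≤ _ := by
          rw [hcard]
          refine ENNReal.ofReal_le_ofReal (card_mul_rpow_le hq hs h (hδpos q hq) (hδone q hq)
            (hδle q hq) (Nat.ceil_lt_add_one ?_).le)
          have := hδpos q hq; positivity
  have hle := Measure.hausdorffMeasure_le_liminf_tsum (l := atTop) (ι := fun N : ℕ => Σ k, J (N + 1 + k))
    (s : ℝ) (Wpsiphi (d + 1) (fun q => (q : ℝ) ^ (-τψ)) (fun q => (q : ℝ) ^ (-τφ)))
    (fun N : ℕ => ENNReal.ofReal (2 * (1 / ((N : ℝ) + 1)))) ?_ (fun N a => T (N + 1 + a.1) a.2) ?_ ?_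
  rotate_left
  · have := (tendsto_one_div_add_atTop_nhds_zero_nat (𝕜 := ℝ)).const_mul 2
    simpa using ENNReal.tendsto_ofReal this
  · refine Eventually.of_forall fun N a => ?_
    have hq : 0 < N + 1 + a.1 := by omega
    refine (ediam_gridBox_le (hδpos _ hq).le _ _).trans (ENNReal.ofReal_le_ofReal ?_)
    gcongr
    refine (hδinv _ hq).trans ?_
    rw [one_div]
    gcongr
    push_cast
    have : (0 : ℝ) ≤ a.1 := by positivity
    linarith
  · refine Eventually.of_forall fun N x hx => ?_
    obtain ⟨hx, hinf⟩ := hx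
    obtain ⟨⟨p, q⟩, ⟨hq, hlo, hup⟩, hN⟩ := exists_lt_denominator_of_infinite hinf (fun pq hpq i => by
      refine neg_le_and_le_two_mul_of_abs_sub_div_lt (hx i (mem_univ i)) hpq.1 ?_
      exact ((norm_le_pi_norm _ i).trans_lt hpq.2.2).trans_le
        (rpow_neg_div_self_le_one hpq.1 hψ)) N
    dsimp only at hq hlo hup hN
    obtain ⟨i, ε, hi⟩ := exists_abs_sub_le_of_mem_shell hlo hup
    have hp := neg_le_and_le_two_mul_of_abs_sub_div_lt (hx i (mem_univ i)) hq
      (((norm_le_pi_norm _ i).trans_lt hup).trans_le (rpow_neg_div_self_le_one hq hψ))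
    have hKδ : 1 / (K q : ℝ) ≤ δ q := by
      rw [one_div_le (by exact_mod_cast hKpos q hq) (hδpos q hq)]
      exact Nat.le_ceil _
    obtain ⟨g, hg⟩ := exists_mem_gridBox (hKpos q hq) hKδ hx hi
    obtain ⟨k, rfl⟩ := Nat.exists_eq_add_of_le (Nat.succ_le_of_lt hN)
    exact mem_iUnion.2 ⟨⟨k, i, ⟨p i, Finset.mem_Icc.2 hp⟩, ε, g⟩, hg⟩
  refine ne_top_of_le_ne_top ?_ (hle.trans (liminf_le_of_le (by isBoundedDefault)
    (a := ∑' q : ℕ, ENNReal.ofReal (C * (1 / (q : ℝ) ^ 2))) fun b hb => ?_))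
  · have : Summable fun q : ℕ => C * (1 / (q : ℝ) ^ 2) :=
      (Real.summable_one_div_nat_pow.2 (by norm_num)).mul_left C
    exact this.tsum_ofReal_ne_top
  · obtain ⟨N, hN⟩ := hb.exists
    refine hN.trans ?_
    rw [ENNReal.tsum_sigma']
    refine (ENNReal.tsum_le_tsum fun k => hsum (N + 1 + k) (by omega)).trans ?_
    exact ENNReal.tsum_comp_le_tsum_of_injective (add_right_injective (N + 1)) _

/-- The form `q y - a θ - b` in the integers `q`, `a` and the integer vector `b`. -/
def integerForm {d : ℕ} (θ y : Fin d → ℝ) (q a : ℤ) (b : Fin d → ℤ) : Fin d → ℝ :=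
  fun i => q * y i - a * θ i - b i

lemma exists_norm_integerForm_le {d : ℕ} (θ y : Fin d → ℝ) {k : ℕ} (hk : 0 < k) :
    ∃ q a : ℤ, ∃ b : Fin d → ℤ, (q ≠ 0 ∨ a ≠ 0) ∧ |q| ≤ k ^ d ∧ |a| ≤ k ^ d ∧
      ‖integerForm θ y q a b‖ ≤ 1 / (k : ℝ) ^ 2 := by
  have hk2 : (0 : ℝ) < (k : ℝ) ^ 2 := by positivity
  let v : Fin (k ^ d + 1) × Fin (k ^ d + 1) → Fin d → ℝ :=
    fun u i => ((u.1 : ℕ) : ℝ) * y i - ((u.2 : ℕ) : ℝ) * θ i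
  have hlt : ∀ u i, ⌊Int.fract (v u i) * (k : ℝ) ^ 2⌋₊ < k ^ 2 := fun u i => by
    rw [Nat.floor_lt (by have := Int.fract_nonneg (v u i); positivity)]
    push_cast
    have := Int.fract_lt_one (v u i)
    nlinarith
  let f : Fin (k ^ d + 1) × Fin (k ^ d + 1) → (Fin d → Fin (k ^ 2)) := fun u i => ⟨_, hlt u i⟩
  obtain ⟨u, w, huw, hf⟩ := Fintype.exists_ne_map_eq_of_card_lt f (by
    simp only [Fintype.card_pi, Fintype.card_fin, Finset.prod_const, Finset.card_univ,
      Fintype.card_prod]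
    rw [← pow_mul, mul_comm 2 d, pow_mul]
    exact (fun Q => by nlinarith : ∀ Q : ℕ, Q ^ 2 < (Q + 1) * (Q + 1)) _)
  refine ⟨(u.1 : ℕ) - (w.1 : ℕ), (u.2 : ℕ) - (w.2 : ℕ), fun i => ⌊v u i⌋ - ⌊v w i⌋, ?_, ?_, ?_, ?_⟩
  · by_contra! h
    exact huw (Prod.ext (Fin.ext (by omega)) (Fin.ext (by omega)))
  · have h1 := u.1.2
    have h2 := w.1.2
    rw [abs_le]
    zify at h1 h2
    constructor <;> omega
  · have h1 := u.2.2
    have h2 := w.2.2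
    rw [abs_le]
    zify at h1 h2
    constructor <;> omega
  · rw [pi_norm_le_iff_of_nonneg (by positivity)]
    intro i
    have hfi : ⌊Int.fract (v u i) * (k : ℝ) ^ 2⌋₊ = ⌊Int.fract (v w i) * (k : ℝ) ^ 2⌋₊ :=
      Fin.ext_iff.1 (congrFun hf i)
    have e : integerForm θ y ((u.1 : ℕ) - (w.1 : ℕ)) ((u.2 : ℕ) - (w.2 : ℕ))
        (fun i => ⌊v u i⌋ - ⌊v w i⌋) i = Int.fract (v u i) - Int.fract (v w i) := by
      simp only [integerForm, Int.fract, v]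
      push_cast
      ring
    have n1 := Int.fract_nonneg (v u i)
    have n2 := Int.fract_nonneg (v w i)
    have h1 := Nat.floor_le (a := Int.fract (v u i) * (k : ℝ) ^ 2) (by positivity)
    have h2 := Nat.lt_floor_add_one (Int.fract (v u i) * (k : ℝ) ^ 2)
    have h3 := Nat.floor_le (a := Int.fract (v w i) * (k : ℝ) ^ 2) (by positivity)
    have h4 := Nat.lt_floor_add_one (Int.fract (v w i) * (k : ℝ) ^ 2)
    rw [hfi] at h1 h2
    rw [e, Real.norm_eq_abs, le_div_iff₀ hk2, ← abs_of_pos hk2, ← abs_mul, abs_le]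
    constructor <;> nlinarith

lemma integerForm_mul {d : ℕ} (θ y : Fin d → ℝ) (m q a : ℤ) (b : Fin d → ℤ) :
    integerForm θ y (m * q) (m * a) (fun i => m * b i) = (m : ℝ) • integerForm θ y q a b := by
  ext i
  simp only [integerForm, Pi.smul_apply, smul_eq_mul]
  push_cast
  ring

lemma exists_le_max_and_norm_integerForm_le {d : ℕ} (hd : 0 < d) (θ y : Fin d → ℝ) (N : ℕ) :
    ∃ q a : ℤ, ∃ b : Fin d → ℤ, (N : ℤ) < max |q| |a| ∧
      ‖integerForm θ y q a b‖ ≤ ((max |q| |a| : ℤ) : ℝ) ^ (-(2 / d : ℝ)) := by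
  have hd' : (0 : ℝ) < d := by exact_mod_cast hd
  have hmax : ∀ q a : ℤ, (q ≠ 0 ∨ a ≠ 0) → 0 < max |q| |a| := fun q a h => by
    rcases h with h | h
    · exact lt_max_of_lt_left (abs_pos.2 h)
    · exact lt_max_of_lt_right (abs_pos.2 h)
  by_cases hex : ∃ q a : ℤ, ∃ b : Fin d → ℤ, (q ≠ 0 ∨ a ≠ 0) ∧ integerForm θ y q a b = 0
  · obtain ⟨q, a, b, hne, h0⟩ := hex
    refine ⟨(N + 1 : ℤ) * q, (N + 1 : ℤ) * a, fun i => (N + 1 : ℤ) * b i, ?_, ?_⟩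
    · have := hmax q a hne
      rw [abs_mul, abs_mul, ← mul_max_of_nonneg _ _ (abs_nonneg _),
        abs_of_nonneg (by positivity : (0 : ℤ) ≤ N + 1)]
      nlinarith
    · rw [integerForm_mul, h0, smul_zero, norm_zero]
      have : (0 : ℤ) ≤ max |(N + 1 : ℤ) * q| |(N + 1 : ℤ) * a| := le_max_of_le_left (abs_nonneg _)
      have : (0 : ℝ) ≤ ((max |(N + 1 : ℤ) * q| |(N + 1 : ℤ) * a| : ℤ) : ℝ) := by exact_mod_cast this
      positivity
  push Not at hex
  let ρ : ℤ × ℤ → ℝ := fun u =>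
    ‖integerForm θ y u.1 u.2 (fun i => round (u.1 * y i - u.2 * θ i))‖
  have hρ : ∀ q a b, ρ (q, a) ≤ ‖integerForm θ y q a b‖ := fun q a b => by
    rw [pi_norm_le_iff_of_nonneg (norm_nonneg _)]
    exact fun i => (round_le _ (b i)).trans (norm_le_pi_norm (integerForm θ y q a b) i)
  obtain ⟨δ, hδ, hδρ⟩ : ∃ δ > 0, ∀ q a : ℤ, (q ≠ 0 ∨ a ≠ 0) → max |q| |a| ≤ N → δ ≤ ρ (q, a) := by
    let F := ((Finset.Icc (-(N : ℤ)) N) ×ˢ (Finset.Icc (-(N : ℤ)) N)).filter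
      (fun u => u.1 ≠ 0 ∨ u.2 ≠ 0)
    have hF : ∀ q a : ℤ, (q ≠ 0 ∨ a ≠ 0) → max |q| |a| ≤ N → (q, a) ∈ F := fun q a hne h => by
      have h1 := abs_le.1 ((le_max_left _ _).trans h)
      have h2 := abs_le.1 ((le_max_right _ _).trans h)
      simp only [F, Finset.mem_filter, Finset.mem_product, Finset.mem_Icc]
      exact ⟨⟨h1, h2⟩, hne⟩
    rcases F.eq_empty_or_nonempty with h | h
    · exact ⟨1, one_pos, fun q a hne hN => by simpa [h] using hF q a hne hN⟩
    · obtain ⟨u, hu, hmin⟩ := F.exists_min_image ρ h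
      refine ⟨ρ u, norm_pos_iff.2 (hex _ _ _ (Finset.mem_filter.1 hu).2), fun q a hne hN => ?_⟩
      exact hmin _ (hF q a hne hN)
  obtain ⟨k, hk⟩ := exists_nat_one_div_lt hδ
  obtain ⟨q, a, b, hne, hq, ha, hb⟩ := exists_norm_integerForm_le θ y (Nat.succ_pos k)
  refine ⟨q, a, b, ?_, hb.trans ?_⟩
  · by_contra! hN
    have h1 := (hδρ q a hne hN).trans ((hρ q a b).trans hb)
    have h2 : 1 / ((k + 1 : ℕ) : ℝ) ^ 2 ≤ 1 / ((k : ℝ) + 1) := by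
      push_cast
      have : (0 : ℝ) ≤ k := by positivity
      gcongr
      nlinarith
    linarith
  · have hm : (0 : ℝ) < ((max |q| |a| : ℤ) : ℝ) := by exact_mod_cast hmax q a hne
    have hm' : ((max |q| |a| : ℤ) : ℝ) ≤ ((k + 1 : ℕ) : ℝ) ^ d := by exact_mod_cast max_le hq ha
    rw [Real.rpow_neg hm.le, one_div]
    gcongr
    calc ((max |q| |a| : ℤ) : ℝ) ^ (2 / d : ℝ) ≤ (((k + 1 : ℕ) : ℝ) ^ d) ^ (2 / d : ℝ) := by gcongr
      _ = ((k + 1 : ℕ) : ℝ) ^ 2 := by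
        rw [← Real.rpow_natCast, ← Real.rpow_mul (by positivity), mul_div_cancel₀ _ hd'.ne']
        norm_cast

/-- The pairs `(θ, y)` for which `‖q y - a θ - b‖ ≤ q ^ (-2 / d)` has solutions with `|a| ≤ q` and
`q` arbitrarily large. -/
def dirichletPairs (d : ℕ) : Set ((Fin d → ℝ) × (Fin d → ℝ)) :=
  ⋂ N : ℕ, ⋃ q : ℕ, ⋃ a : ℤ, ⋃ b : Fin d → ℤ, {u | N < q ∧ |a| ≤ q ∧
    ‖integerForm u.1 u.2 q a b‖ ≤ (q : ℝ) ^ (-(2 / d : ℝ))}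

lemma mem_dirichletPairs {d : ℕ} {u : (Fin d → ℝ) × (Fin d → ℝ)} :
    u ∈ dirichletPairs d ↔ ∀ N : ℕ, ∃ q : ℕ, ∃ a : ℤ, ∃ b : Fin d → ℤ, N < q ∧ |a| ≤ q ∧
      ‖integerForm u.1 u.2 q a b‖ ≤ (q : ℝ) ^ (-(2 / d : ℝ)) := by
  simp only [dirichletPairs, mem_iInter, mem_iUnion, mem_ofPred_eq]

lemma measurableSet_dirichletPairs (d : ℕ) : MeasurableSet (dirichletPairs d) := by
  refine .iInter fun N => .iUnion fun q => .iUnion fun a => .iUnion fun b =>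
    .inter (.const _) (.inter (.const _) ?_)
  refine (isClosed_le (α := ℝ) ?_ continuous_const).measurableSet
  unfold integerForm
  fun_prop

lemma exists_natAbs_norm_integerForm_le {d : ℕ} {θ y : Fin d → ℝ} {q a : ℤ} {b : Fin d → ℤ} {c : ℝ}
    (h : ‖integerForm θ y q a b‖ ≤ c) :
    ∃ a' : ℤ, ∃ b' : Fin d → ℤ, |a'| = |a| ∧ ‖integerForm θ y (q.natAbs : ℤ) a' b'‖ ≤ c := by
  rcases Int.natAbs_eq q with hq | hq
  · exact ⟨a, b, rfl, by rwa [← hq]⟩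
  · refine ⟨-a, -b, abs_neg a, ?_⟩
    have : integerForm θ y (q.natAbs : ℤ) (-a) (-b) = -integerForm θ y q a b := by
      rw [(by omega : (q.natAbs : ℤ) = -q)]
      ext i
      simp only [integerForm, Pi.neg_apply]
      push_cast
      ring
    rwa [this, norm_neg]

lemma mem_dirichletPairs_or_swap_mem {d : ℕ} (hd : 0 < d) (u : (Fin d → ℝ) × (Fin d → ℝ)) :
    u ∈ dirichletPairs d ∨ u.swap ∈ dirichletPairs d := by
  rw [mem_dirichletPairs, mem_dirichletPairs]
  by_contra! h
  obtain ⟨⟨N, hN⟩, N', hN'⟩ := h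
  obtain ⟨q, a, b, hlt, hle⟩ := exists_le_max_and_norm_integerForm_le hd u.1 u.2 (max N N')
  have hlt' : (N : ℤ) < max |q| |a| ∧ (N' : ℤ) < max |q| |a| := by
    push_cast at hlt
    exact ⟨(le_max_left _ _).trans_lt hlt, (le_max_right _ _).trans_lt hlt⟩
  rcases le_total |a| |q| with h | h
  · rw [max_eq_left h] at hle hlt'
    obtain ⟨a', b', ha', hb'⟩ := exists_natAbs_norm_integerForm_le hle
    have hcast := Int.natCast_natAbs q
    refine (hN q.natAbs a' b' (by omega) (by omega)).not_ge (hb'.trans_eq ?_)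
    congr 1
    rw [Int.cast_abs, Nat.cast_natAbs, Int.cast_abs]
  · rw [max_eq_right h] at hle hlt'
    have e : integerForm u.2 u.1 a q (-b) = -integerForm u.1 u.2 q a b := by
      ext i
      simp only [integerForm, Pi.neg_apply]
      push_cast
      ring
    rw [← norm_neg, ← e] at hle
    obtain ⟨a', b', ha', hb'⟩ := exists_natAbs_norm_integerForm_le hle
    have hcast := Int.natCast_natAbs a
    refine (hN' a.natAbs a' b' (by omega) (by omega)).not_ge (hb'.trans_eq ?_)
    congr 1
    rw [Int.cast_abs, Nat.cast_natAbs, Int.cast_abs]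

lemma exists_volume_dirichletPairs_slice_ne_zero {d : ℕ} (hd : 0 < d) :
    ∃ θ : Fin d → ℝ, volume {y | (θ, y) ∈ dirichletPairs d} ≠ 0 := by
  by_contra! h
  have h0 : (volume : Measure ((Fin d → ℝ) × (Fin d → ℝ))) (dirichletPairs d) = 0 :=
    (Measure.measure_prod_null (measurableSet_dirichletPairs d)).2 (Eventually.of_forall h)
  have h1 : (volume : Measure ((Fin d → ℝ) × (Fin d → ℝ))) (Prod.swap ⁻¹' dirichletPairs d) = 0 := by
    rw [Measure.volume_eq_prod, Measure.measurePreserving_swap.measure_preimage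
      (measurableSet_dirichletPairs d).nullMeasurableSet]
    exact h0
  have h2 := measure_union_null h0 h1
  have hu : dirichletPairs d ∪ Prod.swap ⁻¹' dirichletPairs d = univ :=
    eq_univ_of_forall fun u => mem_dirichletPairs_or_swap_mem hd u
  rw [hu] at h2
  exact isOpen_univ.measure_ne_zero _ univ_nonempty h2

theorem measure_compl_eq_zero_of_dense_invariant {E : Type*} [NormedAddCommGroup E] [ProperSpace E]
    [MeasurableSpace E] [BorelSpace E] {μ : Measure E} [μ.IsAddHaarMeasure]
    [IsUnifLocDoublingMeasure μ] {A G : Set E} (hA : NullMeasurableSet A μ) (h0 : μ A ≠ 0)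
    (hG : Dense G) (hinv : ∀ g ∈ G, (fun y => g + y) ⁻¹' A = A) : μ Aᶜ = 0 := by
  by_contra h1
  have hne : ∀ {S : Set E}, μ S ≠ 0 → (ae (μ.restrict S)).NeBot := fun hS =>
    ae_neBot.2 (Measure.restrict_eq_zero.not.2 hS)
  have := hne h0
  have := hne h1
  obtain ⟨x, hx⟩ := (IsUnifLocDoublingMeasure.ae_tendsto_measure_inter_div μ A 1).exists
  obtain ⟨y, hy⟩ := (IsUnifLocDoublingMeasure.ae_tendsto_measure_inter_div μ Aᶜ 1).exists
  let δ : ℕ → ℝ := fun j => 1 / ((j : ℝ) + 1)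
  have hδpos : ∀ j, 0 < δ j := fun j => by positivity
  have hδ : Tendsto δ atTop (nhdsWithin 0 (Ioi 0)) :=
    tendsto_nhdsWithin_iff.2 ⟨tendsto_one_div_add_atTop_nhds_zero_nat,
      Eventually.of_forall hδpos⟩
  choose g hgG hg using fun j => hG.exists_dist_lt (y - x) (hδpos j)
  have hx' := hx (fun _ => x) δ hδ (Eventually.of_forall fun j => by simp [(hδpos j).le])
  have hy' := hy (fun j => g j + x) δ hδ (Eventually.of_forall fun j => by
    have e : dist y (g j + x) = dist (y - x) (g j) := by
      rw [dist_eq_norm, dist_eq_norm]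
      congr 1
      abel
    rw [one_mul, Metric.mem_closedBall, e]
    exact (hg j).le)
  have hball : ∀ j, (fun z => g j + z) ⁻¹' Metric.closedBall (g j + x) (δ j) =
      Metric.closedBall x (δ j) := fun j => by
    ext z
    simp
  have hshift : ∀ j, μ (A ∩ Metric.closedBall x (δ j)) / μ (Metric.closedBall x (δ j)) =
      μ (A ∩ Metric.closedBall (g j + x) (δ j)) / μ (Metric.closedBall (g j + x) (δ j)) := fun j => by
    rw [← measure_preimage_add μ (g j) (A ∩ Metric.closedBall (g j + x) (δ j)),
      ← measure_preimage_add μ (g j) (Metric.closedBall (g j + x) (δ j)),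
      preimage_inter, hinv _ (hgG j), hball]
  have hsum := hx'.add hy'
  have hone : ∀ j, μ (A ∩ Metric.closedBall x (δ j)) / μ (Metric.closedBall x (δ j)) +
      μ (Aᶜ ∩ Metric.closedBall (g j + x) (δ j)) / μ (Metric.closedBall (g j + x) (δ j)) = 1 :=
    fun j => by
      rw [hshift, ← ENNReal.add_div, inter_comm A, inter_comm Aᶜ, ← Set.sdiff_eq,
        measure_inter_add_sdiff₀ _ hA]
      exact ENNReal.div_self (Metric.measure_closedBall_pos μ _ (hδpos j)).ne'
        (isCompact_closedBall _ _).measure_lt_top.ne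
  simp only [hone] at hsum
  have := tendsto_nhds_unique hsum tendsto_const_nhds
  norm_num at this

/-- The points `(a θ + b) / q` with `a / q ∈ I`. -/
def rationalShadow {d : ℕ} (θ : Fin d → ℝ) (I : Set ℝ) (q : ℕ) : Set (Fin d → ℝ) :=
  {z | ∃ a : ℤ, ∃ b : Fin d → ℤ, (a : ℝ) / q ∈ I ∧ z = fun i => (a * θ i + b i) / q}

/-- The approximation radius `q ^ (-(1 + 2 / d))`. -/
noncomputable def shadowRadius (d q : ℕ) : ℝ := (q : ℝ) ^ (-(1 + 2 / d : ℝ))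

/-- The points which are, up to a constant, `shadowRadius d q`-close to `rationalShadow θ I q` for
infinitely many `q`. -/
def shadowApproximable {d : ℕ} (θ : Fin d → ℝ) (I : Set ℝ) : Set (Fin d → ℝ) :=
  {y | ∃ C : ℕ, ∃ᶠ q : ℕ in atTop, ∃ z ∈ rationalShadow θ I q, dist y z ≤ (C + 1) * shadowRadius d q}

/-- The limsup set of the closed `shadowRadius d q / 2`-neighbourhoods of `rationalShadow θ I q`. -/
def shadowLimsup {d : ℕ} (θ : Fin d → ℝ) (I : Set ℝ) : Set (Fin d → ℝ) :=
  limsup (fun q : ℕ => Metric.cthickening (1 / 2 * shadowRadius d q) (rationalShadow θ I q)) atTop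

lemma shadowRadius_pos (d : ℕ) {q : ℕ} (hq : 0 < q) : 0 < shadowRadius d q := by
  have : (0 : ℝ) < q := by exact_mod_cast hq
  unfold shadowRadius
  positivity

lemma tendsto_shadowRadius (d : ℕ) : Tendsto (shadowRadius d) atTop (nhds 0) :=
  (tendsto_rpow_neg_atTop (by positivity)).comp tendsto_natCast_atTop_atTop

lemma exists_dist_lt_of_mem_shadowLimsup {d : ℕ} {θ : Fin d → ℝ} {I : Set ℝ} {y : Fin d → ℝ}
    (hy : y ∈ shadowLimsup θ I) :
    ∃ᶠ q : ℕ in atTop, ∃ z ∈ rationalShadow θ I q, dist y z < shadowRadius d q := by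
  refine ((mem_limsup_iff_frequently_mem.1 hy).and_eventually (eventually_gt_atTop 0)).mono
    fun q ⟨hq, hq0⟩ => ?_
  have hr := shadowRadius_pos d hq0
  exact Metric.mem_thickening_iff.1
    (Metric.cthickening_subset_thickening' hr (by linarith) _ hq)

lemma shadowApproximable_ae_eq {d : ℕ} (θ : Fin d → ℝ) (I : Set ℝ) :
    shadowApproximable θ I =ᵐ[volume] shadowLimsup θ I := by
  have key : ∀ M : ℝ, 0 < M →
      (limsup (fun q : ℕ => Metric.cthickening (M * shadowRadius d q) (rationalShadow θ I q)) atTop :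
        Set (Fin d → ℝ)) =ᵐ[volume]
      (limsup (fun q : ℕ => Metric.cthickening (shadowRadius d q) (rationalShadow θ I q)) atTop :
        Set (Fin d → ℝ)) := fun M hM => by
    simpa only [blimsup_true] using blimsup_cthickening_mul_ae_eq volume (fun _ => True)
      (rationalShadow θ I) hM (shadowRadius d) (tendsto_shadowRadius d)
  refine Filter.EventuallyLE.antisymm ?_ ?_
  · have hsub : shadowApproximable θ I ⊆ ⋃ C : ℕ, limsup (fun q : ℕ =>
        Metric.cthickening (((C : ℝ) + 1) * shadowRadius d q) (rationalShadow θ I q)) atTop := by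
      rintro y ⟨C, hC⟩
      refine mem_iUnion.2 ⟨C, mem_limsup_iff_frequently_mem.2 (hC.mono fun q hq => ?_)⟩
      obtain ⟨z, hz, hyz⟩ := hq
      exact Metric.mem_cthickening_of_dist_le y z _ _ hz hyz
    refine (LE.le.eventuallyLE hsub).trans ?_
    have hU : ∀ C : ℕ, ∀ᵐ y : Fin d → ℝ, y ∈ (limsup (fun q : ℕ =>
        Metric.cthickening (((C : ℝ) + 1) * shadowRadius d q) (rationalShadow θ I q)) atTop :
        Set (Fin d → ℝ)) → y ∈ shadowLimsup θ I := fun C =>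
      ((key _ (by positivity)).trans (key (1 / 2) (by norm_num)).symm).le
    filter_upwards [ae_all_iff.2 hU] with y hy hyU
    obtain ⟨C, hC⟩ := mem_iUnion.1 hyU
    exact hy C hC
  · refine LE.le.eventuallyLE fun y hy => ⟨0, ?_⟩
    refine (exists_dist_lt_of_mem_shadowLimsup hy).mono fun q ⟨z, hz, hyz⟩ => ⟨z, hz, ?_⟩
    simpa using hyz.le

lemma nullMeasurableSet_shadowApproximable {d : ℕ} (θ : Fin d → ℝ) (I : Set ℝ) :
    NullMeasurableSet (shadowApproximable θ I) volume :=
  (MeasurableSet.measurableSet_limsup fun _ =>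
    Metric.isClosed_cthickening.measurableSet).nullMeasurableSet.congr
      (shadowApproximable_ae_eq θ I).symm

lemma add_mem_shadowApproximable {d : ℕ} {θ : Fin d → ℝ} {I I' : Set ℝ} {m : ℕ} (hm : 0 < m) (j : ℤ)
    (u : Fin d → ℤ) (hI : ∀ t ∈ I, t + j / m ∈ I') {y : Fin d → ℝ}
    (hy : y ∈ shadowApproximable θ I) :
    (fun i => (j * θ i + u i) / m) + y ∈ shadowApproximable θ I' := by
  obtain ⟨C, hC⟩ := hy
  have hm' : (0 : ℝ) < m := by exact_mod_cast hm
  refine ⟨⌈((C : ℝ) + 1) * (m : ℝ) ^ (1 + 2 / d : ℝ)⌉₊, ?_⟩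
  have hmap : Tendsto (fun q : ℕ => m * q) atTop atTop := tendsto_id.const_mul_atTop' hm
  refine hmap.frequently ((hC.and_eventually (eventually_gt_atTop 0)).mono ?_)
  rintro q ⟨⟨z, ⟨a, b, ha, rfl⟩, hz⟩, hq⟩
  have hq' : (0 : ℝ) < q := by exact_mod_cast hq
  refine ⟨_, ⟨m * a + j * q, fun i => m * b i + q * u i, ?_, rfl⟩, ?_⟩
  · convert hI _ ha using 1
    push_cast
    field_simp
  · have e : (fun i => ((((m * a + j * q : ℤ) : ℝ) * θ i + ((m * b i + q * u i : ℤ) : ℝ)) /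
        ((m * q : ℕ) : ℝ))) = (fun i => (j * θ i + u i) / m) + fun i => (a * θ i + b i) / q := by
      ext i
      simp only [Pi.add_apply]
      push_cast
      field_simp
      ring
    rw [e, dist_add_left]
    refine hz.trans ?_
    have hr : shadowRadius d q = (m : ℝ) ^ (1 + 2 / d : ℝ) * shadowRadius d (m * q) := by
      unfold shadowRadius
      rw [Nat.cast_mul, Real.mul_rpow hm'.le hq'.le, ← mul_assoc, ← Real.rpow_add hm']
      simp
    rw [hr, ← mul_assoc]
    gcongr
    · exact (shadowRadius_pos d (Nat.mul_pos hm hq)).le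
    · exact (Nat.le_ceil _).trans (by simp)

lemma volume_compl_shadowApproximable_eq_zero {d : ℕ} {θ : Fin d → ℝ} {I : Set ℝ}
    (h : volume (shadowApproximable θ I) ≠ 0) : volume (shadowApproximable θ I)ᶜ = 0 := by
  refine measure_compl_eq_zero_of_dense_invariant (nullMeasurableSet_shadowApproximable θ I) h
    (G := {g | ∃ m : ℕ, 0 < m ∧ ∃ u : Fin d → ℤ, g = fun i => (u i : ℝ) / m}) ?_ ?_
  · rw [Metric.dense_iff]
    intro x ε hε
    obtain ⟨k, hk⟩ := exists_nat_one_div_lt hε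
    have hk0 : (0 : ℝ) < (k : ℝ) + 1 := by positivity
    refine ⟨fun i => (round (((k : ℝ) + 1) * x i) : ℝ) / ((k + 1 : ℕ) : ℝ), ?_, k + 1, k.succ_pos,
      fun i => round (((k : ℝ) + 1) * x i), rfl⟩
    rw [Metric.mem_ball, dist_pi_lt_iff hε]
    intro i
    refine lt_of_le_of_lt ?_ hk
    rw [dist_comm, Real.dist_eq, le_div_iff₀ hk0]
    have h1 := abs_sub_round (((k : ℝ) + 1) * x i)
    nth_rewrite 2 [← abs_of_pos hk0]
    rw [← abs_mul]
    push_cast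
    rw [sub_mul, div_mul_cancel₀ _ hk0.ne', mul_comm (x i)]
    linarith
  · rintro _ ⟨m, hm, u, rfl⟩
    ext y
    constructor
    · intro hy
      have := add_mem_shadowApproximable (I' := I) hm 0 (-u) (by simp) hy
      convert this using 1
      ext i
      simp only [Pi.add_apply, Pi.neg_apply]
      push_cast
      ring
    · intro hy
      have := add_mem_shadowApproximable (I' := I) hm 0 u (by simp) hy
      rw [mem_preimage]
      convert this using 1
      ext i
      simp

lemma exists_mem_shadowApproximable_of_mem_dirichletPairs {d : ℕ} {θ y : Fin d → ℝ}
    (h : (θ, y) ∈ dirichletPairs d) {m : ℕ} (hm : 0 < m) :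
    ∃ j : ℤ, y ∈ shadowApproximable θ (Ico (j / m : ℝ) ((j + 1) / m)) := by
  have hm' : (0 : ℝ) < m := by exact_mod_cast hm
  rw [mem_dirichletPairs] at h
  by_contra! hcon
  have hev : ∀ j ∈ Finset.Icc (-(m : ℤ)) m, ∀ᶠ q : ℕ in atTop,
      ¬ ∃ z ∈ rationalShadow θ (Ico (j / m : ℝ) ((j + 1) / m)) q, dist y z ≤ shadowRadius d q :=
    fun j _ => not_frequently.1 fun hf => hcon j ⟨0, by simpa using hf⟩
  obtain ⟨N, hN⟩ := eventually_atTop.1 ((Filter.eventually_all_finset _).2 hev)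
  obtain ⟨q, a, b, hq, ha, hle⟩ := h N
  have hq0 : 0 < q := by omega
  have hq' : (0 : ℝ) < q := by exact_mod_cast hq0
  have ha1 : -(q : ℝ) ≤ a ∧ (a : ℝ) ≤ q := by exact_mod_cast abs_le.1 ha
  have h1 := Int.floor_le ((a : ℝ) / q * m)
  have h2 := Int.lt_floor_add_one ((a : ℝ) / q * m)
  have ha2 : -1 ≤ (a : ℝ) / q := by rw [le_div_iff₀ hq']; linarith
  have ha3 : (a : ℝ) / q ≤ 1 := by rw [div_le_one hq']; linarith
  refine hN q hq.le ⌊(a : ℝ) / q * m⌋ (Finset.mem_Icc.2 ⟨?_, ?_⟩) ⟨_, ⟨a, b, ⟨?_, ?_⟩, rfl⟩, ?_⟩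
  · rw [Int.le_floor]; push_cast; nlinarith
  · have : (⌊(a : ℝ) / q * m⌋ : ℝ) ≤ (m : ℤ) := by push_cast; nlinarith
    exact_mod_cast this
  · rwa [div_le_iff₀ hm']
  · rwa [lt_div_iff₀ hm']
  · have e : y - (fun i => (a * θ i + b i) / q) =
        (q : ℝ)⁻¹ • integerForm θ y q a b := by
      ext i
      simp only [integerForm, Pi.sub_apply, Pi.smul_apply, smul_eq_mul]
      push_cast
      field_simp
      ring
    rw [dist_eq_norm, e, norm_smul, norm_inv, Real.norm_of_nonneg hq'.le, shadowRadius, neg_add,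
      Real.rpow_add hq', Real.rpow_neg_one]
    gcongr

theorem exists_ae_mem_shadowLimsup {d : ℕ} (hd : 0 < d) :
    ∃ θ : Fin d → ℝ, ∀ᵐ y : Fin d → ℝ, ∀ m : ℕ, 0 < m → ∀ j : ℤ,
      y ∈ shadowLimsup θ (Ico (j / m : ℝ) ((j + 1) / m)) := by
  obtain ⟨θ, hθ⟩ := exists_volume_dirichletPairs_slice_ne_zero hd
  refine ⟨θ, ?_⟩
  simp only [ae_all_iff]
  intro m hm j
  have hae : ∀ᵐ y : Fin d → ℝ, y ∈ shadowApproximable θ (Ico (j / m : ℝ) ((j + 1) / m)) := by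
    obtain ⟨k, hk⟩ : ∃ k : ℤ,
        volume (shadowApproximable θ (Ico (k / m : ℝ) ((k + 1) / m))) ≠ 0 := by
      by_contra! hcon
      exact hθ (measure_mono_null (fun y hy => mem_iUnion.2
        (exists_mem_shadowApproximable_of_mem_dirichletPairs hy hm)) (measure_iUnion_null hcon))
    have hk' := volume_compl_shadowApproximable_eq_zero hk
    let v : Fin d → ℝ := fun i => ((k - j : ℤ) * θ i + (0 : ℤ)) / m
    rw [← measure_preimage_add volume v] at hk'
    filter_upwards [measure_eq_zero_iff_ae_notMem.1 hk'] with y hy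
    replace hy : v + y ∈ shadowApproximable θ (Ico (k / m : ℝ) ((k + 1) / m)) := not_not.1 hy
    have := add_mem_shadowApproximable (I' := Ico (j / m : ℝ) ((j + 1) / m)) hm (j - k) 0 (by
      rintro t ⟨h1, h2⟩
      push_cast
      rw [sub_div]
      rw [add_div] at h2 ⊢
      constructor <;> linarith) hy
    convert this using 1
    ext i
    simp only [v, Pi.add_apply, Pi.zero_apply]
    push_cast
    ring
  filter_upwards [hae, shadowApproximable_ae_eq θ (Ico (j / m : ℝ) ((j + 1) / m))] with y h1 h2
  exact (eq_iff_iff.1 h2).1 h1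

/-- The line through `(0, y)` in direction `(1, -θ)`, parametrized by its first coordinate. -/
def lineOver {d : ℕ} (θ y : Fin d → ℝ) (t : ℝ) : Fin (d + 1) → ℝ :=
  Fin.cons t fun i => y i - t * θ i

lemma continuous_lineOver {d : ℕ} (θ y : Fin d → ℝ) : Continuous (lineOver θ y) :=
  continuous_pi <| Fin.cases continuous_id fun i =>
    show Continuous fun t : ℝ => y i - t * θ i by fun_prop

/-- The parameters `t` for which `lineOver θ y t` lies in a shell of denominator larger than `N`. -/
def lineShells {d : ℕ} (τψ τφ : ℝ) (θ y : Fin d → ℝ) (N : ℕ) : Set ℝ :=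
  ⋃ q : ℕ, ⋃ _ : N < q, ⋃ p : Fin (d + 1) → ℤ,
    {t | (1 - (q : ℝ) ^ (-τφ)) * ((q : ℝ) ^ (-τψ) / q) <
        ‖lineOver θ y t - fun i => (p i : ℝ) / q‖ ∧
      ‖lineOver θ y t - fun i => (p i : ℝ) / q‖ < (q : ℝ) ^ (-τψ) / q}

lemma isOpen_lineShells {d : ℕ} (τψ τφ : ℝ) (θ y : Fin d → ℝ) (N : ℕ) :
    IsOpen (lineShells τψ τφ θ y N) := by
  have hc (p : Fin (d + 1) → ℤ) (q : ℕ) :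
      Continuous fun t => ‖lineOver θ y t - fun i => (p i : ℝ) / q‖ :=
    ((continuous_lineOver θ y).sub continuous_const).norm
  exact isOpen_iUnion fun q => isOpen_iUnion fun _ => isOpen_iUnion fun p =>
    (isOpen_lt continuous_const (hc p q)).inter (isOpen_lt (hc p q) continuous_const)

lemma exists_mem_Icc_lt_and_lt {f : ℝ → ℝ} (hf : Continuous f) {a b r R : ℝ} (hab : a ≤ b)
    (hr : r < R) (ha : f a < R) (hb : R < f b) : ∃ t ∈ Icc a b, r < f t ∧ f t < R := by
  obtain ⟨c, hc, hcR⟩ := exists_between (max_lt hr ha)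
  obtain ⟨t, ht, rfl⟩ := intermediate_value_Icc hab hf.continuousOn
    ⟨((le_max_right _ _).trans_lt hc).le, (hcR.trans hb).le⟩
  exact ⟨t, ht, (le_max_left _ _).trans_lt hc, hcR⟩

lemma dense_lineShells {d : ℕ} {τψ τφ : ℝ} (hψ : 0 ≤ τψ) (h2 : τψ ≤ 2 / d) {θ y : Fin d → ℝ}
    (hy : ∀ m : ℕ, 0 < m → ∀ j : ℤ, y ∈ shadowLimsup θ (Ico (j / m : ℝ) ((j + 1) / m))) (N : ℕ) :
    Dense (lineShells τψ τφ θ y N) := by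
  refine dense_of_exists_between fun {u v} huv => ?_
  obtain ⟨k, hk⟩ := exists_nat_one_div_lt (show 0 < (v - u) / 3 by linarith)
  set m := k + 1 with hm
  have hm0 : 0 < m := k.succ_pos
  have hm' : (0 : ℝ) < m := by exact_mod_cast hm0
  have hmk : 1 / (m : ℝ) < (v - u) / 3 := by rw [hm]; push_cast; exact hk
  set j := ⌊u * m⌋ + 1 with hj
  have hj1 : u < (j : ℝ) / m := by
    rw [lt_div_iff₀ hm', hj]
    push_cast
    exact Int.lt_floor_add_one _
  have hj2 : (j : ℝ) / m ≤ u + 1 / m := by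
    rw [div_le_iff₀ hm', add_mul, div_mul_cancel₀ _ hm'.ne', hj]
    push_cast
    linarith [Int.floor_le (u * m)]
  obtain ⟨q, ⟨z, ⟨a, b, hI, rfl⟩, hz⟩, hq⟩ :=
    ((exists_dist_lt_of_mem_shadowLimsup (hy m hm0 j)).and_eventually
      (eventually_gt_atTop (max m N))).exists
  have hqm : m < q := (le_max_left _ _).trans_lt hq
  have hqN : N < q := (le_max_right _ _).trans_lt hq
  have hq0 : (0 : ℝ) < q := by exact_mod_cast hm0.trans hqm
  have hq1 : (1 : ℝ) ≤ q := by exact_mod_cast hm0.trans hqm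
  have hR : 0 < (q : ℝ) ^ (-τψ) / q := by positivity
  have hRm : (q : ℝ) ^ (-τψ) / q < 1 / m :=
    (div_le_div_of_nonneg_right (Real.rpow_le_one_of_one_le_of_nonpos hq1 (by linarith))
      hq0.le).trans_lt (one_div_lt_one_div_of_lt hm' (by exact_mod_cast hqm))
  have hradius : shadowRadius d q ≤ (q : ℝ) ^ (-τψ) / q := by
    rw [shadowRadius, ← Real.rpow_sub_one hq0.ne']
    exact Real.rpow_le_rpow_of_exponent_le hq1 (by linarith)
  let p : Fin (d + 1) → ℤ := Fin.cons a b
  have hleft : ‖lineOver θ y (a / q) - fun i => (p i : ℝ) / q‖ < (q : ℝ) ^ (-τψ) / q := by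
    refine lt_of_lt_of_le ?_ hradius
    rw [dist_eq_norm] at hz
    have hr := (norm_nonneg _).trans_lt hz
    rw [pi_norm_lt_iff hr] at hz ⊢
    refine Fin.cases ?_ fun i => ?_
    · simpa [lineOver, p] using hr
    · convert hz i using 2
      simp only [lineOver, p, Pi.sub_apply, Fin.cons_succ]
      ring
  have hright : (q : ℝ) ^ (-τψ) / q <
      ‖lineOver θ y ((j + 1) / m + 1 / m) - fun i => (p i : ℝ) / q‖ := by
    have h0 := norm_le_pi_norm
      (lineOver θ y ((j + 1) / m + 1 / m) - fun i => (p i : ℝ) / q) 0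
    simp only [lineOver, p, Pi.sub_apply, Fin.cons_zero] at h0
    exact hRm.trans (lt_of_lt_of_le (by linarith [hI.2]) ((Real.le_norm_self _).trans h0))
  obtain ⟨t, ht, ht1, ht2⟩ := exists_mem_Icc_lt_and_lt
    (((continuous_lineOver θ y).sub continuous_const).norm)
    (show (a : ℝ) / q ≤ (j + 1) / m + 1 / m by linarith [hI.2, one_div_pos.2 hm'])
    (show (1 - (q : ℝ) ^ (-τφ)) * ((q : ℝ) ^ (-τψ) / q) < (q : ℝ) ^ (-τψ) / q by
      have : 0 < (q : ℝ) ^ (-τφ) := by positivity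
      nlinarith) hleft hright
  refine ⟨t, ?_, hj1.trans_le (hI.1.trans ht.1), ht.2.trans_lt ?_⟩
  · simp only [lineShells, mem_iUnion]
    exact ⟨q, hqN, p, ht1, ht2⟩
  · rw [add_div]
    linarith

lemma infinite_of_mem_iInter_lineShells {d : ℕ} {τψ τφ : ℝ} {θ y : Fin d → ℝ} {t : ℝ}
    (ht : t ∈ ⋂ N, lineShells τψ τφ θ y N) :
    {pq : (Fin (d + 1) → ℤ) × ℕ | 0 < pq.2 ∧
      (1 - (pq.2 : ℝ) ^ (-τφ)) * ((pq.2 : ℝ) ^ (-τψ) / pq.2) <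
        ‖lineOver θ y t - fun i => (pq.1 i : ℝ) / pq.2‖ ∧
      ‖lineOver θ y t - fun i => (pq.1 i : ℝ) / pq.2‖ < (pq.2 : ℝ) ^ (-τψ) / pq.2}.Infinite := by
  refine Infinite.of_image Prod.snd (infinite_of_forall_exists_gt fun N => ?_)
  have h := mem_iInter.1 ht N
  simp only [lineShells, mem_iUnion] at h
  obtain ⟨q, hq, p, hp⟩ := h
  exact ⟨q, ⟨(p, q), ⟨(Nat.zero_le N).trans_lt hq, hp⟩, rfl⟩, hq⟩

theorem le_dimH_Wpsiphi {d : ℕ} (hd : 0 < d) {τψ τφ : ℝ} (hψ : 0 ≤ τψ) (h2 : τψ ≤ 2 / d) :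
    (d : ENNReal) ≤
      dimH (Wpsiphi (d + 1) (fun q => (q : ℝ) ^ (-τψ)) (fun q => (q : ℝ) ^ (-τφ))) := by
  obtain ⟨θ, hθ⟩ := exists_ae_mem_shadowLimsup hd
  set W := Wpsiphi (d + 1) (fun q => (q : ℝ) ^ (-τψ)) (fun q => (q : ℝ) ^ (-τφ))
  let π : (Fin (d + 1) → ℝ) →ₗ[ℝ] Fin d → ℝ :=
    { toFun := fun x i => x i.succ + x 0 * θ i
      map_add' := fun x x' => by
        ext i
        simp only [Pi.add_apply]
        ring
      map_smul' := fun c x => by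
        ext i
        simp only [Pi.smul_apply, smul_eq_mul, RingHom.id_apply]
        ring }
  have hLip := (LinearMap.toContinuousLinearMap π).lipschitz
  let B : Set (Fin d → ℝ) := univ.pi fun _ => Ioo (1 / 4) (3 / 4)
  have hB : volume B ≠ 0 :=
    ((isOpen_set_pi finite_univ fun _ _ => isOpen_Ioo).measure_pos volume
      ⟨fun _ => 1 / 2, fun _ _ => by norm_num⟩).ne'
  have hsub : ∀ᵐ y : Fin d → ℝ, y ∈ B → y ∈ LinearMap.toContinuousLinearMap π '' W := by
    filter_upwards [hθ] with y hy hyB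
    let ε : ℝ := 1 / (4 * (1 + ‖θ‖))
    have hε : 0 < ε := by positivity
    obtain ⟨t, ht, ht0, htε⟩ := (dense_iInter_of_isOpen_nat (isOpen_lineShells τψ τφ θ y)
      (dense_lineShells hψ h2 hy)).exists_between hε
    have htθ : t * (1 + ‖θ‖) < 1 / 4 := by
      rw [lt_div_iff₀ (by positivity)] at htε
      linarith
    refine ⟨lineOver θ y t, ⟨fun i _ => ?_, infinite_of_mem_iInter_lineShells ht⟩, ?_⟩
    · induction i using Fin.cases with
      | zero =>
        refine ⟨ht0.le, ?_⟩
        simp only [lineOver, Fin.cons_zero]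
        nlinarith [norm_nonneg θ]
      | succ i =>
        have hi := hyB i (mem_univ i)
        have h1 : |t * θ i| ≤ 1 / 4 := by
          rw [abs_mul, abs_of_pos ht0]
          have := norm_le_pi_norm θ i
          rw [Real.norm_eq_abs] at this
          nlinarith
        rw [abs_le] at h1
        simp only [lineOver, Fin.cons_succ]
        constructor <;> linarith [hi.1, hi.2]
    · ext i
      simp [π, lineOver]
  have hvol : volume (LinearMap.toContinuousLinearMap π '' W) ≠ 0 := fun h0 => hB <|
    measure_mono_null_ae hsub h0
  rw [← hausdorffMeasure_pi_real, Fintype.card_fin] at hvol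
  have := le_dimH_of_hausdorffMeasure_ne_zero (d := (d : NNReal)) (by simpa using hvol)
  refine le_trans ?_ (this.trans (hLip.dimH_image_le W))
  simp

theorem stmt12 (n : ℕ) (hn : 2 ≤ n) (τψ : ℝ)
    (h1 : (1 : ℝ) / n ≤ τψ) (h2 : τψ ≤ 2 / ((n : ℝ) - 1)) :
    Tendsto
      (fun τφ : ℝ =>
        dimH (Wpsiphi n (fun q => (q : ℝ) ^ (-τψ)) (fun q => (q : ℝ) ^ (-τφ))))
      atTop (nhds (ENNReal.ofReal ((n : ℝ) - 1))) := by
  obtain ⟨d, rfl⟩ : ∃ d, n = d + 1 := ⟨n - 1, by omega⟩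
  have hd : 0 < d := by omega
  have hψ : 0 ≤ τψ := le_trans (by positivity) h1
  rw [Nat.cast_add_one, add_sub_cancel_right] at h2 ⊢
  rw [ENNReal.ofReal_natCast, tendsto_order]
  refine ⟨fun a ha => Eventually.of_forall fun τφ => ha.trans_le (le_dimH_Wpsiphi hd hψ h2),
    fun a ha => ?_⟩
  obtain ⟨s, hs, hsa⟩ := ENNReal.lt_iff_exists_nnreal_btwn.1 ha
  have hs' : (d : ℝ) < s := by exact_mod_cast hs
  filter_upwards [eventually_ge_atTop 1, eventually_ge_atTop (3 / ((s : ℝ) - d))] with τφ hφ hφ'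
  rw [div_le_iff₀' (sub_pos.2 hs')] at hφ'
  exact (dimH_Wpsiphi_le hψ hφ hs' hφ').trans_lt hsa
end

section
/- Let n ≥ 2, let ψ(q) = q^{-τ_ψ} with τ_ψ ≥ 2/(n-1), and let φ(q) = q^{-τ_φ} for any τ_φ > 0. Then dim_H W_n(ψ,φ) = (n+1)/(1+τ_ψ). -/
open MeasureTheory Filter Set

open scoped ENNReal NNReal Topology

theorem lintegral_fin_pi_prod {n : ℕ} (μ : Fin n → Measure ℝ) [∀ i, SigmaFinite (μ i)]
    (f : Fin n → ℝ → ℝ≥0∞) (hf : ∀ i, Measurable (f i)) :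
    ∫⁻ x, ∏ i, f i (x i) ∂(Measure.pi μ) = ∏ i, ∫⁻ t, f i t ∂(μ i) := by
  induction n with
  | zero => simp
  | succ n ih =>
    have hm := (measurePreserving_piFinSuccAbove μ 0).symm
    rw [← hm.lintegral_comp (by fun_prop)]
    simp_rw [MeasurableEquiv.piFinSuccAbove_symm_apply, Fin.insertNthEquiv,
      Fin.prod_univ_succ, Fin.insertNth_zero]
    simp only [Fin.zero_succAbove, Equiv.coe_fn_mk, Fin.cons_zero, Fin.cons_succ, cast_eq]
    rw [lintegral_prod_mul (f := f 0) (g := fun y : Fin n → ℝ => ∏ j, f j.succ (y j))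
      (hf 0).aemeasurable (Finset.measurable_fun_prod _ fun j _ =>
        (hf j.succ).comp (measurable_pi_apply j)).aemeasurable, ih _ _ fun i => hf _]

theorem setLIntegral_fin_pi_prod {n : ℕ} (s : Fin n → Set ℝ)
    (f : Fin n → ℝ → ℝ≥0∞) (hf : ∀ i, Measurable (f i)) :
    ∫⁻ x in univ.pi s, ∏ i, f i (x i) = ∏ i, ∫⁻ t in s i, f i t := by
  rw [volume_pi, Measure.restrict_pi_pi, lintegral_fin_pi_prod _ _ hf]

theorem Function.Periodic.setLIntegral_Ioc_eq {P : ℝ → ℝ≥0∞} {T : ℝ} (hP : Function.Periodic P T)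
    (hT : 0 < T) (a b : ℝ) : ∫⁻ v in Ioc a (a + T), P v = ∫⁻ v in Ioc b (b + T), P v := by
  refine (isAddFundamentalDomain_Ioc hT a).setLIntegral_eq (isAddFundamentalDomain_Ioc hT b) _ ?_
  rintro ⟨g, hg⟩ x
  obtain ⟨k, rfl⟩ := AddSubgroup.mem_zmultiples_iff.1 hg
  rw [AddSubgroup.mk_vadd, vadd_eq_add, add_comm]
  exact hP.zsmul k x

theorem Function.Periodic.setLIntegral_Ioc_nat {P : ℝ → ℝ≥0∞} {T : ℝ} (hP : Function.Periodic P T)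
    (hT : 0 < T) (a : ℝ) (m : ℕ) :
    ∫⁻ v in Ioc a (a + m * T), P v = m * ∫⁻ v in Ioc 0 T, P v := by
  induction m with
  | zero => simp
  | succ m ih =>
    have h0 : 0 ≤ (m : ℝ) * T := by positivity
    rw [← Ioc_union_Ioc_eq_Ioc (b := a + m * T) (by linarith) (by push_cast; linarith),
      lintegral_union measurableSet_Ioc (Ioc_disjoint_Ioc_of_le le_rfl), ih]
    have : a + ((m + 1 : ℕ) : ℝ) * T = a + m * T + T := by push_cast; ring
    rw [this, hP.setLIntegral_Ioc_eq hT _ 0, zero_add]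
    push_cast; ring

/-- `P` is a `T`-periodic measurable function of mean one. -/
structure MeanOnePeriodic (P : ℝ → ℝ≥0∞) (T : ℝ) : Prop where
  measurable : Measurable P
  pos : 0 < T
  periodic : Function.Periodic P T
  lintegral_eq : ∫⁻ v in Ioc 0 T, P v = ENNReal.ofReal T

namespace MeanOnePeriodic

variable {P : ℝ → ℝ≥0∞} {T : ℝ}

theorem lintegral_Ioc (h : MeanOnePeriodic P T) (a : ℝ) (m : ℕ) :
    ∫⁻ v in Ioc a (a + m * T), P v = ENNReal.ofReal (m * T) := by
  rw [h.periodic.setLIntegral_Ioc_nat h.pos, h.lintegral_eq, ENNReal.ofReal_mul (by positivity),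
    ENNReal.ofReal_natCast]

theorem lintegral_Icc (h : MeanOnePeriodic P T) (a : ℝ) (m : ℕ) :
    ∫⁻ v in Icc a (a + m * T), P v = ENNReal.ofReal (m * T) := by
  rw [setLIntegral_congr Ioc_ae_eq_Icc.symm, h.lintegral_Ioc]

theorem lintegral_Icc_le (h : MeanOnePeriodic P T) {a b : ℝ} (hab : a ≤ b) :
    ∫⁻ v in Icc a b, P v ≤ ENNReal.ofReal (b - a + T) := by
  have hT := h.pos
  have h1 : b ≤ a + ⌈(b - a) / T⌉₊ * T := by
    have := Nat.le_ceil ((b - a) / T)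
    rw [div_le_iff₀ hT] at this
    linarith
  have h2 : (⌈(b - a) / T⌉₊ : ℝ) * T ≤ b - a + T := by
    have := (Nat.ceil_lt_add_one (div_nonneg (sub_nonneg.2 hab) hT.le)).le
    calc _ ≤ ((b - a) / T + 1) * T := by gcongr
      _ = _ := by field_simp
  calc _ ≤ ∫⁻ v in Icc a (a + ⌈(b - a) / T⌉₊ * T), P v :=
        lintegral_mono_set (Icc_subset_Icc_right h1)
    _ ≤ _ := by rw [h.lintegral_Icc]; exact ENNReal.ofReal_le_ofReal h2

/-- A function with a smaller period and the same mean. -/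
theorem of_period (h : MeanOnePeriodic P T) {S : ℝ} (hS : 0 < S) (hPS : Function.Periodic P S)
    {m : ℕ} (hm : m * S = T) : MeanOnePeriodic P S := by
  refine ⟨h.measurable, hS, hPS, ?_⟩
  have h1 := hPS.setLIntegral_Ioc_nat hS 0 m
  rw [zero_add, hm, h.lintegral_eq, ← hm, ENNReal.ofReal_mul (by positivity),
    ENNReal.ofReal_natCast] at h1
  have hT := h.pos
  have hm0 : (m : ℝ≥0∞) ≠ 0 := by
    rintro h0
    have : m = 0 := by exact_mod_cast h0
    simp [this] at hm; linarith
  exact ((ENNReal.mul_right_inj hm0 (by simp)).1 h1).symm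

theorem comp_affine (h : MeanOnePeriodic P 1) {q : ℕ} (hq : 0 < q) (c : ℝ) :
    MeanOnePeriodic (fun v => P (q * v + c)) (1 / q) := by
  have hq' : (0 : ℝ) < q := by exact_mod_cast hq
  refine ⟨h.measurable.comp (by fun_prop), by positivity, fun v => ?_, ?_⟩
  · have : (q : ℝ) * (v + 1 / q) + c = (q * v + c) + 1 := by field_simp; ring
    simp only [this]
    exact h.periodic _
  · have h1 := lintegral_image_eq_lintegral_abs_deriv_mul (s := Ioc (0 : ℝ) (1 / q))
      (f := fun v => (q : ℝ) * v + c) (f' := fun _ => (q : ℝ)) measurableSet_Ioc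
      (fun x _ => by
        simpa using (((hasDerivAt_id x).const_mul (q : ℝ)).add_const c).hasDerivWithinAt)
      (fun x _ y _ hxy => by simpa [hq'.ne'] using hxy) P
    have h2 : (fun v => (q : ℝ) * v + c) '' Ioc (0 : ℝ) (1 / q) = Ioc c (c + (1 : ℕ) * 1) := by
      rw [Set.image_affine_Ioc hq']
      congr 1
      · simp
      · field_simp; push_cast; ring
    rw [h2, h.lintegral_Ioc, lintegral_const_mul (f := fun v => P (q * v + c)) _
      (h.measurable.comp (by fun_prop))] at h1
    simp only [Nat.cast_one, mul_one, ENNReal.ofReal_one, Nat.abs_cast,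
      ENNReal.ofReal_natCast] at h1
    rw [one_div] at h1 ⊢
    rw [ENNReal.ofReal_inv_of_pos hq', ENNReal.ofReal_natCast]
    exact ENNReal.eq_inv_of_mul_eq_one_left (by rw [mul_comm]; exact h1.symm)

theorem mul_period (h : MeanOnePeriodic P T) {m : ℕ} (hm : 0 < m) :
    MeanOnePeriodic P (m * T) := by
  have := h.pos
  refine ⟨h.measurable, by positivity, h.periodic.nat_mul m, ?_⟩
  simpa using h.lintegral_Ioc 0 m

end MeanOnePeriodic

/-- The correlation over the unit interval of `U` with the translate of `V` by `v`. -/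
noncomputable def correlation (U V : ℝ → ℝ≥0∞) (v : ℝ) : ℝ≥0∞ :=
  ∫⁻ a in Ioc (0 : ℝ) 1, U a * V (a + v)

theorem measurable_correlation {U V : ℝ → ℝ≥0∞} (hU : Measurable U) (hV : Measurable V) :
    Measurable (correlation U V) := by
  refine Measurable.lintegral_prod_right' (f := fun p : ℝ × ℝ => U p.2 * V (p.2 + p.1)) ?_
  exact (hU.comp measurable_snd).mul (hV.comp (measurable_snd.add measurable_fst))

theorem setLIntegral_correlation {U V : ℝ → ℝ≥0∞} (hU : Measurable U) (hV : Measurable V)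
    (s : Set ℝ) :
    ∫⁻ v in s, correlation U V v = ∫⁻ a in Ioc (0 : ℝ) 1, U a * ∫⁻ v in s, V (a + v) := by
  unfold correlation
  rw [lintegral_lintegral_swap]
  · refine lintegral_congr fun a => ?_
    rw [lintegral_const_mul (f := fun v => V (a + v)) _ (hV.comp (by fun_prop))]
  · exact ((hU.comp measurable_snd).mul
      (hV.comp (measurable_snd.add measurable_fst))).aemeasurable

theorem MeanOnePeriodic.comp_add {P : ℝ → ℝ≥0∞} {T : ℝ} (h : MeanOnePeriodic P T) (c : ℝ) :
    MeanOnePeriodic (fun v => P (c + v)) T := by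
  refine ⟨h.measurable.comp (by fun_prop), h.pos, fun v => ?_, ?_⟩
  · simp only [← add_assoc]; exact h.periodic _
  · have hP : Function.Periodic (fun v => P (c + v)) T := fun v => by
      simp only [← add_assoc]; exact h.periodic _
    have h1 : ∫⁻ v, (Ioc c (c + T)).indicator P (c + v) = ∫⁻ v, (Ioc c (c + T)).indicator P v :=
      lintegral_add_left_eq_self _ c
    rw [lintegral_indicator measurableSet_Ioc] at h1
    have h2 := h.lintegral_Ioc c 1
    simp only [Nat.cast_one, one_mul] at h2
    rw [← h2, ← h1, ← lintegral_indicator measurableSet_Ioc]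
    refine lintegral_congr fun v => ?_
    simp only [indicator, mem_Ioc]
    congr 1
    simp

theorem correlation_meanOnePeriodic {U V : ℝ → ℝ≥0∞} {q r : ℕ} (hq : 0 < q) (hr : 0 < r)
    (hU : MeanOnePeriodic U (1 / q)) (hV : MeanOnePeriodic V (1 / r)) :
    MeanOnePeriodic (correlation U V) (1 / (q.lcm r : ℕ)) := by
  have hq' : (q : ℝ) ≠ 0 := by exact_mod_cast hq.ne'
  have hr' : (r : ℝ) ≠ 0 := by exact_mod_cast hr.ne'
  have hU1 : MeanOnePeriodic U 1 := by
    have := hU.mul_period hq; rwa [mul_one_div_cancel hq'] at this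
  have hV1 : MeanOnePeriodic V 1 := by
    have := hV.mul_period hr; rwa [mul_one_div_cancel hr'] at this
  have p1 : Function.Periodic (correlation U V) (1 / r) := fun v => by
    unfold correlation
    refine lintegral_congr fun a => ?_
    rw [← add_assoc, hV.periodic]
  have p2 : Function.Periodic (correlation U V) (1 / q) := fun v => by
    unfold correlation
    have hper : Function.Periodic (fun a => U a * V (a + v)) 1 := fun a => by
      simp only [hU1.periodic a]
      rw [show a + 1 + v = a + v + 1 by ring, hV1.periodic]
    have h1 := hper.setLIntegral_Ioc_eq one_pos (1 / q) 0
    have h2 : ∫⁻ a, (Ioc (1 / q : ℝ) (1 / q + 1)).indicator (fun a => U a * V (a + v)) (a + 1 / q)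
      = ∫⁻ a, (Ioc (1 / q : ℝ) (1 / q + 1)).indicator (fun a => U a * V (a + v)) a :=
      lintegral_add_right_eq_self _ _
    rw [lintegral_indicator measurableSet_Ioc, h1, zero_add] at h2
    rw [← h2, ← lintegral_indicator measurableSet_Ioc]
    refine lintegral_congr fun a => ?_
    simp only [indicator, mem_Ioc]
    have : (1 / q : ℝ) < a + 1 / q ∧ a + 1 / q ≤ 1 / q + 1 ↔ 0 < a ∧ a ≤ 1 := by
      constructor <;> rintro ⟨h1, h2⟩ <;> constructor <;> linarith
    simp only [this, hU.periodic a, add_assoc, add_comm v]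
  have hg : 0 < q.gcd r := Nat.gcd_pos_of_pos_left _ hq
  have hg' : (q.gcd r : ℝ) ≠ 0 := by exact_mod_cast hg.ne'
  have hl : 0 < q.lcm r := Nat.lcm_pos hq hr
  have hl' : (q.lcm r : ℝ) ≠ 0 := by exact_mod_cast hl.ne'
  have hgl : (q.gcd r : ℝ) * q.lcm r = q * r := by exact_mod_cast Nat.gcd_mul_lcm q r
  have hb : (q.gcd r : ℝ) = q * q.gcdA r + r * q.gcdB r := by exact_mod_cast Nat.gcd_eq_gcd_ab q r
  have hper : Function.Periodic (correlation U V) (1 / (q.lcm r : ℕ)) := by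
    have := (p1.int_mul (q.gcdA r)).add_period (p2.int_mul (q.gcdB r))
    have e : (1 : ℝ) / (q.lcm r : ℕ) = q.gcd r / (q * r) := by
      rw [← hgl]; field_simp
    have e' : (1 : ℝ) / (q.lcm r : ℕ) = q.gcdA r * (1 / r) + q.gcdB r * (1 / q) := by
      rw [e, hb]; field_simp
    rwa [e']
  have hone : MeanOnePeriodic (correlation U V) 1 := by
    refine ⟨measurable_correlation hU.measurable hV.measurable, one_pos, ?_, ?_⟩
    · have := p1.nat_mul r; rwa [mul_one_div_cancel hr'] at this
    · rw [setLIntegral_correlation hU.measurable hV.measurable]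
      simp_rw [(hV1.comp_add _).lintegral_eq]
      simpa using hU1.lintegral_eq
  exact hone.of_period (by positivity) hper (mul_one_div_cancel hl')

theorem lintegral_window_eq {V : ℝ → ℝ≥0∞} (a δ : ℝ) :
    ∫⁻ b in Icc (a - δ) (a + δ), V b = ∫⁻ v in Icc (-δ) δ, V (a + v) := by
  rw [← lintegral_indicator measurableSet_Icc, ← lintegral_indicator measurableSet_Icc,
    ← lintegral_add_left_eq_self _ a]
  refine lintegral_congr fun v => ?_
  simp only [indicator, mem_Icc]
  have : a - δ ≤ a + v ∧ a + v ≤ a + δ ↔ -δ ≤ v ∧ v ≤ δ := by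
    constructor <;> rintro ⟨h1, h2⟩ <;> constructor <;> linarith
  simp only [this]

/-- The mass given by `U ⊗ V` to the pairs of points of the unit interval at distance `≤ δ`. -/
noncomputable def closeMass (U V : ℝ → ℝ≥0∞) (δ : ℝ) : ℝ≥0∞ :=
  ∫⁻ a in Icc (0 : ℝ) 1, U a * ∫⁻ b in Icc (a - δ) (a + δ), V b

theorem closeMass_eq {U V : ℝ → ℝ≥0∞} (hU : Measurable U) (hV : Measurable V) (δ : ℝ) :
    closeMass U V δ = ∫⁻ v in Icc (-δ) δ, correlation U V v := by
  rw [setLIntegral_correlation hU hV, closeMass, setLIntegral_congr Ioc_ae_eq_Icc.symm]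
  simp_rw [lintegral_window_eq]

theorem closeMass_le {U V : ℝ → ℝ≥0∞} {q r : ℕ} (hq : 0 < q) (hr : 0 < r)
    (hU : MeanOnePeriodic U (1 / q)) (hV : MeanOnePeriodic V (1 / r)) {δ : ℝ} (hδ : 0 ≤ δ) :
    closeMass U V δ ≤ ENNReal.ofReal (2 * δ + 1 / (q.lcm r : ℕ)) := by
  rw [closeMass_eq hU.measurable hV.measurable]
  refine ((correlation_meanOnePeriodic hq hr hU hV).lintegral_Icc_le (by linarith)).trans_eq ?_
  ring_nf

theorem closeMass_le_of_le_average {U V : ℝ → ℝ≥0∞} {q r : ℕ} (hq : 0 < q) (hr : 0 < r)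
    (hU : MeanOnePeriodic U (1 / q)) (hV : MeanOnePeriodic V (1 / r)) {ρ : ℝ} (hρ : 0 < ρ)
    (hVρ : ∀ c, V c ≤ ENNReal.ofReal (2 / ρ) * ∫⁻ v in Icc (-(2 * ρ)) (2 * ρ), V (c + v))
    (δ : ℝ) :
    closeMass U V δ ≤ ENNReal.ofReal (4 * δ / ρ * (4 * ρ + 1 / (q.lcm r : ℕ))) := by
  have hc := correlation_meanOnePeriodic hq hr hU hV
  have key : ∀ v, correlation U V v ≤
      ENNReal.ofReal (2 / ρ * (4 * ρ + 1 / (q.lcm r : ℕ))) := fun v => by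
    calc correlation U V v
        ≤ ∫⁻ a in Ioc (0 : ℝ) 1, ENNReal.ofReal (2 / ρ) *
            (U a * ∫⁻ w in Icc (-(2 * ρ)) (2 * ρ), V (a + (v + w))) := by
          unfold correlation
          refine lintegral_mono fun a => ?_
          calc U a * V (a + v) ≤ U a * _ := mul_le_mul_right (hVρ _) _
            _ = _ := by simp_rw [add_assoc]; ring
      _ = ENNReal.ofReal (2 / ρ) * ∫⁻ w in Icc (-(2 * ρ)) (2 * ρ), correlation U V (v + w) := by
          rw [lintegral_const_mul' _ _ ENNReal.ofReal_ne_top]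
          congr 1
          have := setLIntegral_correlation hU.measurable
            (V := fun x => V (x + v)) (hV.measurable.comp (by fun_prop)) (Icc (-(2 * ρ)) (2 * ρ))
          simp only [correlation] at this ⊢
          simp_rw [show ∀ a w : ℝ, a + (v + w) = a + w + v by intros; ring]
          exact this.symm
      _ ≤ ENNReal.ofReal (2 / ρ) * ENNReal.ofReal (4 * ρ + 1 / (q.lcm r : ℕ)) := by
          gcongr
          refine ((hc.comp_add v).lintegral_Icc_le (by linarith)).trans_eq ?_
          ring_nf
      _ = _ := by rw [← ENNReal.ofReal_mul (by positivity)]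
  rw [closeMass_eq hU.measurable hV.measurable]
  calc _ ≤ ∫⁻ v in Icc (-δ) δ, ENNReal.ofReal (2 / ρ * (4 * ρ + 1 / (q.lcm r : ℕ))) :=
        lintegral_mono fun v => key v
    _ = _ := by
        rw [setLIntegral_const, Real.volume_Icc, ← ENNReal.ofReal_mul (by positivity)]
        congr 1; field_simp; ring

section MassDistribution

theorem exists_open_subset_closedBall {X : Type*} [MetricSpace X] {s : ℝ} (hs : 0 ≤ s) {t : Set X}
    (htd : Metric.ediam t ≤ 1 / 2) {ε : ℝ≥0∞} (hε : ε ≠ 0) :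
    ∃ (U : Set X) (j : ℕ), IsOpen U ∧ t ⊆ U ∧ (∀ x ∈ U, U ⊆ Metric.closedBall x ((1 / 2) ^ j)) ∧
      ENNReal.ofReal (((1 / 2 : ℝ) ^ j) ^ s) ≤ 2 ^ s * (Metric.ediam t ^ s + ε) := by
  have hfin : Metric.ediam t ≠ ⊤ := ne_top_of_le_ne_top (by simp) htd
  have hcont : Tendsto (fun η : ℝ≥0 => (Metric.ediam t + 2 * η) ^ s) (𝓝[>] 0)
      (𝓝 (Metric.ediam t ^ s)) := by
    have : Continuous fun η : ℝ≥0 => (Metric.ediam t + 2 * (η : ℝ≥0∞)) ^ s := by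
      refine (ENNReal.continuous_rpow_const).comp (continuous_const.add ?_)
      exact (ENNReal.continuous_const_mul (by simp)).comp ENNReal.continuous_coe
    have h := this.tendsto 0
    simp only [ENNReal.coe_zero, mul_zero, add_zero] at h
    exact h.mono_left nhdsWithin_le_nhds
  have hlt : Metric.ediam t ^ s < Metric.ediam t ^ s + ε :=
    ENNReal.lt_add_right (ENNReal.rpow_ne_top_of_nonneg hs hfin) hε
  have h1 := hcont.eventually (gt_mem_nhds hlt)
  have h2 : ∀ᶠ η : ℝ≥0 in 𝓝[>] 0, η < 1 / 4 :=
    nhdsWithin_le_nhds (gt_mem_nhds (by positivity))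
  obtain ⟨η, ⟨hη1, hη2⟩, hη0⟩ := ((h1.and h2).and self_mem_nhdsWithin).exists
  have hη0 : 0 < η := hη0
  set D : ℝ := (Metric.ediam t).toReal + 2 * η with hD
  have hDe : Metric.ediam t + 2 * η = ENNReal.ofReal D := by
    rw [hD, ENNReal.ofReal_add ENNReal.toReal_nonneg (by positivity), ENNReal.ofReal_toReal hfin,
      ENNReal.ofReal_mul (by norm_num)]
    simp
  have hD0 : 0 < D := by positivity
  have hD1 : D ≤ 1 := by
    have h3 : (Metric.ediam t).toReal ≤ 1 / 2 := by
      have := ENNReal.toReal_mono (by simp) htd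
      simpa using this
    have h4 : (η : ℝ) < 1 / 4 := by exact_mod_cast hη2
    linarith
  obtain ⟨j, hj1, hj2⟩ := exists_nat_pow_near_of_lt_one hD0 hD1 (by norm_num : (0 : ℝ) < 1 / 2)
    (by norm_num)
  refine ⟨Metric.thickening η t, j, Metric.isOpen_thickening,
    Metric.self_subset_thickening (by exact_mod_cast hη0) t, fun x hx y hy => ?_, ?_⟩
  · have h5 : edist y x ≤ ENNReal.ofReal D := by
      rw [← hDe]
      exact (Metric.edist_le_ediam_of_mem hy hx).trans (Metric.ediam_thickening_le η)
    rw [edist_dist] at h5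
    exact ((ENNReal.ofReal_le_ofReal_iff hD0.le).1 h5).trans hj2
  · have h6 : (1 / 2 : ℝ) ^ j ≤ 2 * D := by
      rw [pow_succ] at hj1; linarith
    calc ENNReal.ofReal (((1 / 2 : ℝ) ^ j) ^ s) ≤ ENNReal.ofReal ((2 * D) ^ s) := by gcongr
      _ = 2 ^ s * (Metric.ediam t + 2 * η) ^ s := by
        rw [Real.mul_rpow (by norm_num) hD0.le, ENNReal.ofReal_mul (by positivity), hDe,
          ENNReal.ofReal_rpow_of_nonneg hD0.le hs, ← ENNReal.ofReal_rpow_of_nonneg (by norm_num) hs]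
        simp
      _ ≤ _ := by gcongr

variable {X : Type*} [MetricSpace X] [MeasurableSpace X] [BorelSpace X] [SecondCountableTopology X]

theorem measurable_measure_closedBall (μ : Measure X) [SFinite μ] (r : ℝ) :
    Measurable fun x => μ (Metric.closedBall x r) := by
  have : MeasurableSet {p : X × X | dist p.2 p.1 ≤ r} :=
    (isClosed_le (by fun_prop) continuous_const).measurableSet
  exact measurable_measure_prodMk_left this

/-- A measure of small `s`-energy has large trace on the set of points
where it satisfies a Frostman condition of exponent `d < s`. -/
theorem exists_frostman_constant {s d : ℝ} (hds : d < s) {c : ℝ≥0∞} (hc0 : c ≠ 0) (hc : c ≠ ⊤)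
    {C : ℝ≥0∞} (hC : C ≠ ⊤) :
    ∃ Λ : ℝ≥0∞, Λ ≠ 0 ∧ Λ ≠ ⊤ ∧ ∀ μ : Measure X, IsFiniteMeasure μ → c ≤ μ univ →
      (∀ j : ℕ, ∫⁻ x, μ (Metric.closedBall x ((1 / 2) ^ j)) ∂μ ≤
        C * ENNReal.ofReal (((1 / 2 : ℝ) ^ j) ^ s)) →
      c / 2 ≤ μ {x | ∀ j : ℕ, μ (Metric.closedBall x ((1 / 2) ^ j)) ≤
        Λ * ENNReal.ofReal (((1 / 2 : ℝ) ^ j) ^ d)} := by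
  set θ : ℝ := (1 / 2) ^ (s - d) with hθ
  have hθ0 : 0 < θ := by positivity
  have hθ1 : θ < 1 := Real.rpow_lt_one (by norm_num) (by norm_num) (by linarith)
  have hS : ∑' j : ℕ, ENNReal.ofReal (θ ^ j) ≠ ⊤ := by
    rw [← ENNReal.ofReal_tsum_of_nonneg (fun j => by positivity)
      (summable_geometric_of_lt_one hθ0.le hθ1)]
    exact ENNReal.ofReal_ne_top
  set S := ∑' j : ℕ, ENNReal.ofReal (θ ^ j) with hSdef
  set Λ := 2 * (C * S) / c + 1 with hΛ
  have hΛ0 : Λ ≠ 0 := by simp [hΛ]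
  have hΛt : Λ ≠ ⊤ := by
    refine ENNReal.add_ne_top.2 ⟨ENNReal.div_ne_top ?_ hc0, by simp⟩
    exact ENNReal.mul_ne_top (by simp) (ENNReal.mul_ne_top hC hS)
  refine ⟨Λ, hΛ0, hΛt, fun μ _ hμ hE => ?_⟩
  set bad : ℕ → Set X := fun j => {x | Λ * ENNReal.ofReal (((1 / 2 : ℝ) ^ j) ^ d) ≤
    μ (Metric.closedBall x ((1 / 2) ^ j))} with hbad
  have hbadle : ∀ j, μ (bad j) ≤ C / Λ * ENNReal.ofReal (θ ^ j) := fun j => by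
    have hr : 0 < ((1 / 2 : ℝ) ^ j) ^ d := by positivity
    have hr' : ENNReal.ofReal (((1 / 2 : ℝ) ^ j) ^ d) ≠ 0 := by simpa using hr
    refine (meas_ge_le_lintegral_div (measurable_measure_closedBall μ _).aemeasurable
      (mul_ne_zero hΛ0 hr') (ENNReal.mul_ne_top hΛt ENNReal.ofReal_ne_top)).trans ?_
    refine (ENNReal.div_le_div_right (hE j) _).trans_eq ?_
    rw [ENNReal.mul_div_mul_comm (Or.inl hΛ0) (Or.inl hΛt), ← ENNReal.ofReal_div_of_pos hr]
    congr 2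
    rw [← Real.rpow_sub (by positivity), hθ, ← Real.rpow_natCast, ← Real.rpow_natCast,
      ← Real.rpow_mul (by norm_num), ← Real.rpow_mul (by norm_num), mul_comm]
  have hbadU : μ (⋃ j, bad j) ≤ c / 2 := by
    refine (measure_iUnion_le _).trans ((ENNReal.tsum_le_tsum hbadle).trans ?_)
    rw [ENNReal.tsum_mul_left, ← hSdef]
    calc C / Λ * S = C * S / Λ := by simp only [div_eq_mul_inv]; ring
      _ ≤ c / 2 := by
        refine ENNReal.div_le_of_le_mul' ?_
        calc C * S = (2 * (C * S) / c) * (c / 2) := by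
              rw [mul_comm (2 * (C * S) / c), div_eq_mul_inv, div_eq_mul_inv]
              have h2 : (2 : ℝ≥0∞)⁻¹ * 2 = 1 := ENNReal.inv_mul_cancel (by simp) (by simp)
              have h3 : c * c⁻¹ = 1 := ENNReal.mul_inv_cancel hc0 hc
              calc C * S = (c * c⁻¹) * (2⁻¹ * 2) * (C * S) := by rw [h2, h3]; simp
                _ = _ := by ring
          _ ≤ Λ * (c / 2) := by gcongr; exact le_self_add
  have hsub : univ ⊆ (⋃ j, bad j) ∪ {x | ∀ j : ℕ, μ (Metric.closedBall x ((1 / 2) ^ j)) ≤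
        Λ * ENNReal.ofReal (((1 / 2 : ℝ) ^ j) ^ d)} := by
    intro x _
    by_cases h : x ∈ ⋃ j, bad j
    · exact Or.inl h
    · refine Or.inr fun j => ?_
      simp only [mem_iUnion, not_exists] at h
      exact (not_le.1 (h j)).le
  have h1 := hμ.trans ((measure_mono hsub).trans (measure_union_le _ _))
  have h2 : c / 2 + c / 2 ≤ c / 2 + μ {x | ∀ j : ℕ, μ (Metric.closedBall x ((1 / 2) ^ j)) ≤
        Λ * ENNReal.ofReal (((1 / 2 : ℝ) ^ j) ^ d)} := by
    rw [ENNReal.add_halves]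
    exact h1.trans (add_le_add_left hbadU _)
  exact (ENNReal.add_le_add_iff_left (ENNReal.div_ne_top hc (by simp))).1 h2

theorem hausdorffMeasure_iInter_ne_zero {s d : ℝ} (hd : 0 ≤ d) (hds : d < s) {c C : ℝ≥0∞}
    (hc0 : c ≠ 0) (hc : c ≠ ⊤) (hC : C ≠ ⊤) (K : ℕ → Set X) (hK : Antitone K)
    (hKc : ∀ k, IsCompact (K k)) (μ : ℕ → Measure X) [∀ k, IsFiniteMeasure (μ k)]
    (hμK : ∀ k, μ k (K k)ᶜ = 0) (hμ : ∀ k, c ≤ μ k univ)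
    (hE : ∀ k j : ℕ, ∫⁻ x, μ k (Metric.closedBall x ((1 / 2) ^ j)) ∂(μ k) ≤
        C * ENNReal.ofReal (((1 / 2 : ℝ) ^ j) ^ s)) :
    μH[d] (⋂ k, K k) ≠ 0 := by
  obtain ⟨Λ, hΛ0, hΛt, hΛ⟩ := exists_frostman_constant (X := X) hds hc0 hc hC
  have h2d : (2 : ℝ≥0∞) ^ d ≠ ⊤ := by simp
  have h2d0 : (2 : ℝ≥0∞) ^ d ≠ 0 := by simp
  set A := Λ * 2 ^ d with hA
  have hA0 : A ≠ 0 := mul_ne_zero hΛ0 h2d0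
  have hAt : A ≠ ⊤ := ENNReal.mul_ne_top hΛt h2d
  suffices h : c / 2 / A ≤ μH[d] (⋂ k, K k) by
    intro h0
    rw [h0, nonpos_iff_eq_zero, ENNReal.div_eq_zero_iff, ENNReal.div_eq_zero_iff] at h
    simp [hc0, hAt] at h
  rw [Measure.hausdorffMeasure_apply]
  refine le_iSup₂_of_le (1 / 2 : ℝ≥0∞) (by simp) ?_
  refine le_iInf fun t => le_iInf fun hcov => le_iInf fun htd => ?_
  refine ENNReal.div_le_of_le_mul' ?_
  refine ENNReal.le_of_forall_pos_le_add fun ε hε _ => ?_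
  obtain ⟨e, he0, he⟩ := ENNReal.exists_pos_sum_of_countable'
    (ENNReal.div_ne_zero.2 ⟨ENNReal.coe_ne_zero.2 hε.ne', hAt⟩) ℕ
  choose U j hUo htU hUj hj using fun i =>
    exists_open_subset_closedBall hd (htd i) (he0 i).ne'
  set V : ℕ → Set X := fun i => {x | x ∈ U i ∧ (t i).Nonempty} with hV
  have hVo : ∀ i, IsOpen (V i) := fun i => (hUo i).and isOpen_const
  obtain ⟨k, hk⟩ : ∃ k, K k ⊆ ⋃ i, V i := by
    refine exists_subset_nhds_of_isCompact hK.directed_ge hKc fun x hx => ?_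
    refine (isOpen_iUnion hVo).mem_nhds ?_
    obtain ⟨i, hi⟩ := mem_iUnion.1 (hcov hx)
    exact mem_iUnion.2 ⟨i, htU i hi, x, hi⟩
  set G := {x | ∀ j : ℕ, μ k (Metric.closedBall x ((1 / 2) ^ j)) ≤
        Λ * ENNReal.ofReal (((1 / 2 : ℝ) ^ j) ^ d)} with hG
  have hGm : c / 2 ≤ μ k G := hΛ (μ k) inferInstance (hμ k) (hE k)
  have hpiece : ∀ i, μ k (G ∩ V i) ≤
      A * (⨆ _ : (t i).Nonempty, Metric.ediam (t i) ^ d) + A * e i := fun i => by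
    rcases (G ∩ V i).eq_empty_or_nonempty with h | ⟨x, hxG, hxU, hne⟩
    · simp [h]
    · calc μ k (G ∩ V i) ≤ μ k (Metric.closedBall x ((1 / 2) ^ j i)) :=
            measure_mono fun y hy => hUj i x hxU hy.2.1
        _ ≤ Λ * ENNReal.ofReal (((1 / 2 : ℝ) ^ j i) ^ d) := hxG _
        _ ≤ Λ * (2 ^ d * (Metric.ediam (t i) ^ d + e i)) := by gcongr; exact hj i
        _ = _ := by rw [iSup_pos hne, hA]; ring
  calc c / 2 ≤ μ k G := hGm
    _ ≤ μ k ((⋃ i, G ∩ V i) ∪ (K k)ᶜ) := by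
        refine measure_mono fun x hx => ?_
        by_cases hxK : x ∈ K k
        · obtain ⟨i, hi⟩ := mem_iUnion.1 (hk hxK)
          exact Or.inl (mem_iUnion.2 ⟨i, hx, hi⟩)
        · exact Or.inr hxK
    _ ≤ (∑' i, μ k (G ∩ V i)) + 0 := by
        refine (measure_union_le _ _).trans (add_le_add (measure_iUnion_le _) (hμK k).le)
    _ ≤ ∑' i, (A * (⨆ _ : (t i).Nonempty, Metric.ediam (t i) ^ d) + A * e i) := by
        rw [add_zero]; exact ENNReal.tsum_le_tsum hpiece
    _ = A * (∑' i, ⨆ _ : (t i).Nonempty, Metric.ediam (t i) ^ d) + A * ∑' i, e i := by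
        rw [ENNReal.tsum_add, ENNReal.tsum_mul_left, ENNReal.tsum_mul_left]
    _ ≤ _ := by
        gcongr
        calc A * ∑' i, e i ≤ A * (ε / A) := by gcongr
          _ = ε := ENNReal.mul_div_cancel hA0 hAt

end MassDistribution

theorem unitCube_eq_closedBall (n : ℕ) :
    unitCube n = Metric.closedBall (fun _ => (1 / 2 : ℝ)) (1 / 2) := by
  rw [closedBall_pi _ (by norm_num), unitCube]
  congr! 2 with i
  rw [Real.closedBall_eq_Icc]; norm_num

theorem isCompact_unitCube (n : ℕ) : IsCompact (unitCube n) :=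
  isCompact_univ_pi fun _ => isCompact_Icc

theorem volume_unitCube (n : ℕ) : volume (unitCube n) = 1 := by
  rw [unitCube, volume_pi_pi]; simp

/-- A continuous cut-off of the set of pairs at distance at most `2⁻ʲ`. -/
noncomputable def pairCutoff {n : ℕ} (j : ℕ) (x y : Fin n → ℝ) : ℝ≥0 :=
  Real.toNNReal (2 - 2 ^ j * dist x y)

theorem continuous_pairCutoff {n : ℕ} (j : ℕ) :
    Continuous fun p : (Fin n → ℝ) × (Fin n → ℝ) => pairCutoff j p.1 p.2 := by
  unfold pairCutoff
  exact continuous_real_toNNReal.comp (by fun_prop)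

theorem one_le_pairCutoff {n : ℕ} {j : ℕ} {x y : Fin n → ℝ}
    (h : y ∈ Metric.closedBall x ((1 / 2) ^ j)) : 1 ≤ pairCutoff j x y := by
  rw [pairCutoff, Real.one_le_toNNReal]
  rw [Metric.mem_closedBall, dist_comm] at h
  have : 2 ^ j * dist x y ≤ 2 ^ j * (1 / 2) ^ j := by gcongr
  rw [← mul_pow] at this
  norm_num at this
  linarith

theorem pairCutoff_le_two {n : ℕ} (j : ℕ) (x y : Fin n → ℝ) : pairCutoff j x y ≤ 2 := by
  rw [pairCutoff, Real.toNNReal_le_iff_le_coe]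
  have : 0 ≤ 2 ^ j * dist x y := by positivity
  push_cast; linarith

theorem mem_closedBall_of_pairCutoff_ne_zero {n : ℕ} {j : ℕ} {x y : Fin n → ℝ}
    (h : pairCutoff j x y ≠ 0) : y ∈ Metric.closedBall x (2 * (1 / 2) ^ j) := by
  rw [pairCutoff, Ne, Real.toNNReal_eq_zero, not_le] at h
  rw [Metric.mem_closedBall, dist_comm]
  have h1 : (1 / 2 : ℝ) ^ j * (2 ^ j * dist x y) ≤ (1 / 2) ^ j * 2 := by gcongr; linarith
  rw [← mul_assoc, ← mul_pow] at h1
  norm_num at h1 ⊢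
  linarith

/-- The mass given by `f ⊗ f` to the pairs at distance about `2⁻ʲ`. -/
noncomputable def pairMass {n : ℕ} (f : (Fin n → ℝ) → ℝ≥0) (j : ℕ) : ℝ≥0∞ :=
  ∫⁻ x, ∫⁻ y, (f x * f y * pairCutoff j x y : ℝ≥0)

theorem pairMass_mul_le {n : ℕ} {f g : (Fin n → ℝ) → ℝ≥0} (hf0 : ∀ x ∉ unitCube n, f x = 0)
    {B : ℝ≥0} (hB : ∀ x, f x ≤ B) (j : ℕ) :
    pairMass (fun x => f x * g x) j ≤ (2 * B ^ 2 : ℝ≥0) * ∫⁻ x in unitCube n,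
      ∫⁻ y in Metric.closedBall x (2 * (1 / 2) ^ j), (g x * g y : ℝ≥0) := by
  rw [← lintegral_const_mul' _ _ ENNReal.coe_ne_top,
    ← lintegral_indicator (isCompact_unitCube n).measurableSet]
  refine lintegral_mono fun x => ?_
  by_cases hx : x ∈ unitCube n
  · rw [indicator_of_mem hx, ← lintegral_const_mul' _ _ ENNReal.coe_ne_top,
      ← lintegral_indicator Metric.isClosed_closedBall.measurableSet]
    refine lintegral_mono fun y => ?_
    by_cases hy : y ∈ Metric.closedBall x (2 * (1 / 2) ^ j)
    · rw [indicator_of_mem hy]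
      rw [← ENNReal.coe_mul, ENNReal.coe_le_coe]
      calc f x * g x * (f y * g y) * pairCutoff j x y ≤ B * g x * (B * g y) * 2 := by
            gcongr
            exacts [hB x, hB y, pairCutoff_le_two j x y]
        _ = 2 * B ^ 2 * (g x * g y) := by ring
    · have : pairCutoff j x y = 0 := by
        by_contra h
        exact hy (mem_closedBall_of_pairCutoff_ne_zero h)
      simp [this]
  · simp [hf0 x hx]

/-- Quantitative positivity of mass and bound for the pair masses,
stable under multiplication by equidistributed densities. -/
structure EnergyBounded {n : ℕ} (s : ℝ) (c C : ℝ≥0∞) (f : (Fin n → ℝ) → ℝ≥0) : Prop where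
  continuous : Continuous f
  eq_zero : ∀ x ∉ unitCube n, f x = 0
  lt_mass : c < ∫⁻ x, f x
  pairMass_le : ∃ C' < C, ∀ j, pairMass f j ≤ C' * ENNReal.ofReal (((1 / 2 : ℝ) ^ j) ^ s)

theorem exists_bound_of_eq_zero {n : ℕ} {f : (Fin n → ℝ) → ℝ≥0} (hf : Continuous f)
    (hf0 : ∀ x ∉ unitCube n, f x = 0) : ∃ B, ∀ x, f x ≤ B := by
  obtain ⟨B, hB⟩ := (isCompact_unitCube n).bddAbove_image hf.continuousOn
  refine ⟨B, fun x => ?_⟩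
  by_cases hx : x ∈ unitCube n
  · exact hB (mem_image_of_mem f hx)
  · simp [hf0 x hx]

/-- A sequence of densities `g Q` which equidistributes and whose pair masses in the unit cube are
uniformly bounded by those of a measure of dimension `s₀`. -/
structure Ubiquitous {n : ℕ} (s₀ : ℝ) (g : ℕ → (Fin n → ℝ) → ℝ≥0) : Prop where
  continuous : ∀ Q, Continuous (g Q)
  le_mass : ∀ F : (Fin n → ℝ) → ℝ≥0, Continuous F → (∀ x ∉ unitCube n, F x = 0) →
    ∀ ε : ℝ≥0∞, ε ≠ 0 → ∀ᶠ Q in atTop, ∫⁻ x, F x ≤ (∫⁻ x, (F x * g Q x : ℝ≥0)) + ε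
  pair_le : ∀ H : (Fin n → ℝ) → (Fin n → ℝ) → ℝ≥0, Continuous (Function.uncurry H) →
    (∀ x y, H x y ≠ 0 → x ∈ unitCube n ∧ y ∈ unitCube n) →
    ∀ ε : ℝ≥0∞, ε ≠ 0 → ∀ᶠ Q in atTop,
      ∫⁻ x, ∫⁻ y, (H x y * (g Q x * g Q y) : ℝ≥0) ≤ (∫⁻ x, ∫⁻ y, H x y) + ε
  close_le : ∃ K : ℝ≥0∞, K ≠ ⊤ ∧ ∀ᶠ Q in atTop, ∀ δ : ℝ, 0 < δ → δ ≤ 2 →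
    ∫⁻ x in unitCube n, ∫⁻ y in Metric.closedBall x δ, (g Q x * g Q y : ℝ≥0) ≤
      K * ENNReal.ofReal (δ ^ s₀)

theorem eventually_mul_ofReal_rpow_le {s s₀ : ℝ} (hs : s < s₀) {A C : ℝ≥0∞} (hA : A ≠ ⊤)
    (hC : C ≠ 0) : ∀ᶠ j : ℕ in atTop, A * ENNReal.ofReal ((2 * (1 / 2 : ℝ) ^ j) ^ s₀) ≤
      C * ENNReal.ofReal (((1 / 2 : ℝ) ^ j) ^ s) := by
  have h1 : Tendsto (fun j : ℕ => ENNReal.ofReal (2 ^ s₀ * ((1 / 2 : ℝ) ^ (s₀ - s)) ^ j)) atTop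
      (𝓝 0) := by
    rw [← ENNReal.ofReal_zero]
    refine ENNReal.tendsto_ofReal ?_
    rw [← mul_zero ((2 : ℝ) ^ s₀)]
    exact (tendsto_pow_atTop_nhds_zero_of_lt_one (by positivity)
      (Real.rpow_lt_one (by norm_num) (by norm_num) (by linarith))).const_mul _
  have h2 := ENNReal.Tendsto.const_mul h1 (Or.inr hA)
  rw [mul_zero] at h2
  filter_upwards [h2.eventually (gt_mem_nhds (pos_iff_ne_zero.2 hC))] with j hj
  have : (2 * (1 / 2 : ℝ) ^ j) ^ s₀ =
      2 ^ s₀ * ((1 / 2 : ℝ) ^ (s₀ - s)) ^ j * ((1 / 2 : ℝ) ^ j) ^ s := by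
    rw [Real.mul_rpow (by norm_num) (by positivity), mul_assoc]
    congr 1
    rw [← Real.rpow_natCast, ← Real.rpow_natCast, ← Real.rpow_mul (by norm_num),
      ← Real.rpow_mul (by norm_num), ← Real.rpow_mul (by norm_num),
      ← Real.rpow_add (by norm_num)]
    ring_nf
  rw [this, ENNReal.ofReal_mul (by positivity), ← mul_assoc]
  gcongr

theorem EnergyBounded.eventually_mul {n : ℕ} {s s₀ : ℝ} (hs : s < s₀) {c C : ℝ≥0∞}
    {f : (Fin n → ℝ) → ℝ≥0} (hf : EnergyBounded s c C f) {g : ℕ → (Fin n → ℝ) → ℝ≥0}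
    (hg : Ubiquitous s₀ g) : ∀ᶠ Q in atTop, EnergyBounded s c C fun x => f x * g Q x := by
  obtain ⟨C', hC', hfC⟩ := hf.pairMass_le
  obtain ⟨D, hD1, hD2⟩ := exists_between hC'
  obtain ⟨B, hB⟩ := exists_bound_of_eq_zero hf.continuous hf.eq_zero
  obtain ⟨K, hK, hgK⟩ := hg.close_le
  have hA : ((2 * B ^ 2 : ℝ≥0) : ℝ≥0∞) * K ≠ ⊤ := ENNReal.mul_ne_top ENNReal.coe_ne_top hK
  obtain ⟨J, hJ⟩ := eventually_atTop.1
    (eventually_mul_ofReal_rpow_le hs hA (bot_lt_of_lt hD1).ne')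
  have hmass : ∀ᶠ Q in atTop, c < ∫⁻ x, (f x * g Q x : ℝ≥0) := by
    obtain ⟨c', hc1, hc2⟩ := exists_between hf.lt_mass
    have hc : c ≠ ⊤ := (hc1.trans_le le_top).ne
    filter_upwards [hg.le_mass f hf.continuous hf.eq_zero (c' - c) (tsub_pos_of_lt hc1).ne']
      with Q hQ
    by_contra hlt
    have h1 : ∫⁻ x, (f x : ℝ≥0∞) ≤ c' := calc
      _ ≤ _ := hQ
      _ ≤ c + (c' - c) := add_le_add_left (not_lt.1 hlt) _
      _ = c' := add_tsub_cancel_of_le hc1.le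
    exact absurd hc2 (not_lt.2 h1)
  have hpair : ∀ᶠ Q in atTop, ∀ j ∈ Finset.range J, pairMass (fun x => f x * g Q x) j ≤
      D * ENNReal.ofReal (((1 / 2 : ℝ) ^ j) ^ s) := by
    rw [Filter.eventually_all_finset]
    intro j _
    have hr : 0 < ((1 / 2 : ℝ) ^ j) ^ s := by positivity
    have hε : (D - C') * ENNReal.ofReal (((1 / 2 : ℝ) ^ j) ^ s) ≠ 0 :=
      mul_ne_zero (tsub_pos_of_lt hD1).ne' (by simpa using hr)
    have hcont : Continuous (Function.uncurry fun x y => f x * f y * pairCutoff j x y) :=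
      ((hf.continuous.comp continuous_fst).mul (hf.continuous.comp continuous_snd)).mul
        (continuous_pairCutoff j)
    filter_upwards [hg.pair_le _ hcont (fun x y h => by
      constructor <;> by_contra h'
      · simp [hf.eq_zero x h'] at h
      · simp [hf.eq_zero y h'] at h) _ hε] with Q hQ
    calc pairMass (fun x => f x * g Q x) j
        = ∫⁻ x, ∫⁻ y, (f x * f y * pairCutoff j x y * (g Q x * g Q y) : ℝ≥0) := by
          refine lintegral_congr fun x => lintegral_congr fun y => ?_
          congr 1
          ring
      _ ≤ pairMass f j + (D - C') * ENNReal.ofReal (((1 / 2 : ℝ) ^ j) ^ s) := hQ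
      _ ≤ C' * ENNReal.ofReal (((1 / 2 : ℝ) ^ j) ^ s) +
          (D - C') * ENNReal.ofReal (((1 / 2 : ℝ) ^ j) ^ s) := by gcongr; exact hfC j
      _ = _ := by rw [← add_mul, add_tsub_cancel_of_le hD1.le]
  filter_upwards [hmass, hpair, hgK] with Q h1 h2 h3
  refine ⟨hf.continuous.mul (hg.continuous Q), fun x hx => by simp [hf.eq_zero x hx], h1, D, hD2,
    fun j => ?_⟩
  by_cases hj : j < J
  · exact h2 j (Finset.mem_range.2 hj)
  · refine (pairMass_mul_le hf.eq_zero hB j).trans (le_trans ?_ (hJ j (not_lt.1 hj)))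
    rw [mul_assoc]
    gcongr
    refine h3 _ (by positivity) ?_
    have : (1 / 2 : ℝ) ^ j ≤ 1 := pow_le_one₀ (by norm_num) (by norm_num)
    linarith

theorem exists_energyBounded {n : ℕ} {s : ℝ} (hs : s ≤ n) :
    ∃ (c C : ℝ≥0∞) (f : (Fin n → ℝ) → ℝ≥0), c ≠ 0 ∧ c ≠ ⊤ ∧ C ≠ ⊤ ∧ EnergyBounded s c C f := by
  set f : (Fin n → ℝ) → ℝ≥0 := fun x => Real.toNNReal (1 / 2 - dist x fun _ => 1 / 2) with hf
  have hcont : Continuous f := continuous_real_toNNReal.comp (by fun_prop)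
  have hf0 : ∀ x ∉ unitCube n, f x = 0 := fun x hx => by
    rw [unitCube_eq_closedBall, Metric.mem_closedBall, not_le] at hx
    rw [hf, Real.toNNReal_eq_zero]; linarith
  obtain ⟨B, hB⟩ := exists_bound_of_eq_zero hcont hf0
  have hpos : ∫⁻ x, (f x : ℝ≥0∞) ≠ 0 := by
    rw [Ne, lintegral_eq_zero_iff (by fun_prop)]
    intro h
    have h0 : f = 0 := by
      refine hcont.ae_eq_iff_eq volume continuous_zero |>.1 ?_
      filter_upwards [h] with x hx
      simpa using hx
    have := congrFun h0 fun _ => 1 / 2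
    simp only [hf, dist_self, Pi.zero_apply, Real.toNNReal_eq_zero] at this
    norm_num at this
  have hfin : ∫⁻ x, (f x : ℝ≥0∞) ≠ ⊤ := by
    refine ne_top_of_le_ne_top (b := (B : ℝ≥0∞)) ENNReal.coe_ne_top ?_
    calc ∫⁻ x, (f x : ℝ≥0∞) ≤ ∫⁻ x, (unitCube n).indicator (fun _ => (B : ℝ≥0∞)) x := by
          refine lintegral_mono fun x => ?_
          by_cases hx : x ∈ unitCube n
          · simp [hx, hB x]
          · simp [hx, hf0 x hx]
      _ = B := by
          rw [lintegral_indicator (isCompact_unitCube n).measurableSet, setLIntegral_const,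
            volume_unitCube, mul_one]
  have hbound : ∀ j, pairMass f j ≤
      ((2 * B ^ 2 : ℝ≥0) * ENNReal.ofReal (4 ^ n)) * ENNReal.ofReal (((1 / 2 : ℝ) ^ j) ^ s) := by
    intro j
    have h1 := pairMass_mul_le (g := fun _ => 1) hf0 hB j
    simp only [mul_one] at h1
    refine h1.trans ?_
    rw [mul_assoc]
    gcongr
    simp only [ENNReal.coe_one, lintegral_const, one_mul, Measure.restrict_apply_univ]
    simp_rw [Real.volume_pi_closedBall _ (show (0 : ℝ) ≤ 2 * (1 / 2) ^ j by positivity)]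
    rw [setLIntegral_const, volume_unitCube, mul_one, ← ENNReal.ofReal_mul (by positivity)]
    refine ENNReal.ofReal_le_ofReal ?_
    rw [Fintype.card_fin, show 2 * (2 * (1 / 2 : ℝ) ^ j) = 4 * (1 / 2) ^ j by ring, mul_pow]
    gcongr
    rw [← Real.rpow_natCast _ n]
    exact Real.rpow_le_rpow_of_exponent_ge (by positivity)
      (pow_le_one₀ (by norm_num) (by norm_num)) hs
  have hCt : ((2 * B ^ 2 : ℝ≥0) : ℝ≥0∞) * ENNReal.ofReal (4 ^ n) ≠ ⊤ :=
    ENNReal.mul_ne_top ENNReal.coe_ne_top ENNReal.ofReal_ne_top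
  exact ⟨(∫⁻ x, (f x : ℝ≥0∞)) / 2, _ + 1, f, by simp [hpos], ENNReal.div_ne_top hfin (by simp),
    by simp [ENNReal.mul_ne_top], hcont, hf0, ENNReal.half_lt_self hpos hfin, _,
    ENNReal.lt_add_right hCt one_ne_zero, hbound⟩

theorem le_dimH_of_ubiquitous {n : ℕ} {s₀ : ℝ} (hs₀ : s₀ ≤ n) {g : ℕ → (Fin n → ℝ) → ℝ≥0}
    (hg : Ubiquitous s₀ g) :
    ENNReal.ofReal s₀ ≤ dimH {x ∈ unitCube n | ∃ᶠ Q in atTop, x ∈ tsupport (g Q)} := by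
  refine le_of_forall_lt fun d hd => ?_
  lift d to ℝ≥0 using (hd.trans_le le_top).ne
  obtain ⟨d', hdd', hd'⟩ := ENNReal.lt_iff_exists_nnreal_btwn.1 hd
  refine hdd'.trans_le (le_dimH_of_hausdorffMeasure_ne_zero ?_)
  have hd's : (d' : ℝ) < s₀ := by
    rw [← ENNReal.ofReal_coe_nnreal] at hd'
    exact (ENNReal.ofReal_lt_ofReal_iff_of_nonneg d'.2).1 hd'
  obtain ⟨s, hs1, hs2⟩ := exists_between hd's
  obtain ⟨c, C, f₀, hc0, hc, hC, hf₀⟩ := exists_energyBounded (n := n) (hs2.le.trans hs₀)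
  have hstep : ∀ (k : ℕ) (f : {f : (Fin n → ℝ) → ℝ≥0 // EnergyBounded s c C f}),
      ∃ Q, k ≤ Q ∧ EnergyBounded s c C fun x => f.1 x * g Q x := fun k f =>
    ((eventually_ge_atTop k).and (f.2.eventually_mul hs2 hg)).exists
  choose Q hkQ hQ using hstep
  let F : ℕ → {f : (Fin n → ℝ) → ℝ≥0 // EnergyBounded s c C f} := fun k =>
    Nat.rec ⟨f₀, hf₀⟩ (fun k f => ⟨_, hQ k f⟩) k
  have hF : ∀ k, (F (k + 1)).1 = fun x => (F k).1 x * g (Q k (F k)) x := fun k => rfl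
  have hcube : ∀ k, tsupport (F k).1 ⊆ unitCube n := fun k =>
    closure_minimal (fun x hx => by
      by_contra h
      exact hx ((F k).2.eq_zero x h)) (isCompact_unitCube n).isClosed
  have hmeas : ∀ k, Measurable fun x => ((F k).1 x : ℝ≥0∞) := fun k =>
    (F k).2.continuous.measurable.coe_nnreal_ennreal
  let μ : ℕ → Measure (Fin n → ℝ) := fun k => volume.withDensity fun x => (F k).1 x
  have hfin : ∀ k, IsFiniteMeasure (μ k) := fun k => by
    refine isFiniteMeasure_withDensity ?_
    obtain ⟨B, hB⟩ := exists_bound_of_eq_zero (F k).2.continuous (F k).2.eq_zero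
    refine ne_top_of_le_ne_top (b := (B : ℝ≥0∞)) ENNReal.coe_ne_top ?_
    calc ∫⁻ x, ((F k).1 x : ℝ≥0∞) ≤ ∫⁻ x, (unitCube n).indicator (fun _ => (B : ℝ≥0∞)) x := by
          refine lintegral_mono fun x => ?_
          by_cases hx : x ∈ unitCube n
          · simp [hx, hB x]
          · simp [hx, (F k).2.eq_zero x hx]
      _ = B := by
          rw [lintegral_indicator (isCompact_unitCube n).measurableSet, setLIntegral_const,
            volume_unitCube, mul_one]
  have hne := hausdorffMeasure_iInter_ne_zero d'.2 hs1 hc0 hc hC (fun k => tsupport (F k).1)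
    (antitone_nat_of_succ_le fun k => by
      rw [hF]; exact tsupport_mul_subset_left)
    (fun k => (isCompact_unitCube n).of_isClosed_subset (isClosed_tsupport _) (hcube k)) μ
    (fun k => by
      rw [withDensity_apply _ (isClosed_tsupport _).measurableSet.compl,
        setLIntegral_congr_fun (g := fun _ => 0) (isClosed_tsupport _).measurableSet.compl
          (fun x hx => by simp [image_eq_zero_of_notMem_tsupport hx])]
      simp)
    (fun k => by
      rw [withDensity_apply _ MeasurableSet.univ, setLIntegral_univ]
      exact (F k).2.lt_mass.le)
    (fun k j => by
      obtain ⟨C', hC', h⟩ := (F k).2.pairMass_le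
      refine le_trans ?_ ((h j).trans (mul_le_mul_left hC'.le _))
      rw [lintegral_withDensity_eq_lintegral_mul _ (hmeas k) (measurable_measure_closedBall _ _)]
      refine lintegral_mono fun x => ?_
      simp only [Pi.mul_apply]
      rw [withDensity_apply _ Metric.isClosed_closedBall.measurableSet,
        ← lintegral_const_mul' _ _ ENNReal.coe_ne_top,
        ← lintegral_indicator Metric.isClosed_closedBall.measurableSet]
      refine lintegral_mono fun y => ?_
      by_cases hy : y ∈ Metric.closedBall x ((1 / 2) ^ j)
      · rw [indicator_of_mem hy]
        rw [← ENNReal.coe_mul, ENNReal.coe_le_coe]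
        exact le_mul_of_one_le_right zero_le (one_le_pairCutoff hy)
      · rw [indicator_of_notMem hy]
        exact zero_le)
  refine fun h0 => hne (measure_mono_null (fun x hx => ?_) h0)
  rw [mem_iInter] at hx
  refine ⟨hcube 0 (hx 0), frequently_atTop.2 fun k => ⟨Q k (F k), hkQ _ _, ?_⟩⟩
  have := hx (k + 1)
  simp only [hF] at this
  exact tsupport_mul_subset_right this

/-- Integrals of functions against the density `g` are controlled by their integrals against
Lebesgue measure, up to translations by vectors with coordinates in `[0, η]`. -/
structure Equidistributed {n : ℕ} (g : (Fin n → ℝ) → ℝ≥0∞) (η : ℝ) : Prop where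
  measurable : Measurable g
  lintegral_mul_le : ∀ F F' : (Fin n → ℝ) → ℝ≥0∞, Measurable F → Measurable F' →
    (∀ x v, (∀ i, v i ∈ Icc 0 η) → F (x + v) ≤ F' x) → ∫⁻ x, F x * g x ≤ ∫⁻ x, F' x
  le_lintegral_mul : ∀ F F' : (Fin n → ℝ) → ℝ≥0∞, Measurable F → Measurable F' →
    (∀ x v, (∀ i, v i ∈ Icc 0 η) → F x ≤ F' (x + v)) → ∫⁻ x, F x ≤ ∫⁻ x, F' x * g x

theorem equidistributed_prod {n q : ℕ} (hq : 0 < q) {U : Fin n → ℝ → ℝ≥0∞}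
    (hU : ∀ i, MeanOnePeriodic (U i) (1 / q)) {η : ℝ} (hη : 1 / (q : ℝ) ≤ η) :
    Equidistributed (fun x => ∏ i, U i (x i)) η := by
  have hq' : (0 : ℝ) < q := by exact_mod_cast hq
  have hUm : ∀ i, Measurable (U i) := fun i => (hU i).measurable
  have hg : Measurable fun x : Fin n → ℝ => ∏ i, U i (x i) :=
    Finset.measurable_fun_prod _ fun i _ => (hUm i).comp (measurable_pi_apply i)
  set g : (Fin n → ℝ) → ℝ≥0∞ := fun x => ∏ i, U i (x i) with hgdef
  set S : Set (Fin n → ℝ) := univ.pi fun _ => Ioc 0 (1 / (q : ℝ)) with hS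
  have hSm : MeasurableSet S := MeasurableSet.univ_pi fun _ => measurableSet_Ioc
  set V : ℝ≥0∞ := ENNReal.ofReal (1 / q) ^ n with hV
  have hV0 : V ≠ 0 := by
    rw [hV]; exact pow_ne_zero _ (by simpa using hq.ne')
  have hVt : V ≠ ⊤ := ENNReal.pow_ne_top ENNReal.ofReal_ne_top
  have hvol : volume S = V := by
    rw [hS, volume_pi_pi]; simp [hV]
  have hint : ∀ x, ∫⁻ v in S, g (x + v) = V := fun x => by
    simp only [hgdef, Pi.add_apply]
    rw [setLIntegral_fin_pi_prod _ (fun i t => U i (x i + t))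
      (fun i => ((hU i).comp_add (x i)).measurable)]
    have := fun i => ((hU i).comp_add (x i)).lintegral_eq
    simp_rw [this]
    simp [hV]
  have hmem : ∀ v ∈ S, ∀ i, v i ∈ Icc 0 η := fun v hv i =>
    ⟨(hv i trivial).1.le, (hv i trivial).2.trans hη⟩
  have hshift : ∀ G : (Fin n → ℝ) → ℝ≥0∞, Measurable G →
      V * ∫⁻ x, G x * g x = ∫⁻ x, ∫⁻ v in S, G (x + v) * g (x + v) := fun G hG => by
    rw [lintegral_lintegral_swap]
    · have : ∀ v : Fin n → ℝ, ∫⁻ x, G (x + v) * g (x + v) = ∫⁻ x, G x * g x := fun v =>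
        lintegral_add_right_eq_self (fun x => G x * g x) v
      simp_rw [this]
      rw [setLIntegral_const, hvol, mul_comm]
    · exact ((hG.mul hg).comp (measurable_fst.add measurable_snd)).aemeasurable
  have hconst : ∀ G : (Fin n → ℝ) → ℝ≥0∞,
      ∫⁻ x, ∫⁻ v in S, G x * g (x + v) = (∫⁻ x, G x) * V := fun G => by
    rw [← lintegral_mul_const' _ _ hVt]
    refine lintegral_congr fun x => ?_
    rw [lintegral_const_mul (f := fun v => g (x + v)) _ (hg.comp (measurable_const_add x)), hint]
  refine ⟨hg, fun F F' hF hF' h => ?_, fun F F' hF hF' h => ?_⟩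
  · rw [← ENNReal.mul_le_mul_iff_right hV0 hVt, hshift F hF, mul_comm, ← hconst]
    refine lintegral_mono fun x => setLIntegral_mono' hSm fun v hv => ?_
    exact mul_le_mul_left (h x v (hmem v hv)) _
  · rw [← ENNReal.mul_le_mul_iff_right hV0 hVt, hshift F' hF', mul_comm, ← hconst]
    refine lintegral_mono fun x => setLIntegral_mono' hSm fun v hv => ?_
    exact mul_le_mul_left (h x v (hmem v hv)) _

theorem Equidistributed.average {n : ℕ} {ι : Type*} {s : Finset ι} (hs : s.Nonempty)
    {g : ι → (Fin n → ℝ) → ℝ≥0∞} {η : ℝ} (hg : ∀ i ∈ s, Equidistributed (g i) η) :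
    Equidistributed (fun x => (s.card : ℝ≥0∞)⁻¹ * ∑ i ∈ s, g i x) η := by
  have hs0 : (s.card : ℝ≥0∞) ≠ 0 := by simpa using hs.ne_empty
  have hst : (s.card : ℝ≥0∞) ≠ ⊤ := ENNReal.natCast_ne_top _
  have key : ∀ F : (Fin n → ℝ) → ℝ≥0∞, Measurable F →
      ∫⁻ x, F x * ((s.card : ℝ≥0∞)⁻¹ * ∑ i ∈ s, g i x) =
        (s.card : ℝ≥0∞)⁻¹ * ∑ i ∈ s, ∫⁻ x, F x * g i x := fun F hF => by
    rw [← lintegral_finsetSum' (f := fun i x => F x * g i x) _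
        fun i hi => (hF.mul (hg i hi).measurable).aemeasurable,
      ← lintegral_const_mul' _ _ (ENNReal.inv_ne_top.2 hs0)]
    refine lintegral_congr fun x => ?_
    rw [mul_left_comm, Finset.mul_sum]
  have hc : ∀ a : ℝ≥0∞, (s.card : ℝ≥0∞)⁻¹ * ∑ _i ∈ s, a = a := fun a => by
    rw [Finset.sum_const, nsmul_eq_mul, ← mul_assoc, ENNReal.inv_mul_cancel hs0 hst, one_mul]
  refine ⟨(Finset.measurable_fun_sum _ fun i hi => (hg i hi).measurable).const_mul _,
    fun F F' hF hF' h => ?_, fun F F' hF hF' h => ?_⟩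
  · rw [key F hF, ← hc (∫⁻ x, F' x)]
    refine mul_le_mul_right (Finset.sum_le_sum fun i hi => ?_) _
    exact (hg i hi).lintegral_mul_le F F' hF hF' h
  · rw [key F' hF', ← hc (∫⁻ x, F x)]
    refine mul_le_mul_right (Finset.sum_le_sum fun i hi => ?_) _
    exact (hg i hi).le_lintegral_mul F F' hF hF' h

theorem exists_modulus_of_hasCompactSupport {X : Type*} [PseudoMetricSpace X] {F : X → ℝ≥0}
    (hF : Continuous F) {K : Set X} (hK : IsCompact K) (hFK : ∀ x ∉ K, F x = 0) {ε : ℝ≥0}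
    (hε : 0 < ε) : ∃ η > 0, ∀ x y, dist x y ≤ η → F x ≤ F y + ε := by
  obtain ⟨η, hη, h⟩ := Metric.mem_uniformity_dist.1
    (hK.uniformContinuousAt_of_continuousAt F (fun a _ => hF.continuousAt)
      (Metric.dist_mem_uniformity hε))
  refine ⟨η / 2, by positivity, fun x y hxy => ?_⟩
  by_cases hx : x ∈ K
  · have : dist (F x) (F y) < ε := h (hxy.trans_lt (half_lt_self hη)) hx
    rw [NNReal.dist_eq] at this
    have := (abs_lt.1 this).2
    rw [← NNReal.coe_le_coe]; push_cast; linarith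
  · simp [hFK x hx]

theorem unitCube_subset_closedBall (n : ℕ) : unitCube n ⊆ Metric.closedBall 0 1 := fun x hx => by
  rw [mem_closedBall_zero_iff, pi_norm_le_iff_of_nonneg zero_le_one]
  intro i
  rw [Real.norm_eq_abs, abs_le]
  have := hx i trivial
  constructor <;> linarith [this.1, this.2]

theorem norm_le_of_forall_mem_Icc {n : ℕ} {v : Fin n → ℝ} {η : ℝ} (hη : 0 ≤ η)
    (hv : ∀ i, v i ∈ Icc 0 η) : ‖v‖ ≤ η := by
  rw [pi_norm_le_iff_of_nonneg hη]
  intro i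
  rw [Real.norm_eq_abs, abs_of_nonneg (hv i).1]
  exact (hv i).2

theorem volume_closedBall_zero_two_le (n : ℕ) :
    volume (Metric.closedBall (0 : Fin n → ℝ) 2) ≤ ENNReal.ofReal (6 ^ n) := by
  rw [Real.volume_pi_closedBall _ (by norm_num), Fintype.card_fin]
  refine ENNReal.ofReal_le_ofReal ?_
  gcongr; norm_num

theorem Equidistributed.lintegral_indicator_le {n : ℕ} {g : (Fin n → ℝ) → ℝ≥0∞} {η : ℝ}
    (hg : Equidistributed g η) (hη0 : 0 ≤ η) (hη : η ≤ 1) :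
    ∫⁻ x, (Metric.closedBall (0 : Fin n → ℝ) 2).indicator 1 x * g x ≤ ENNReal.ofReal (6 ^ n) := by
  refine (hg.lintegral_mul_le _ ((Metric.closedBall (0 : Fin n → ℝ) 3).indicator 1)
    (measurable_one.indicator measurableSet_closedBall)
    (measurable_one.indicator measurableSet_closedBall) fun x v hv => ?_).trans_eq ?_
  · by_cases hx : x + v ∈ Metric.closedBall (0 : Fin n → ℝ) 2
    · have hx' : x ∈ Metric.closedBall (0 : Fin n → ℝ) 3 := by
        rw [mem_closedBall_zero_iff] at hx ⊢
        have := norm_sub_le (x + v) v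
        rw [add_sub_cancel_right] at this
        linarith [norm_le_of_forall_mem_Icc hη0 hv]
      rw [indicator_of_mem hx, indicator_of_mem hx']; rfl
    · rw [indicator_of_notMem hx]; exact zero_le
  · rw [lintegral_indicator_one measurableSet_closedBall,
      Real.volume_pi_closedBall _ (by norm_num), Fintype.card_fin]
    norm_num

theorem lintegral_le_of_equidistributed {n : ℕ} {F : (Fin n → ℝ) → ℝ≥0} (hF : Continuous F)
    (hF0 : ∀ x ∉ unitCube n, F x = 0) {ε : ℝ≥0∞} (hε : ε ≠ 0) :
    ∃ η > 0, ∀ g : (Fin n → ℝ) → ℝ≥0∞, Equidistributed g η →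
      ∫⁻ x, F x ≤ (∫⁻ x, F x * g x) + ε := by
  obtain ⟨ε', hε', hε'ε⟩ := ENNReal.exists_nnreal_pos_mul_lt
    (ENNReal.ofReal_ne_top (r := 6 ^ n)) hε
  obtain ⟨η, hη, hmod⟩ := exists_modulus_of_hasCompactSupport hF (isCompact_unitCube n) hF0 hε'
  refine ⟨min η 1, by positivity, fun g hg => ?_⟩
  set b : (Fin n → ℝ) → ℝ≥0∞ := (Metric.closedBall (0 : Fin n → ℝ) 2).indicator 1 with hb
  have hbm : Measurable b := measurable_one.indicator measurableSet_closedBall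
  have hFm : Measurable fun x => (F x : ℝ≥0∞) := hF.measurable.coe_nnreal_ennreal
  calc ∫⁻ x, (F x : ℝ≥0∞) ≤ ∫⁻ x, (F x + ε' * b x) * g x := by
        refine hg.le_lintegral_mul _ _ hFm (hFm.add (hbm.const_mul _)) fun x v hv => ?_
        have hv' := norm_le_of_forall_mem_Icc (by positivity) hv
        by_cases hx : x ∈ unitCube n
        · have hx' := unitCube_subset_closedBall n hx
          have : b (x + v) = 1 := by
            rw [hb, indicator_of_mem]; rfl
            rw [mem_closedBall_zero_iff] at hx' ⊢
            linarith [norm_add_le x v, min_le_right η 1]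
          rw [this, mul_one]
          refine mod_cast hmod x (x + v) ?_
          rw [dist_self_add_right]; exact hv'.trans (min_le_left _ _)
        · simp [hF0 x hx]
    _ = (∫⁻ x, F x * g x) + ε' * ∫⁻ x, b x * g x := by
        rw [← lintegral_const_mul' _ _ ENNReal.coe_ne_top,
          ← lintegral_add_left (f := fun x => F x * g x) (hFm.mul hg.measurable)]
        refine lintegral_congr fun x => ?_
        ring
    _ ≤ (∫⁻ x, F x * g x) + ε := by
        gcongr
        refine le_trans ?_ hε'ε.le
        gcongr
        exact hg.lintegral_indicator_le (by positivity) (min_le_right _ _)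

theorem lintegral_lintegral_le_of_equidistributed {n : ℕ} {H : (Fin n → ℝ) → (Fin n → ℝ) → ℝ≥0}
    (hH : Continuous (Function.uncurry H))
    (hH0 : ∀ x y, H x y ≠ 0 → x ∈ unitCube n ∧ y ∈ unitCube n) {ε : ℝ≥0∞} (hε : ε ≠ 0) :
    ∃ η > 0, ∀ g : (Fin n → ℝ) → ℝ≥0∞, Equidistributed g η →
      ∫⁻ x, (∫⁻ y, H x y * g y) * g x ≤ (∫⁻ x, ∫⁻ y, H x y) + ε := by
  set M : ℝ≥0∞ := ENNReal.ofReal (6 ^ n) with hM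
  have hMt : M ≠ ⊤ := ENNReal.ofReal_ne_top
  obtain ⟨ε', hε', hε'ε⟩ := ENNReal.exists_nnreal_pos_mul_lt (a := M * M + M * M) (by finiteness) hε
  obtain ⟨η, hη, hmod⟩ := exists_modulus_of_hasCompactSupport hH
    ((isCompact_unitCube n).prod (isCompact_unitCube n)) (fun p hp => by
      by_contra h; exact hp (hH0 _ _ h)) hε'
  refine ⟨min η 1, by positivity, fun g hg => ?_⟩
  set b : (Fin n → ℝ) → ℝ≥0∞ := (Metric.closedBall (0 : Fin n → ℝ) 2).indicator 1 with hb
  set c : (Fin n → ℝ) → ℝ≥0∞ := (Metric.closedBall (0 : Fin n → ℝ) 1).indicator 1 with hc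
  have hbm : Measurable b := measurable_one.indicator measurableSet_closedBall
  have hcm : Measurable c := measurable_one.indicator measurableSet_closedBall
  have hb1 : ∀ x, ‖x‖ ≤ 2 → b x = 1 := fun x hx => by
    rw [hb, indicator_of_mem (mem_closedBall_zero_iff.2 hx)]; rfl
  have hc1 : ∀ x, ‖x‖ ≤ 1 → c x = 1 := fun x hx => by
    rw [hc, indicator_of_mem (mem_closedBall_zero_iff.2 hx)]; rfl
  have hcube : ∀ x ∈ unitCube n, ‖x‖ ≤ 1 := fun x hx =>
    mem_closedBall_zero_iff.1 (unitCube_subset_closedBall n hx)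
  have hbI : ∫⁻ x, b x ≤ M := by
    rw [hb, lintegral_indicator_one measurableSet_closedBall]
    exact volume_closedBall_zero_two_le n
  have hnear : ∀ x v : Fin n → ℝ, ‖v‖ ≤ min η 1 → ‖x + v‖ ≤ 1 → ‖x‖ ≤ 2 := fun x v hv h => by
    have := norm_sub_le (x + v) v
    rw [add_sub_cancel_right] at this
    linarith [min_le_right η 1]
  have hHm : Measurable fun p : (Fin n → ℝ) × (Fin n → ℝ) => (H p.1 p.2 : ℝ≥0∞) :=
    hH.measurable.coe_nnreal_ennreal
  have hHx : ∀ x, Measurable fun y => (H x y : ℝ≥0∞) := fun x => hHm.comp measurable_prodMk_left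
  have hbb : Measurable fun p : (Fin n → ℝ) × (Fin n → ℝ) => (ε' : ℝ≥0∞) * (b p.1 * b p.2) :=
    ((hbm.comp measurable_fst).mul (hbm.comp measurable_snd)).const_mul _
  have inner : ∀ x, ∫⁻ y, H x y * g y ≤ (∫⁻ y, H x y) + ε' * M * c x := fun x => by
    by_cases hx : x ∈ unitCube n
    · rw [hc1 x (hcube x hx), mul_one]
      calc ∫⁻ y, H x y * g y ≤ ∫⁻ y, (H x y + ε' * b y) := by
            refine hg.lintegral_mul_le _ _ (hHx x) ((hHx x).add (hbm.const_mul _))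
              fun y v hv => ?_
            have hv' := norm_le_of_forall_mem_Icc (by positivity) hv
            by_cases h0 : H x (y + v) = 0
            · simp [h0]
            · rw [hb1 y (hnear y v hv' (hcube _ (hH0 _ _ h0).2)), mul_one]
              refine mod_cast hmod (x, y + v) (x, y) ?_
              simpa using hv'.trans (min_le_left _ _)
        _ ≤ (∫⁻ y, H x y) + ε' * M := by
            rw [lintegral_add_left (hHx x), lintegral_const_mul' _ _ ENNReal.coe_ne_top]
            gcongr
    · have : ∀ y, H x y = 0 := fun y => by
        by_contra h; exact hx (hH0 _ _ h).1
      simp [this]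
  calc ∫⁻ x, (∫⁻ y, H x y * g y) * g x
      ≤ ∫⁻ x, ((∫⁻ y, H x y) + ε' * M * c x) * g x := by
        gcongr with x; exact inner x
    _ ≤ ∫⁻ x, ((∫⁻ y, (H x y + ε' * (b x * b y))) + ε' * M * b x) := by
        refine hg.lintegral_mul_le _ _ (hHm.lintegral_prod_right'.add (hcm.const_mul _))
          ((hHm.add hbb).lintegral_prod_right'.add (hbm.const_mul _)) fun x v hv => ?_
        have hv' := norm_le_of_forall_mem_Icc (by positivity) hv
        gcongr with y
        · by_cases h0 : H (x + v) y = 0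
          · simp [h0]
          · rw [hb1 x (hnear x v hv' (hcube _ (hH0 _ _ h0).1)),
              hb1 y ((hcube _ (hH0 _ _ h0).2).trans one_le_two), mul_one, mul_one]
            refine mod_cast hmod (x + v, y) (x, y) ?_
            simpa using hv'.trans (min_le_left _ _)
        · by_cases hx : ‖x + v‖ ≤ 1
          · rw [hb1 x (hnear x v hv' hx), hc1 _ hx]
          · rw [hc, indicator_of_notMem (by rwa [mem_closedBall_zero_iff])]; exact zero_le
    _ = (∫⁻ x, ∫⁻ y, H x y) + (ε' * ((∫⁻ x, b x) * ∫⁻ y, b y) + ε' * M * ∫⁻ x, b x) := by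
        rw [lintegral_add_right _ (hbm.const_mul _), lintegral_const_mul _ hbm, ← add_assoc]
        congr 1
        have : ∀ x, ∫⁻ y, (H x y + ε' * (b x * b y)) =
            (∫⁻ y, H x y) + ε' * (∫⁻ y, b y) * b x := fun x => by
          rw [lintegral_add_left (hHx x), lintegral_const_mul' _ _ ENNReal.coe_ne_top,
            lintegral_const_mul _ hbm]
          ring
        simp_rw [this]
        rw [lintegral_add_left hHm.lintegral_prod_right', lintegral_const_mul _ hbm]
        ring
    _ ≤ (∫⁻ x, ∫⁻ y, H x y) + (ε' * (M * M) + ε' * M * M) := by gcongr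
    _ ≤ (∫⁻ x, ∫⁻ y, H x y) + ε := by
        gcongr
        refine le_trans (le_of_eq ?_) hε'ε.le
        ring

theorem ubiquitous_of_equidistributed {n : ℕ} {s₀ : ℝ} {g : ℕ → (Fin n → ℝ) → ℝ≥0}
    (hcont : ∀ Q, Continuous (g Q))
    (hg : ∀ η > 0, ∀ᶠ Q in atTop, Equidistributed (fun x => (g Q x : ℝ≥0∞)) η)
    (hclose : ∃ K : ℝ≥0∞, K ≠ ⊤ ∧ ∀ᶠ Q in atTop, ∀ δ : ℝ, 0 < δ → δ ≤ 2 →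
      ∫⁻ x in unitCube n, ∫⁻ y in Metric.closedBall x δ, (g Q x * g Q y : ℝ≥0) ≤
        K * ENNReal.ofReal (δ ^ s₀)) : Ubiquitous s₀ g := by
  refine ⟨hcont, fun F hF hF0 ε hε => ?_, fun H hH hH0 ε hε => ?_, hclose⟩
  · obtain ⟨η, hη, h⟩ := lintegral_le_of_equidistributed hF hF0 hε
    filter_upwards [hg η hη] with Q hQ
    simpa using h _ hQ
  · obtain ⟨η, hη, h⟩ := lintegral_lintegral_le_of_equidistributed hH hH0 hε
    filter_upwards [hg η hη] with Q hQ
    refine le_trans (le_of_eq ?_) (h _ hQ)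
    refine lintegral_congr fun x => ?_
    rw [← lintegral_mul_const' _ _ ENNReal.coe_ne_top]
    refine lintegral_congr fun y => ?_
    push_cast; ring

theorem sum_gcd_pow_le {n : ℕ} (hn : 2 ≤ n) (N : ℕ) :
    ∑ q ∈ Finset.Ioc 0 N, ∑ r ∈ Finset.Ioc 0 N, q.gcd r ^ n ≤ N ^ (n + 1) := by
  have h1 : ∀ q ∈ Finset.Ioc 0 N, ∀ r ∈ Finset.Ioc 0 N, q.gcd r ^ n ≤
      ∑ d ∈ Finset.Ioc 0 N, (if d ∣ q then 1 else 0) * (if d ∣ r then 1 else 0) * d ^ n := by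
    intro q hq r hr
    rw [Finset.mem_Ioc] at hq hr
    have hmem : q.gcd r ∈ Finset.Ioc 0 N := Finset.mem_Ioc.2
      ⟨Nat.gcd_pos_of_pos_left _ hq.1, (Nat.le_of_dvd hq.1 (Nat.gcd_dvd_left q r)).trans hq.2⟩
    refine le_trans (le_of_eq ?_) (Finset.single_le_sum (fun _ _ => Nat.zero_le _) hmem)
    simp [Nat.gcd_dvd_left, Nat.gcd_dvd_right]
  have hcount : ∀ d, ∑ q ∈ Finset.Ioc 0 N, (if d ∣ q then 1 else 0) = N / d := fun d => by
    rw [← Finset.card_filter, Nat.Ioc_filter_dvd_card_eq_div]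
  calc ∑ q ∈ Finset.Ioc 0 N, ∑ r ∈ Finset.Ioc 0 N, q.gcd r ^ n
      ≤ ∑ q ∈ Finset.Ioc 0 N, ∑ r ∈ Finset.Ioc 0 N, ∑ d ∈ Finset.Ioc 0 N,
          (if d ∣ q then 1 else 0) * (if d ∣ r then 1 else 0) * d ^ n :=
        Finset.sum_le_sum fun q hq => Finset.sum_le_sum fun r hr => h1 q hq r hr
    _ = ∑ d ∈ Finset.Ioc 0 N, (N / d) ^ 2 * d ^ n := by
        simp_rw [Finset.sum_comm (s := Finset.Ioc 0 N) (t := Finset.Ioc 0 N)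
          (f := fun r d => _ * (if d ∣ r then 1 else 0) * d ^ n)]
        rw [Finset.sum_comm]
        refine Finset.sum_congr rfl fun d _ => ?_
        simp_rw [← Finset.sum_mul, ← Finset.mul_sum, hcount]
        rw [← Finset.sum_mul, hcount, sq]
    _ ≤ ∑ d ∈ Finset.Ioc 0 N, N ^ n := by
        refine Finset.sum_le_sum fun d hd => ?_
        rw [Finset.mem_Ioc] at hd
        obtain ⟨k, rfl⟩ := Nat.exists_eq_add_of_le hn
        calc (N / d) ^ 2 * d ^ (2 + k) = (N / d * d) ^ 2 * d ^ k := by ring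
          _ ≤ N ^ 2 * N ^ k := by
            gcongr
            exacts [Nat.div_mul_le_self _ _, hd.2]
          _ = N ^ (2 + k) := by ring
    _ = N ^ (n + 1) := by simp [pow_succ, mul_comm]

theorem sum_inv_lcm_pow_le {n : ℕ} (hn : 2 ≤ n) {Q : ℕ} (hQ : 0 < Q) :
    ∑ q ∈ Finset.Ioc Q (2 * Q), ∑ r ∈ Finset.Ioc Q (2 * Q), (1 / (q.lcm r : ℕ) : ℝ) ^ n ≤
      Q ^ 2 * (2 ^ (n + 1) * (1 / (Q : ℝ)) ^ (n + 1)) := by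
  have hQ' : (0 : ℝ) < Q := by exact_mod_cast hQ
  have hsub : Finset.Ioc Q (2 * Q) ⊆ Finset.Ioc 0 (2 * Q) := Finset.Ioc_subset_Ioc_left hQ.le
  have h1 : ∀ q ∈ Finset.Ioc Q (2 * Q), ∀ r ∈ Finset.Ioc Q (2 * Q),
      (1 / (q.lcm r : ℕ) : ℝ) ^ n ≤ (1 / (Q : ℝ) ^ 2) ^ n * (q.gcd r : ℕ) ^ n := by
    intro q hq r hr
    rw [Finset.mem_Ioc] at hq hr
    rw [← mul_pow]
    have hq' : (Q : ℝ) ≤ q := by exact_mod_cast hq.1.le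
    have hr' : (Q : ℝ) ≤ r := by exact_mod_cast hr.1.le
    have hl : (0 : ℝ) < (q.lcm r : ℕ) := by
      exact_mod_cast Nat.lcm_pos (hQ.trans hq.1) (hQ.trans hr.1)
    have hgl : (q.gcd r : ℝ) * (q.lcm r : ℕ) = q * r := by exact_mod_cast Nat.gcd_mul_lcm q r
    gcongr
    rw [div_mul_eq_mul_div, one_mul, div_le_div_iff₀ hl (by positivity), hgl, one_mul, sq]
    gcongr
  calc ∑ q ∈ Finset.Ioc Q (2 * Q), ∑ r ∈ Finset.Ioc Q (2 * Q), (1 / (q.lcm r : ℕ) : ℝ) ^ n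
      ≤ ∑ q ∈ Finset.Ioc Q (2 * Q), ∑ r ∈ Finset.Ioc Q (2 * Q),
          (1 / (Q : ℝ) ^ 2) ^ n * (q.gcd r : ℕ) ^ n :=
        Finset.sum_le_sum fun q hq => Finset.sum_le_sum fun r hr => h1 q hq r hr
    _ ≤ ∑ q ∈ Finset.Ioc 0 (2 * Q), ∑ r ∈ Finset.Ioc 0 (2 * Q),
          (1 / (Q : ℝ) ^ 2) ^ n * (q.gcd r : ℕ) ^ n := by
        refine (Finset.sum_le_sum fun q _ => Finset.sum_le_sum_of_subset_of_nonneg hsub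
          fun _ _ _ => by positivity).trans (Finset.sum_le_sum_of_subset_of_nonneg hsub
          fun _ _ _ => Finset.sum_nonneg fun _ _ => by positivity)
    _ ≤ (1 / (Q : ℝ) ^ 2) ^ n * (2 * Q : ℕ) ^ (n + 1) := by
        simp_rw [← Finset.mul_sum]
        gcongr
        exact_mod_cast sum_gcd_pow_le hn (2 * Q)
    _ = Q ^ 2 * (2 ^ (n + 1) * (1 / (Q : ℝ)) ^ (n + 1)) := by
        have e1 : 1 / (Q : ℝ) * Q = 1 := one_div_mul_cancel hQ'.ne'
        have e2 : (1 / (Q : ℝ)) ^ n * (Q : ℝ) ^ n = 1 := by rw [← mul_pow, e1, one_pow]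
        have e3 : (1 / (Q : ℝ) ^ 2) ^ n = (1 / (Q : ℝ)) ^ n * (1 / (Q : ℝ)) ^ n := by
          rw [← mul_pow]; congr 1; field_simp
        rw [e3]
        push_cast
        linear_combination 2 ^ (n + 1) * (1 / (Q : ℝ)) ^ n * Q * e2 -
          2 ^ (n + 1) * (1 / (Q : ℝ)) ^ n * Q * e1

theorem lintegral_closedBall_prod {n : ℕ} {U V : Fin n → ℝ → ℝ≥0∞} (hU : ∀ i, Measurable (U i))
    (hV : ∀ i, Measurable (V i)) {δ : ℝ} (hδ : 0 ≤ δ) :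
    ∫⁻ x in unitCube n, ∫⁻ y in Metric.closedBall x δ, (∏ i, U i (x i)) * ∏ i, V i (y i) =
      ∏ i, closeMass (U i) (V i) δ := by
  have h1 : ∀ x : Fin n → ℝ, ∫⁻ y in Metric.closedBall x δ, (∏ i, U i (x i)) * ∏ i, V i (y i) =
      ∏ i, (U i (x i) * ∫⁻ b in Icc (x i - δ) (x i + δ), V i b) := fun x => by
    rw [lintegral_const_mul (f := fun y : Fin n → ℝ => ∏ i, V i (y i)) _
      (Finset.measurable_fun_prod _ fun i _ => (hV i).comp (measurable_pi_apply i)),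
      closedBall_pi _ hδ,
      setLIntegral_fin_pi_prod _ _ hV, Finset.prod_mul_distrib]
    simp_rw [Real.closedBall_eq_Icc]
  simp_rw [h1]
  refine setLIntegral_fin_pi_prod _
    (fun i a => U i a * ∫⁻ b in Icc (a - δ) (a + δ), V i b) fun i => ?_
  simp_rw [lintegral_window_eq]
  refine (hU i).mul ?_
  exact Measurable.lintegral_prod_right' (f := fun p : ℝ × ℝ => V i (p.1 + p.2))
    ((hV i).comp (measurable_fst.add measurable_snd))

theorem prod_closeMass_le {n q r : ℕ} (hq : 0 < q) (hr : 0 < r) {U V : Fin n → ℝ → ℝ≥0∞}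
    (hU : ∀ i, MeanOnePeriodic (U i) (1 / q)) (hV : ∀ i, MeanOnePeriodic (V i) (1 / r))
    {δ : ℝ} (hδ : 0 ≤ δ) :
    ∏ i, closeMass (U i) (V i) δ ≤ ENNReal.ofReal ((2 * δ + 1 / (q.lcm r : ℕ)) ^ n) := by
  rw [ENNReal.ofReal_pow (by positivity)]
  refine (Finset.prod_le_prod' fun i _ => closeMass_le hq hr (hU i) (hV i) hδ).trans_eq ?_
  simp

theorem prod_closeMass_le_of_le_average {n q r : ℕ} (hq : 0 < q) (hr : 0 < r)
    {U V : Fin n → ℝ → ℝ≥0∞} (hU : ∀ i, MeanOnePeriodic (U i) (1 / q))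
    (hV : ∀ i, MeanOnePeriodic (V i) (1 / r)) (i₀ : Fin n) {ρ R A : ℝ} (hρ : 0 < ρ) (hρR : ρ ≤ R)
    (hA : 1 / ρ ≤ A / R)
    (hVρ : ∀ i ≠ i₀, ∀ c, V i c ≤
      ENNReal.ofReal (2 / ρ) * ∫⁻ v in Icc (-(2 * ρ)) (2 * ρ), V i (c + v))
    {δ : ℝ} (hδ : 0 ≤ δ) (hδR : δ ≤ R) :
    ∏ i, closeMass (U i) (V i) δ ≤
      ENNReal.ofReal ((4 * δ * (A / R)) ^ (n - 1) * (4 * R + 1 / (q.lcm r : ℕ)) ^ n) := by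
  have hR : 0 < R := hρ.trans_le hρR
  have hAR : 0 < A / R := lt_of_lt_of_le (by positivity) hA
  have hn : n - 1 + 1 = n := Nat.sub_add_cancel i₀.pos
  have hcard : (Finset.univ.erase i₀).card = n - 1 := by simp
  rw [← Finset.mul_prod_erase _ _ (Finset.mem_univ i₀)]
  calc closeMass (U i₀) (V i₀) δ * ∏ i ∈ Finset.univ.erase i₀, closeMass (U i) (V i) δ
      ≤ ENNReal.ofReal (4 * R + 1 / (q.lcm r : ℕ)) * ∏ _i ∈ Finset.univ.erase i₀,
          ENNReal.ofReal (4 * δ * (A / R) * (4 * R + 1 / (q.lcm r : ℕ))) := by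
        refine mul_le_mul' ((closeMass_le hq hr (hU i₀) (hV i₀) hδ).trans ?_)
          (Finset.prod_le_prod' fun i hi => (closeMass_le_of_le_average hq hr (hU i) (hV i) hρ
            (hVρ i (Finset.ne_of_mem_erase hi)) δ).trans ?_)
        · refine ENNReal.ofReal_le_ofReal ?_
          linarith
        · refine ENNReal.ofReal_le_ofReal ?_
          rw [div_eq_mul_one_div (4 * δ) ρ]
          gcongr
    _ = _ := by
        rw [Finset.prod_const, hcard, ← ENNReal.ofReal_pow (by positivity),
          ← ENNReal.ofReal_mul (by positivity), mul_pow, mul_left_comm, ← pow_succ', hn]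

theorem rpow_neg_mul_rpow_eq {n Q : ℕ} (hQ : 0 < Q) {τ s₀ : ℝ} (hs : (1 + τ) * s₀ = n + 1) :
    ((Q : ℝ) ^ (-(1 + τ))) ^ s₀ = (1 / (Q : ℝ)) ^ (n + 1) := by
  have hQ' : (0 : ℝ) < Q := by exact_mod_cast hQ
  rw [← Real.rpow_mul hQ'.le, neg_mul, hs, Real.rpow_neg hQ'.le, one_div, inv_pow]
  congr 1
  exact_mod_cast Real.rpow_natCast (Q : ℝ) (n + 1)

theorem sum_far_le {n Q : ℕ} (hn : 2 ≤ n) (hQ : 0 < Q) {τ s₀ δ : ℝ} (hs : (1 + τ) * s₀ = n + 1)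
    (hs0 : 0 ≤ s₀) (hsn : s₀ ≤ n) (hδ2 : δ ≤ 2) (hδR : (Q : ℝ) ^ (-(1 + τ)) ≤ δ) :
    ∑ q ∈ Finset.Ioc Q (2 * Q), ∑ r ∈ Finset.Ioc Q (2 * Q),
      (2 * δ + 1 / (q.lcm r : ℕ) : ℝ) ^ n ≤ Q ^ 2 * (4 ^ n * (2 ^ n + 2 ^ (n + 1)) * δ ^ s₀) := by
  have hQ' : (0 : ℝ) < Q := by exact_mod_cast hQ
  set R := (Q : ℝ) ^ (-(1 + τ)) with hR
  have hR0 : 0 < R := by positivity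
  have hδ : 0 < δ := hR0.trans_le hδR
  have h1 : ∀ q r : ℕ, (2 * δ + 1 / (q.lcm r : ℕ) : ℝ) ^ n ≤
      4 ^ n * (δ ^ n + (1 / (q.lcm r : ℕ)) ^ n) := fun q r => by
    set ℓ : ℝ := 1 / (q.lcm r : ℕ)
    have hℓ : 0 ≤ ℓ := by positivity
    calc (2 * δ + ℓ) ^ n ≤ 2 ^ (n - 1) * ((2 * δ) ^ n + ℓ ^ n) := add_pow_le (by positivity) hℓ n
      _ ≤ 2 ^ n * (2 ^ n * δ ^ n + 2 ^ n * ℓ ^ n) := by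
          rw [mul_pow]
          gcongr
          · norm_num
          · omega
          · exact le_mul_of_one_le_left (by positivity) (one_le_pow₀ (by norm_num))
      _ = _ := by rw [show (4 : ℝ) = 2 * 2 by norm_num, mul_pow]; ring
  have hδn : δ ^ n ≤ 2 ^ n * δ ^ s₀ := by
    have e : δ ^ n = 2 ^ n * (δ / 2) ^ n := by rw [← mul_pow]; congr 1; ring
    rw [e]
    gcongr
    calc (δ / 2) ^ n = (δ / 2) ^ (n : ℝ) := (Real.rpow_natCast _ _).symm
      _ ≤ (δ / 2) ^ s₀ := Real.rpow_le_rpow_of_exponent_ge (by positivity) (by linarith) hsn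
      _ ≤ δ ^ s₀ := by gcongr; linarith
  have hRδ : (1 / (Q : ℝ)) ^ (n + 1) ≤ δ ^ s₀ := by
    rw [← rpow_neg_mul_rpow_eq hQ hs]; gcongr
  have hcard : ∀ a : ℝ, ∑ _q ∈ Finset.Ioc Q (2 * Q), ∑ _r ∈ Finset.Ioc Q (2 * Q), a = Q ^ 2 * a :=
    fun a => by simp [two_mul]; ring
  calc _ ≤ ∑ q ∈ Finset.Ioc Q (2 * Q), ∑ r ∈ Finset.Ioc Q (2 * Q),
        4 ^ n * (δ ^ n + (1 / (q.lcm r : ℕ) : ℝ) ^ n) :=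
        Finset.sum_le_sum fun q _ => Finset.sum_le_sum fun r _ => h1 q r
    _ ≤ 4 ^ n * (Q ^ 2 * δ ^ n + Q ^ 2 * (2 ^ (n + 1) * (1 / (Q : ℝ)) ^ (n + 1))) := by
        simp_rw [← Finset.mul_sum, Finset.sum_add_distrib]
        rw [hcard]
        gcongr
        exact sum_inv_lcm_pow_le hn hQ
    _ ≤ 4 ^ n * (Q ^ 2 * (2 ^ n * δ ^ s₀) + Q ^ 2 * (2 ^ (n + 1) * δ ^ s₀)) := by gcongr
    _ = _ := by ring

theorem sum_near_le {n Q : ℕ} (hn : 2 ≤ n) (hQ : 0 < Q) {τ s₀ δ A : ℝ} (hτ : 0 ≤ τ)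
    (hs : (1 + τ) * s₀ = n + 1) (hsn : s₀ ≤ n - 1) (hδ : 0 < δ)
    (hδR : δ ≤ (Q : ℝ) ^ (-(1 + τ))) (hA : 0 ≤ A) :
    ∑ q ∈ Finset.Ioc Q (2 * Q), ∑ r ∈ Finset.Ioc Q (2 * Q),
      (4 * δ * (A / (Q : ℝ) ^ (-(1 + τ)))) ^ (n - 1) *
        (4 * (Q : ℝ) ^ (-(1 + τ)) + 1 / (q.lcm r : ℕ) : ℝ) ^ n ≤
      Q ^ 2 * ((4 * A) ^ (n - 1) * 8 ^ n * (1 + 2 ^ (n + 1)) * δ ^ s₀) := by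
  have hQ' : (0 : ℝ) < Q := by exact_mod_cast hQ
  have hQ1 : (1 : ℝ) ≤ Q := by exact_mod_cast hQ
  set R := (Q : ℝ) ^ (-(1 + τ)) with hR
  have hR0 : 0 < R := by positivity
  have hR1 : R ≤ 1 := Real.rpow_le_one_of_one_le_of_nonpos hQ1 (by linarith)
  have h1 : ∀ q r : ℕ, (4 * R + 1 / (q.lcm r : ℕ) : ℝ) ^ n ≤
      8 ^ n * (R ^ n + (1 / (q.lcm r : ℕ)) ^ n) := fun q r => by
    set ℓ : ℝ := 1 / (q.lcm r : ℕ)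
    have hℓ : 0 ≤ ℓ := by positivity
    calc (4 * R + ℓ) ^ n ≤ 2 ^ (n - 1) * ((4 * R) ^ n + ℓ ^ n) := add_pow_le (by positivity) hℓ n
      _ ≤ 2 ^ n * (4 ^ n * R ^ n + 4 ^ n * ℓ ^ n) := by
          rw [mul_pow]
          gcongr
          · norm_num
          · omega
          · exact le_mul_of_one_le_left (by positivity) (one_le_pow₀ (by norm_num))
      _ = _ := by rw [show (8 : ℝ) = 2 * 4 by norm_num, mul_pow]; ring
  have hRn : R ^ n ≤ R ^ s₀ := by
    rw [← Real.rpow_natCast]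
    exact Real.rpow_le_rpow_of_exponent_ge hR0 hR1 (by linarith)
  have hδn : (4 * δ * (A / R)) ^ (n - 1) ≤ (4 * A) ^ (n - 1) * (δ ^ s₀ / R ^ s₀) := by
    rw [show 4 * δ * (A / R) = 4 * A * (δ / R) by ring, mul_pow, ← Real.div_rpow hδ.le hR0.le]
    gcongr
    rw [← Real.rpow_natCast]
    refine Real.rpow_le_rpow_of_exponent_ge (by positivity) ((div_le_one hR0).2 hδR) ?_
    rw [Nat.cast_sub (by omega)]; simpa using hsn
  have hcard : ∀ a : ℝ, ∑ _q ∈ Finset.Ioc Q (2 * Q), ∑ _r ∈ Finset.Ioc Q (2 * Q), a = Q ^ 2 * a :=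
    fun a => by simp [two_mul]; ring
  calc _ ≤ ∑ q ∈ Finset.Ioc Q (2 * Q), ∑ r ∈ Finset.Ioc Q (2 * Q),
        (4 * A) ^ (n - 1) * (δ ^ s₀ / R ^ s₀) *
          (8 ^ n * (R ^ n + (1 / (q.lcm r : ℕ) : ℝ) ^ n)) := by
        gcongr with q _ r _
        exact h1 q r
    _ ≤ (4 * A) ^ (n - 1) * (δ ^ s₀ / R ^ s₀) *
          (8 ^ n * (Q ^ 2 * R ^ n + Q ^ 2 * (2 ^ (n + 1) * (1 / (Q : ℝ)) ^ (n + 1)))) := by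
        simp_rw [← Finset.mul_sum, Finset.sum_add_distrib]
        rw [hcard]
        gcongr
        exact sum_inv_lcm_pow_le hn hQ
    _ ≤ (4 * A) ^ (n - 1) * (δ ^ s₀ / R ^ s₀) *
          (8 ^ n * (Q ^ 2 * R ^ s₀ + Q ^ 2 * (2 ^ (n + 1) * R ^ s₀))) := by
        rw [← rpow_neg_mul_rpow_eq hQ hs]
        gcongr
    _ = _ := by
        have : R ^ s₀ ≠ 0 := by positivity
        field_simp

/-- The average over `Q < q ≤ 2 * Q` of the products of the functions `U q i`. -/
noncomputable def dyadicAverage {n : ℕ} (U : ℕ → Fin n → ℝ → ℝ≥0) (Q : ℕ) (x : Fin n → ℝ) : ℝ≥0 :=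
  (Q : ℝ≥0)⁻¹ * ∑ q ∈ Finset.Ioc Q (2 * Q), ∏ i, U q i (x i)

theorem coe_dyadicAverage {n : ℕ} (U : ℕ → Fin n → ℝ → ℝ≥0) {Q : ℕ} (hQ : 0 < Q)
    (x : Fin n → ℝ) : (dyadicAverage U Q x : ℝ≥0∞) =
      (Q : ℝ≥0∞)⁻¹ * ∑ q ∈ Finset.Ioc Q (2 * Q), ∏ i, (U q i (x i) : ℝ≥0∞) := by
  have : (Q : ℝ≥0) ≠ 0 := by exact_mod_cast hQ.ne'
  rw [dyadicAverage, ENNReal.coe_mul, ENNReal.coe_inv this]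
  push_cast; rfl

/-- Families of continuous `1/q`-periodic densities which, in all coordinates but `i₀`, are
controlled by their averages at the scale `q ^ (-(1 + τ)) / 2`. -/
structure DensityFamily {n : ℕ} (τ : ℝ) (i₀ : Fin n) (U : ℕ → Fin n → ℝ → ℝ≥0) : Prop where
  continuous : ∀ q i, Continuous (U q i)
  meanOnePeriodic : ∀ᶠ q : ℕ in atTop, ∀ i,
    MeanOnePeriodic (fun a => (U q i a : ℝ≥0∞)) (1 / q)
  le_average : ∀ᶠ q : ℕ in atTop, ∀ i ≠ i₀, ∀ c, (U q i c : ℝ≥0∞) ≤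
    ENNReal.ofReal (2 / ((q : ℝ) ^ (-(1 + τ)) / 2)) *
      ∫⁻ v in Icc (-(2 * ((q : ℝ) ^ (-(1 + τ)) / 2))) (2 * ((q : ℝ) ^ (-(1 + τ)) / 2)),
        (U q i (c + v) : ℝ≥0∞)

theorem DensityFamily.continuous_dyadicAverage {n : ℕ} {τ : ℝ} {i₀ : Fin n}
    {U : ℕ → Fin n → ℝ → ℝ≥0} (hU : DensityFamily τ i₀ U) (Q : ℕ) :
    Continuous (dyadicAverage U Q) := by
  unfold dyadicAverage
  refine continuous_const.mul (continuous_finsetSum _ fun q _ => continuous_finsetProd _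
    fun i _ => (hU.continuous q i).comp (continuous_apply i))

theorem DensityFamily.equidistributed_dyadicAverage {n : ℕ} {τ : ℝ} {i₀ : Fin n}
    {U : ℕ → Fin n → ℝ → ℝ≥0} (hU : DensityFamily τ i₀ U) {η : ℝ} (hη : 0 < η) :
    ∀ᶠ Q in atTop, Equidistributed (fun x => (dyadicAverage U Q x : ℝ≥0∞)) η := by
  have h1 : ∀ᶠ q : ℕ in atTop, 1 / (q : ℝ) ≤ η :=
    (tendsto_one_div_atTop_nhds_zero_nat.eventually (gt_mem_nhds hη)).mono fun _ h => h.le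
  obtain ⟨N, hN⟩ := eventually_atTop.1 (hU.meanOnePeriodic.and h1)
  filter_upwards [eventually_ge_atTop N, eventually_gt_atTop 0] with Q hQN hQ
  have := Equidistributed.average (s := Finset.Ioc Q (2 * Q)) (by rw [Finset.nonempty_Ioc]; omega)
    (g := fun q x => ∏ i, (U q i (x i) : ℝ≥0∞)) (η := η) fun q hq => by
      rw [Finset.mem_Ioc] at hq
      obtain ⟨hm, hqη⟩ := hN q (hQN.trans hq.1.le)
      exact equidistributed_prod (hQ.trans hq.1) hm hqη
  rw [Nat.card_Ioc, two_mul, Nat.add_sub_cancel] at this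
  simpa only [coe_dyadicAverage U hQ, two_mul] using this

theorem DensityFamily.lintegral_dyadicAverage_eq {n : ℕ} {τ : ℝ} {i₀ : Fin n}
    {U : ℕ → Fin n → ℝ → ℝ≥0} (hU : DensityFamily τ i₀ U) {Q : ℕ} (hQ : 0 < Q) {δ : ℝ}
    (hδ : 0 ≤ δ) :
    ∫⁻ x in unitCube n, ∫⁻ y in Metric.closedBall x δ,
      (dyadicAverage U Q x * dyadicAverage U Q y : ℝ≥0) =
    ((Q : ℝ≥0∞) ^ 2)⁻¹ * ∑ q ∈ Finset.Ioc Q (2 * Q), ∑ r ∈ Finset.Ioc Q (2 * Q),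
      ∏ i, closeMass (fun a => U q i a) (fun a => U r i a) δ := by
  have hQ0 : (Q : ℝ≥0∞) ≠ 0 := by exact_mod_cast hQ.ne'
  have hUm : ∀ q i, Measurable fun a => (U q i a : ℝ≥0∞) := fun q i =>
    (hU.continuous q i).measurable.coe_nnreal_ennreal
  have hP : ∀ q, Measurable fun x : Fin n → ℝ => ∏ i, (U q i (x i) : ℝ≥0∞) := fun q =>
    Finset.measurable_fun_prod _ fun i _ => (hUm q i).comp (measurable_pi_apply i)
  have hinner : ∀ x, ∫⁻ y in Metric.closedBall x δ,
      (dyadicAverage U Q x * dyadicAverage U Q y : ℝ≥0) =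
      ((Q : ℝ≥0∞) ^ 2)⁻¹ * ∑ q ∈ Finset.Ioc Q (2 * Q), ∑ r ∈ Finset.Ioc Q (2 * Q),
        ∫⁻ y in Metric.closedBall x δ,
          (∏ i, (U q i (x i) : ℝ≥0∞)) * ∏ i, (U r i (y i) : ℝ≥0∞) := fun x => by
    simp_rw [← lintegral_finsetSum (Finset.Ioc Q (2 * Q)) fun r _ => (hP r).const_mul _]
    rw [← lintegral_finsetSum _ fun q _ =>
        Finset.measurable_fun_sum _ fun r _ => (hP r).const_mul _,
      ← lintegral_const_mul' _ _ (ENNReal.inv_ne_top.2 (pow_ne_zero _ hQ0))]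
    refine lintegral_congr fun y => ?_
    rw [ENNReal.coe_mul, coe_dyadicAverage U hQ, coe_dyadicAverage U hQ, ← Finset.sum_mul_sum,
      ENNReal.inv_pow, sq]
    ring
  have hm : ∀ q r, Measurable fun x : Fin n → ℝ => ∫⁻ y in Metric.closedBall x δ,
      (∏ i, (U q i (x i) : ℝ≥0∞)) * ∏ i, (U r i (y i) : ℝ≥0∞) := fun q r => by
    simp_rw [lintegral_const_mul _ (hP r)]
    refine (hP q).mul ?_
    have h1 : ∀ x : Fin n → ℝ, ∫⁻ y in Metric.closedBall x δ, ∏ i, (U r i (y i) : ℝ≥0∞) =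
        (volume.withDensity fun y : Fin n → ℝ => ∏ i, (U r i (y i) : ℝ≥0∞))
          (Metric.closedBall x δ) := fun x =>
      (withDensity_apply _ Metric.isClosed_closedBall.measurableSet).symm
    simp_rw [h1]
    exact measurable_measure_closedBall _ _
  simp_rw [hinner]
  rw [lintegral_const_mul' _ _ (ENNReal.inv_ne_top.2 (pow_ne_zero _ hQ0)),
    lintegral_finsetSum _ fun q _ => Finset.measurable_fun_sum _ fun r _ => hm q r]
  simp_rw [lintegral_finsetSum (Finset.Ioc Q (2 * Q)) fun r _ => hm _ r,
    lintegral_closedBall_prod (hUm _) (hUm _) hδ]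

theorem DensityFamily.exists_close_le {n : ℕ} (hn : 2 ≤ n) {τ s₀ : ℝ} (hτ : 0 ≤ τ)
    (hs : (1 + τ) * s₀ = n + 1) (hsn : s₀ ≤ n - 1) {i₀ : Fin n}
    {U : ℕ → Fin n → ℝ → ℝ≥0} (hU : DensityFamily τ i₀ U) :
    ∃ K : ℝ≥0∞, K ≠ ⊤ ∧ ∀ᶠ Q in atTop, ∀ δ : ℝ, 0 < δ → δ ≤ 2 →
      ∫⁻ x in unitCube n, ∫⁻ y in Metric.closedBall x δ,
        (dyadicAverage U Q x * dyadicAverage U Q y : ℝ≥0) ≤ K * ENNReal.ofReal (δ ^ s₀) := by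
  have hs0 : 0 ≤ s₀ := by
    by_contra h
    have : (1 + τ) * s₀ ≤ 0 := mul_nonpos_of_nonneg_of_nonpos (by linarith) (not_le.1 h).le
    rw [hs] at this
    linarith [n.cast_nonneg (α := ℝ)]
  set A : ℝ := 2 * 2 ^ (1 + τ) with hA
  set K₁ : ℝ := (4 * A) ^ (n - 1) * 8 ^ n * (1 + 2 ^ (n + 1)) with hK₁
  set K₂ : ℝ := 4 ^ n * (2 ^ n + 2 ^ (n + 1)) with hK₂
  refine ⟨ENNReal.ofReal (max K₁ K₂), ENNReal.ofReal_ne_top, ?_⟩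
  obtain ⟨N, hN⟩ := eventually_atTop.1 (hU.meanOnePeriodic.and hU.le_average)
  filter_upwards [eventually_ge_atTop N, eventually_gt_atTop 0] with Q hQN hQ δ hδ hδ2
  have hQ' : (0 : ℝ) < Q := by exact_mod_cast hQ
  set R : ℝ := (Q : ℝ) ^ (-(1 + τ)) with hR
  have hR0 : 0 < R := by positivity
  have hfin : ∀ a : ℝ, 0 ≤ a → ((Q : ℝ≥0∞) ^ 2)⁻¹ * ENNReal.ofReal (Q ^ 2 * a) =
      ENNReal.ofReal a := fun a ha => by
    have hQ0 : (Q : ℝ≥0∞) ^ 2 ≠ 0 := pow_ne_zero _ (by exact_mod_cast hQ.ne')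
    rw [ENNReal.ofReal_mul (by positivity), ENNReal.ofReal_pow hQ'.le, ENNReal.ofReal_natCast,
      ← mul_assoc, ENNReal.inv_mul_cancel hQ0 (by finiteness), one_mul]
  have hmono : ∀ (f : ℕ → ℕ → ℝ) (K : ℝ), (∀ q r, 0 ≤ f q r) → 0 ≤ K → K ≤ max K₁ K₂ →
      (∀ q ∈ Finset.Ioc Q (2 * Q), ∀ r ∈ Finset.Ioc Q (2 * Q),
        ∏ i, closeMass (fun a => U q i a) (fun a => U r i a) δ ≤ ENNReal.ofReal (f q r)) →
      ∑ q ∈ Finset.Ioc Q (2 * Q), ∑ r ∈ Finset.Ioc Q (2 * Q), f q r ≤ Q ^ 2 * (K * δ ^ s₀) →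
      ∫⁻ x in unitCube n, ∫⁻ y in Metric.closedBall x δ,
        (dyadicAverage U Q x * dyadicAverage U Q y : ℝ≥0) ≤
        ENNReal.ofReal (max K₁ K₂) * ENNReal.ofReal (δ ^ s₀) := by
    intro f K hf hK0 hK hle hsum
    rw [hU.lintegral_dyadicAverage_eq hQ hδ.le]
    calc _ ≤ ((Q : ℝ≥0∞) ^ 2)⁻¹ * ∑ q ∈ Finset.Ioc Q (2 * Q), ∑ r ∈ Finset.Ioc Q (2 * Q),
          ENNReal.ofReal (f q r) := mul_le_mul_right
            (Finset.sum_le_sum fun q hq => Finset.sum_le_sum fun r hr => hle q hq r hr) _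
      _ = ((Q : ℝ≥0∞) ^ 2)⁻¹ * ENNReal.ofReal (∑ q ∈ Finset.Ioc Q (2 * Q),
            ∑ r ∈ Finset.Ioc Q (2 * Q), f q r) := by
          rw [ENNReal.ofReal_sum_of_nonneg fun q _ => Finset.sum_nonneg fun r _ => hf q r]
          simp_rw [ENNReal.ofReal_sum_of_nonneg fun r _ => hf _ r]
      _ ≤ ((Q : ℝ≥0∞) ^ 2)⁻¹ * ENNReal.ofReal (Q ^ 2 * (K * δ ^ s₀)) := by gcongr
      _ = ENNReal.ofReal K * ENNReal.ofReal (δ ^ s₀) := by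
          rw [hfin _ (by positivity), ENNReal.ofReal_mul hK0]
      _ ≤ _ := by gcongr
  rcases le_total R δ with hRδ | hδR
  · refine hmono _ K₂ (fun q r => ?_) (by positivity) (le_max_right _ _) (fun q hq r hr => ?_)
      (sum_far_le hn hQ hs hs0 (by linarith) hδ2 hRδ)
    · positivity
    · rw [Finset.mem_Ioc] at hq hr
      exact prod_closeMass_le (hQ.trans hq.1) (hQ.trans hr.1) (hN q (hQN.trans hq.1.le)).1
        (hN r (hQN.trans hr.1.le)).1 hδ.le
  · refine hmono _ K₁ (fun q r => ?_) (by positivity) (le_max_left _ _) (fun q hq r hr => ?_)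
      (sum_near_le (A := A) hn hQ hτ hs hsn hδ hδR (by positivity))
    · positivity
    · rw [Finset.mem_Ioc] at hq hr
      have hr0 : (0 : ℝ) < r := by exact_mod_cast hQ.trans hr.1
      have hQr : (Q : ℝ) ≤ r := by exact_mod_cast hr.1.le
      have hrQ : (r : ℝ) ≤ 2 * Q := by exact_mod_cast hr.2
      refine prod_closeMass_le_of_le_average (hQ.trans hq.1) (hQ.trans hr.1)
        (hN q (hQN.trans hq.1.le)).1 (hN r (hQN.trans hr.1.le)).1 i₀
        (ρ := (r : ℝ) ^ (-(1 + τ)) / 2) (by positivity) ?_ ?_ (hN r (hQN.trans hr.1.le)).2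
        hδ.le hδR
      · have : (r : ℝ) ^ (-(1 + τ)) ≤ R :=
          Real.rpow_le_rpow_of_nonpos hQ' hQr (by linarith)
        have : 0 < (r : ℝ) ^ (-(1 + τ)) := by positivity
        linarith
      · rw [hA, Real.rpow_neg hr0.le, Real.rpow_neg hQ'.le, div_inv_eq_mul, mul_assoc,
          ← Real.mul_rpow (by norm_num) hQ'.le, one_div_div, div_inv_eq_mul]
        gcongr

theorem DensityFamily.ubiquitous {n : ℕ} (hn : 2 ≤ n) {τ s₀ : ℝ} (hτ : 0 ≤ τ)
    (hs : (1 + τ) * s₀ = n + 1) (hsn : s₀ ≤ n - 1) {i₀ : Fin n}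
    {U : ℕ → Fin n → ℝ → ℝ≥0} (hU : DensityFamily τ i₀ U) :
    Ubiquitous s₀ (dyadicAverage U) :=
  ubiquitous_of_equidistributed hU.continuous_dyadicAverage
    (fun _ hη => hU.equidistributed_dyadicAverage hη) (hU.exists_close_le hn hτ hs hsn)

/-- The tent of half-width `w` around the circle of points at distance `c` from the integers. -/
noncomputable def tent (c w y : ℝ) : ℝ≥0 :=
  Real.toNNReal (w - |‖(y : UnitAddCircle)‖ - c|)

theorem continuous_tent (c w : ℝ) : Continuous (tent c w) := by
  have h : Continuous fun y : ℝ => ‖(y : UnitAddCircle)‖ :=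
    continuous_norm.comp (AddCircle.continuous_mk' 1)
  exact continuous_real_toNNReal.comp (continuous_const.sub (h.sub continuous_const).abs)

theorem tent_le {c w : ℝ} (hw : 0 ≤ w) (y : ℝ) : tent c w y ≤ w := by
  rw [tent, Real.coe_toNNReal']
  exact max_le (by linarith [abs_nonneg (‖(y : UnitAddCircle)‖ - c)]) hw

theorem abs_le_of_tent_ne_zero {c w y : ℝ} (h : tent c w y ≠ 0) :
    |‖(y : UnitAddCircle)‖ - c| ≤ w := by
  rw [tent, Ne, Real.toNNReal_eq_zero, not_le] at h
  linarith

/-- The integral of the tent over a period. -/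
noncomputable def tentMass (c w : ℝ) : ℝ≥0 := (∫⁻ y in Ioc (0 : ℝ) 1, tent c w y).toNNReal

theorem coe_tentMass {c w : ℝ} (hw : 0 ≤ w) :
    (tentMass c w : ℝ≥0∞) = ∫⁻ y in Ioc (0 : ℝ) 1, tent c w y := by
  refine ENNReal.coe_toNNReal (ne_top_of_le_ne_top (b := ENNReal.ofReal w) (by simp) ?_)
  calc ∫⁻ y in Ioc (0 : ℝ) 1, (tent c w y : ℝ≥0∞) ≤ ∫⁻ y in Ioc (0 : ℝ) 1, ENNReal.ofReal w := by
        refine lintegral_mono fun y => ?_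
        rw [← ENNReal.ofReal_coe_nnreal]
        exact ENNReal.ofReal_le_ofReal (tent_le hw y)
    _ = ENNReal.ofReal w := by simp

theorem tentMass_ne_zero {c w : ℝ} (hc : 0 ≤ c) (hw : 0 < w) (hcw : c + w ≤ 1 / 2) :
    tentMass c w ≠ 0 := by
  rw [← ENNReal.coe_ne_zero, coe_tentMass hw.le, ← pos_iff_ne_zero,
    setLIntegral_pos_iff (continuous_tent c w).measurable.coe_nnreal_ennreal]
  have hsub : Ioo c (c + w) ⊆
      Function.support (fun y => (tent c w y : ℝ≥0∞)) ∩ Ioc (0 : ℝ) 1 := fun y hy => by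
    refine ⟨?_, hc.trans_lt hy.1, by linarith [hy.2]⟩
    have hn : ‖(y : UnitAddCircle)‖ = y := by
      rw [UnitAddCircle.norm_eq, round_eq_zero_iff.2 ⟨by linarith [hy.1], by linarith [hy.2]⟩]
      simpa using hc.trans hy.1.le
    simp only [Function.mem_support, Ne, ENNReal.coe_eq_zero, tent, Real.toNNReal_eq_zero, not_le,
      hn]
    rw [abs_of_pos (by linarith [hy.1])]
    linarith [hy.2]
  refine lt_of_lt_of_le ?_ (measure_mono hsub)
  simpa using hw

/-- The tent function, normalised to have mean one. -/
noncomputable def normalizedTent (c w y : ℝ) : ℝ≥0 := (tentMass c w)⁻¹ * tent c w y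

theorem continuous_normalizedTent (c w : ℝ) : Continuous (normalizedTent c w) :=
  continuous_const.mul (continuous_tent c w)

theorem meanOnePeriodic_normalizedTent {c w : ℝ} (hc : 0 ≤ c) (hw : 0 < w)
    (hcw : c + w ≤ 1 / 2) : MeanOnePeriodic (fun y => (normalizedTent c w y : ℝ≥0∞)) 1 := by
  have h0 := tentMass_ne_zero hc hw hcw
  refine ⟨(continuous_normalizedTent c w).measurable.coe_nnreal_ennreal, one_pos, fun y => ?_, ?_⟩
  · have : ((y + 1 : ℝ) : UnitAddCircle) = (y : UnitAddCircle) := by simp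
    simp only [normalizedTent, tent, this]
  · simp only [normalizedTent, ENNReal.coe_mul, ENNReal.coe_inv h0]
    rw [lintegral_const_mul' _ _ (by simp [h0]), ← coe_tentMass hw.le,
      ENNReal.inv_mul_cancel (by simpa using h0) (by simp), ENNReal.ofReal_one]

theorem tent_zero_le_average {w q : ℝ} (hw : 0 < w) (hq : 0 < q) (a : ℝ) :
    (tent 0 w (q * a) : ℝ≥0∞) ≤ ENNReal.ofReal (2 / (w / q)) *
      ∫⁻ v in Icc (-(2 * (w / q))) (2 * (w / q)), (tent 0 w (q * (a + v)) : ℝ≥0∞) := by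
  by_cases h0 : tent 0 w (q * a) = 0
  · simp [h0]
  have h := abs_le_of_tent_ne_zero h0
  rw [sub_zero, abs_norm, UnitAddCircle.norm_eq, abs_le] at h
  set p : ℝ := ((round (q * a) : ℤ) : ℝ)
  set m : ℝ := p / q - a with hm
  have hmq : q * m = p - q * a := by rw [hm]; field_simp
  have hρ : 0 < w / q := by positivity
  have hm1 : |m| ≤ w / q := by
    rw [abs_le, ← neg_div, div_le_iff₀ hq, le_div_iff₀ hq, mul_comm m, hmq]
    constructor <;> linarith [h.1, h.2]
  have hsub : Icc (m - w / q / 2) (m + w / q / 2) ⊆ Icc (-(2 * (w / q))) (2 * (w / q)) :=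
    Icc_subset_Icc (by linarith [(abs_le.1 hm1).1]) (by linarith [(abs_le.1 hm1).2])
  have hlow : ∀ v ∈ Icc (m - w / q / 2) (m + w / q / 2),
      ENNReal.ofReal (w / 2) ≤ tent 0 w (q * (a + v)) := fun v hv => by
    have h1 : |v - m| ≤ w / q / 2 := abs_le.2 ⟨by linarith [hv.1], by linarith [hv.2]⟩
    have h2 : ‖((q * (a + v) : ℝ) : UnitAddCircle)‖ ≤ w / 2 := by
      rw [UnitAddCircle.norm_eq]
      refine (round_le _ (round (q * a))).trans ?_
      have : q * (a + v) - p = q * (v - m) := by rw [mul_sub, hmq]; ring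
      rw [this, abs_mul, abs_of_pos hq]
      calc q * |v - m| ≤ q * (w / q / 2) := by gcongr
        _ = w / 2 := by field_simp
    refine ENNReal.coe_le_coe.2 (Real.toNNReal_le_toNNReal ?_)
    rw [sub_zero, abs_norm]; linarith
  calc (tent 0 w (q * a) : ℝ≥0∞) ≤ ENNReal.ofReal w := by
        rw [← ENNReal.ofReal_coe_nnreal]
        exact ENNReal.ofReal_le_ofReal (tent_le hw.le _)
    _ = ENNReal.ofReal (2 / (w / q)) *
          ∫⁻ v in Icc (m - w / q / 2) (m + w / q / 2), ENNReal.ofReal (w / 2) := by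
        rw [setLIntegral_const, Real.volume_Icc, ← ENNReal.ofReal_mul (by positivity),
          ← ENNReal.ofReal_mul (by positivity)]
        congr 1; field_simp; ring
    _ ≤ _ := by
        refine mul_le_mul' le_rfl ?_
        exact (setLIntegral_mono' measurableSet_Icc hlow).trans (lintegral_mono_set hsub)

theorem normalizedTent_zero_le_average {w q : ℝ} (hw : 0 < w) (hq : 0 < q) (a : ℝ) :
    (normalizedTent 0 w (q * a) : ℝ≥0∞) ≤ ENNReal.ofReal (2 / (w / q)) *
      ∫⁻ v in Icc (-(2 * (w / q))) (2 * (w / q)), (normalizedTent 0 w (q * (a + v)) : ℝ≥0∞) := by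
  simp only [normalizedTent, ENNReal.coe_mul]
  rw [lintegral_const_mul' _ _ ENNReal.coe_ne_top, mul_left_comm]
  gcongr
  exact tent_zero_le_average hw hq a

/-- The densities concentrating near the points `x` for which `‖q x‖` is slightly less than
`ψ q` in the coordinate `i₀`, and at most `ψ q / 2` in the other coordinates. -/
noncomputable def annulusDensity {n : ℕ} (i₀ : Fin n) (ψ φ : ℕ → ℝ) (q : ℕ) (i : Fin n) (a : ℝ) :
    ℝ≥0 :=
  if i = i₀ then normalizedTent (ψ q * (1 - φ q / 2)) (φ q * ψ q / 4) (q * a)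
  else normalizedTent 0 (ψ q / 2) (q * a)

theorem tendsto_natCast_rpow_neg {τ : ℝ} (hτ : 0 < τ) :
    Tendsto (fun q : ℕ => (q : ℝ) ^ (-τ)) atTop (𝓝 0) :=
  (tendsto_rpow_neg_atTop hτ).comp tendsto_natCast_atTop_atTop

theorem eventually_rpow_neg_le {τ : ℝ} (hτ : 0 < τ) {a : ℝ} (ha : 0 < a) :
    ∀ᶠ q : ℕ in atTop, (q : ℝ) ^ (-τ) ≤ a :=
  ((tendsto_natCast_rpow_neg hτ).eventually (gt_mem_nhds ha)).mono fun _ h => h.le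

theorem densityFamily_annulusDensity {n : ℕ} (i₀ : Fin n) {τ τ' : ℝ} (hτ : 0 < τ) (hτ' : 0 < τ') :
    DensityFamily τ i₀
      (annulusDensity i₀ (fun q => (q : ℝ) ^ (-τ)) (fun q => (q : ℝ) ^ (-τ'))) := by
  refine ⟨fun q i => ?_, ?_, ?_⟩
  · unfold annulusDensity
    split_ifs
    · exact (continuous_normalizedTent _ _).comp (continuous_const_mul _)
    · exact (continuous_normalizedTent _ _).comp (continuous_const_mul _)
  · filter_upwards [eventually_rpow_neg_le hτ (a := 1 / 2) (by norm_num),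
      eventually_rpow_neg_le hτ' one_pos, eventually_gt_atTop 0] with q h1 h2 hq i
    have hq' : (0 : ℝ) < q := by exact_mod_cast hq
    have hψ : 0 < (q : ℝ) ^ (-τ) := by positivity
    have hφ : 0 < (q : ℝ) ^ (-τ') := by positivity
    by_cases hi : i = i₀
    · simp only [annulusDensity, hi, if_true]
      have := (meanOnePeriodic_normalizedTent (c := (q : ℝ) ^ (-τ) * (1 - (q : ℝ) ^ (-τ') / 2))
        (w := (q : ℝ) ^ (-τ') * (q : ℝ) ^ (-τ) / 4)
        (mul_nonneg hψ.le (by linarith)) (by positivity) (by nlinarith)).comp_affine hq 0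
      simpa using this
    · simp only [annulusDensity, hi, if_false]
      have := (meanOnePeriodic_normalizedTent (c := 0) (w := (q : ℝ) ^ (-τ) / 2) le_rfl
        (by positivity) (by linarith)).comp_affine hq 0
      simpa using this
  · filter_upwards [eventually_gt_atTop 0] with q hq i hi a
    have hq' : (0 : ℝ) < q := by exact_mod_cast hq
    have h := normalizedTent_zero_le_average (w := (q : ℝ) ^ (-τ) / 2) (by positivity) hq' a
    have e : (q : ℝ) ^ (-(1 + τ)) / 2 = (q : ℝ) ^ (-τ) / 2 / q := by
      rw [neg_add, add_comm, Real.rpow_add hq', Real.rpow_neg_one]; ring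
    simp only [annulusDensity, hi, if_false, e]
    exact h

theorem exists_of_mem_tsupport_annulusDensity {n : ℕ} {i₀ : Fin n} {ψ φ : ℕ → ℝ} {Q : ℕ}
    {x : Fin n → ℝ} (hx : x ∈ tsupport (dyadicAverage (annulusDensity i₀ ψ φ) Q)) :
    ∃ q ∈ Finset.Ioc Q (2 * Q),
      |‖((q * x i₀ : ℝ) : UnitAddCircle)‖ - ψ q * (1 - φ q / 2)| ≤ φ q * ψ q / 4 ∧
      ∀ i, i ≠ i₀ → ‖((q * x i : ℝ) : UnitAddCircle)‖ ≤ ψ q / 2 := by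
  have hcont (q : ℕ) (i : Fin n) :
      Continuous fun x : Fin n → ℝ => ‖((q * x i : ℝ) : UnitAddCircle)‖ :=
    continuous_norm.comp ((AddCircle.continuous_mk' 1).comp
      (continuous_const.mul (continuous_apply i)))
  have hclosed : IsClosed (⋃ q ∈ Finset.Ioc Q (2 * Q), {x : Fin n → ℝ |
      |‖((q * x i₀ : ℝ) : UnitAddCircle)‖ - ψ q * (1 - φ q / 2)| ≤ φ q * ψ q / 4 ∧
      ∀ i, i ≠ i₀ → ‖((q * x i : ℝ) : UnitAddCircle)‖ ≤ ψ q / 2}) := by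
    refine isClosed_biUnion_finset fun q _ =>
      (isClosed_le ((hcont q i₀).sub continuous_const).abs continuous_const).and ?_
    simp only [ofPred_forall]
    exact isClosed_iInter fun i => isClosed_iInter fun _ =>
      isClosed_le (hcont q i) continuous_const
  have h := closure_minimal (fun y hy => ?_) hclosed hx
  · simpa only [mem_iUnion₂, exists_prop, mem_ofPred_eq] using h
  · have hne : ∑ q ∈ Finset.Ioc Q (2 * Q), ∏ i, annulusDensity i₀ ψ φ q i (y i) ≠ 0 :=
      right_ne_zero_of_mul hy
    obtain ⟨q, hq, hq0⟩ := Finset.exists_ne_zero_of_sum_ne_zero hne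
    rw [Finset.prod_ne_zero_iff] at hq0
    refine mem_biUnion hq ⟨?_, fun i hi => ?_⟩
    · have h0 := hq0 i₀ (Finset.mem_univ _)
      rw [annulusDensity, if_pos rfl] at h0
      exact abs_le_of_tent_ne_zero (right_ne_zero_of_mul h0)
    · have h0 := hq0 i (Finset.mem_univ _)
      rw [annulusDensity, if_neg hi] at h0
      simpa using abs_le_of_tent_ne_zero (right_ne_zero_of_mul h0)

theorem mem_Wpsiphi_of_frequently {n : ℕ} {i₀ : Fin n} {ψ φ : ℕ → ℝ}
    (hψ : ∀ q, 0 < q → 0 < ψ q) (hφ : ∀ q, 0 < q → 0 < φ q) {x : Fin n → ℝ} (hx : x ∈ unitCube n)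
    (h : ∃ᶠ Q in atTop, x ∈ tsupport (dyadicAverage (annulusDensity i₀ ψ φ) Q)) :
    x ∈ Wpsiphi n ψ φ := by
  refine ⟨hx, Set.Infinite.of_image Prod.snd (Set.infinite_of_forall_exists_gt fun N => ?_)⟩
  obtain ⟨Q, hNQ, hQ⟩ := frequently_atTop.1 h N
  obtain ⟨q, hq, h₀, h₁⟩ := exists_of_mem_tsupport_annulusDensity hQ
  have hQq := (Finset.mem_Ioc.1 hq).1
  have hq0 : 0 < q := (Nat.zero_le Q).trans_lt hQq
  have hq' : (0 : ℝ) < q := by exact_mod_cast hq0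
  have hdist (i : Fin n) : ‖(x - fun i => ((round (q * x i) : ℤ) : ℝ) / q) i‖ =
      ‖((q * x i : ℝ) : UnitAddCircle)‖ / q := by
    rw [UnitAddCircle.norm_eq, Pi.sub_apply, Real.norm_eq_abs, eq_div_iff hq'.ne',
      ← abs_of_pos hq', ← abs_mul, abs_of_pos hq', sub_mul, div_mul_cancel₀ _ hq'.ne', mul_comm]
  have hψq := hψ q hq0
  have hφψ := mul_pos (hφ q hq0) hψq
  rw [abs_le] at h₀
  refine ⟨q, ⟨(fun i => round (q * x i), q), ⟨hq0, ?_, ?_⟩, rfl⟩, hNQ.trans_lt hQq⟩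
  · refine lt_of_lt_of_le ?_ (norm_le_pi_norm _ i₀)
    rw [hdist, ← mul_div_assoc, div_lt_div_iff_of_pos_right hq']
    nlinarith [h₀.1]
  · refine (pi_norm_lt_iff (div_pos hψq hq')).2 fun i => ?_
    rw [hdist, div_lt_div_iff_of_pos_right hq']
    rcases eq_or_ne i i₀ with rfl | hi
    · nlinarith [h₀.2]
    · linarith [h₁ i hi]

theorem le_dimH_Wpsiphi_s13 {n : ℕ} (hn : 2 ≤ n) {τ τ' : ℝ} (hτ' : 0 < τ')
    (h : 2 / ((n : ℝ) - 1) ≤ τ) :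
    ENNReal.ofReal (((n : ℝ) + 1) / (1 + τ)) ≤
      dimH (Wpsiphi n (fun q => (q : ℝ) ^ (-τ)) (fun q => (q : ℝ) ^ (-τ'))) := by
  have hn' : (2 : ℝ) ≤ n := by exact_mod_cast hn
  have hn1 : (0 : ℝ) < n - 1 := by linarith
  have hτ : 0 < τ := lt_of_lt_of_le (by positivity) h
  rw [div_le_iff₀ hn1] at h
  have hs : ((n : ℝ) + 1) / (1 + τ) ≤ n - 1 := by
    rw [div_le_iff₀ (by linarith)]; nlinarith
  have hU := densityFamily_annulusDensity ⟨0, by lia⟩ hτ hτ' (n := n)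
  refine (le_dimH_of_ubiquitous (hs.trans (by linarith))
    (hU.ubiquitous hn hτ.le (mul_div_cancel₀ _ (by linarith)) hs)).trans (dimH_mono ?_)
  rintro x ⟨hx, hfreq⟩
  exact mem_Wpsiphi_of_frequently (fun q hq => by positivity) (fun q hq => by positivity) hx hfreq

theorem exists_natCast_eq_of_norm_lt {n : ℕ} {x : Fin n → ℝ} (hx : x ∈ unitCube n)
    {p : Fin n → ℤ} {q : ℕ} (hq : 0 < q) {r : ℝ} (hr : r ≤ 1)
    (h : ‖x - fun i => (p i : ℝ) / q‖ < r / q) (i : Fin n) : 0 ≤ p i ∧ p i ≤ q := by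
  have hq' : (0 : ℝ) < q := by exact_mod_cast hq
  have hi := (norm_le_pi_norm (x - fun i => (p i : ℝ) / q) i).trans_lt h
  rw [Pi.sub_apply, Real.norm_eq_abs, lt_div_iff₀ hq', ← abs_of_pos hq', ← abs_mul,
    abs_of_pos hq', sub_mul, div_mul_cancel₀ _ hq'.ne', abs_lt] at hi
  obtain ⟨h0, h1⟩ := hx i (mem_univ i)
  have h2 : (-1 : ℝ) < p i := by nlinarith
  have h3 : (p i : ℝ) < q + 1 := by nlinarith
  norm_cast at h2 h3
  lia

theorem exists_norm_lt_of_mem_Wpsiphi {n : ℕ} {ψ φ : ℕ → ℝ} (hψ : ∀ q, 0 < q → ψ q ≤ 1)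
    {x : Fin n → ℝ} (hx : x ∈ Wpsiphi n ψ φ) (N : ℕ) :
    ∃ q, N ≤ q ∧ 0 < q ∧ ∃ p : Fin n → Fin (q + 1),
      ‖x - fun i => ((p i : ℕ) : ℝ) / q‖ < ψ q / q := by
  by_contra! hN
  refine hx.2 (Set.Finite.subset ((finite_Icc (0 : Fin n → ℤ) fun _ => (N : ℤ)).prod
    (finite_Iio N)) ?_)
  rintro ⟨p, q⟩ ⟨hq, -, hlt⟩
  have hp := exists_natCast_eq_of_norm_lt hx.1 hq (hψ q hq) hlt
  have hqN : q < N := by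
    by_contra! hle
    refine (hN q hle hq fun i => ⟨(p i).toNat, by have := hp i; lia⟩).not_gt ?_
    have e : (fun i => (((p i).toNat : ℕ) : ℝ) / q) = fun i => (p i : ℝ) / q :=
      funext fun i => congrArg (· / (q : ℝ)) (by exact_mod_cast Int.toNat_of_nonneg (hp i).1)
    exact e ▸ hlt
  exact ⟨⟨fun i => (hp i).1, fun i => (hp i).2.trans (Int.ofNat_le.2 hqN.le)⟩, hqN⟩

theorem dimH_Wpsiphi_le_s13 {n : ℕ} {τ : ℝ} (hτ : 0 ≤ τ) (φ : ℕ → ℝ) :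
    dimH (Wpsiphi n (fun q => (q : ℝ) ^ (-τ)) φ) ≤
      ENNReal.ofReal (((n : ℝ) + 1) / (1 + τ)) := by
  refine dimH_le fun d hd => ?_
  by_contra! hlt
  rw [ENNReal.ofReal_lt_coe_iff (by positivity), div_lt_iff₀ (by linarith)] at hlt
  have hψ (q : ℕ) (hq : 0 < q) : (q : ℝ) ^ (-τ) ≤ 1 :=
    Real.rpow_le_one_of_one_le_of_nonpos (by exact_mod_cast hq) (by linarith)
  let t : (N : ℕ) → (Σ q : ℕ, (Fin n → Fin (q + 1))) → Set (Fin n → ℝ) := fun N c =>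
    if N ≤ c.1 then Metric.closedBall (fun i => ((c.2 i : ℕ) : ℝ) / c.1)
      ((c.1 : ℝ) ^ (-(1 + τ))) else ∅
  let f : ℕ → ℝ := fun q => 2 ^ n * 2 ^ (d : ℝ) * (q : ℝ) ^ (n - (1 + τ) * d)
  have hdiam (N q : ℕ) (hNq : N ≤ q) (p) :
      Metric.ediam (t N ⟨q, p⟩) ≤ ENNReal.ofReal (2 * (q : ℝ) ^ (-(1 + τ))) := by
    simp only [t, hNq, if_true]
    refine Metric.ediam_le_of_forall_dist_le fun x hx y hy => ?_
    rw [two_mul]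
    exact (dist_triangle_right x y _).trans (add_le_add hx hy)
  have hsum : Summable f := (Real.summable_nat_rpow.2 (by linarith)).mul_left _
  have key : μH[d] (Wpsiphi n (fun q => (q : ℝ) ^ (-τ)) φ) ≤
      liminf (fun N => ∑' c, Metric.ediam (t N c) ^ (d : ℝ)) atTop := by
    refine Measure.hausdorffMeasure_le_liminf_tsum d _
      (fun N : ℕ => ENNReal.ofReal (2 * (N : ℝ) ^ (-(1 + τ)))) ?_ t ?_ ?_
    · have := (tendsto_natCast_rpow_neg (τ := 1 + τ) (by linarith)).const_mul 2
      simpa using ENNReal.tendsto_ofReal this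
    · filter_upwards [eventually_gt_atTop 0] with N hN
      rintro ⟨q, p⟩
      by_cases hNq : N ≤ q
      · refine (hdiam N q hNq p).trans (ENNReal.ofReal_le_ofReal ?_)
        gcongr 2 * ?_
        exact Real.rpow_le_rpow_of_nonpos (by exact_mod_cast hN) (by exact_mod_cast hNq)
          (by linarith)
      · simp [t, hNq]
    · refine Eventually.of_forall fun N x hx => ?_
      obtain ⟨q, hNq, hq, p, hp⟩ := exists_norm_lt_of_mem_Wpsiphi hψ hx N
      refine mem_iUnion.2 ⟨⟨q, p⟩, ?_⟩
      simp only [t, hNq, if_true, Metric.mem_closedBall, dist_eq_norm]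
      refine hp.le.trans_eq ?_
      rw [neg_add, add_comm, Real.rpow_add (by exact_mod_cast hq), Real.rpow_neg_one,
        div_eq_mul_inv]
  have hbound : liminf (fun N => ∑' c, Metric.ediam (t N c) ^ (d : ℝ)) atTop ≤
      ∑' q, ENNReal.ofReal (f q) := by
    refine liminf_le_of_frequently_le' (Eventually.frequently ?_)
    filter_upwards [eventually_gt_atTop 0] with N hN
    refine (ENNReal.tsum_sigma' _).trans_le ?_
    refine ENNReal.tsum_le_tsum fun q => ?_
    by_cases hNq : N ≤ q
    · have hq' : (1 : ℝ) ≤ q := by exact_mod_cast hN.trans_le hNq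
      have hq0 : (0 : ℝ) < q := by linarith
      calc ∑' p, Metric.ediam (t N ⟨q, p⟩) ^ (d : ℝ)
          ≤ ∑' _ : Fin n → Fin (q + 1),
              ENNReal.ofReal ((2 * (q : ℝ) ^ (-(1 + τ))) ^ (d : ℝ)) := by
            refine ENNReal.tsum_le_tsum fun p => ?_
            exact (ENNReal.rpow_le_rpow (hdiam N q hNq p) d.2).trans_eq
              (ENNReal.ofReal_rpow_of_nonneg (by positivity) d.2)
        _ = ENNReal.ofReal (((q : ℝ) + 1) ^ n * (2 * (q : ℝ) ^ (-(1 + τ))) ^ (d : ℝ)) := by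
            rw [tsum_fintype, Finset.sum_const, nsmul_eq_mul, ENNReal.ofReal_mul (by positivity),
              ← ENNReal.ofReal_natCast]
            simp
        _ ≤ ENNReal.ofReal (f q) := by
            refine ENNReal.ofReal_le_ofReal ?_
            calc ((q : ℝ) + 1) ^ n * (2 * (q : ℝ) ^ (-(1 + τ))) ^ (d : ℝ)
                ≤ (2 * q) ^ n * (2 * (q : ℝ) ^ (-(1 + τ))) ^ (d : ℝ) := by
                  gcongr; linarith
              _ = f q := by
                  rw [Real.mul_rpow two_pos.le (by positivity), ← Real.rpow_mul hq0.le, mul_pow,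
                    ← Real.rpow_natCast (q : ℝ) n]
                  simp only [f]
                  rw [sub_eq_add_neg, Real.rpow_add hq0, neg_mul]
                  ring
    · have hd0 : (0 : ℝ) < d := by
        by_contra! hd0
        nlinarith [n.cast_nonneg (α := ℝ)]
      simp [t, hNq, hd0]
  exact (ne_top_of_le_ne_top hsum.tsum_ofReal_ne_top (key.trans hbound)) hd

theorem stmt13 (n : ℕ) (hn : 2 ≤ n) (τψ τφ : ℝ) (hτφ : 0 < τφ)
    (h : 2 / ((n : ℝ) - 1) ≤ τψ) :
    dimH (Wpsiphi n (fun q => (q : ℝ) ^ (-τψ)) (fun q => (q : ℝ) ^ (-τφ))) =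
      ENNReal.ofReal (((n : ℝ) + 1) / (1 + τψ)) := by
  have hn' : (2 : ℝ) ≤ n := by exact_mod_cast hn
  have hτψ : 0 ≤ τψ := (div_nonneg two_pos.le (by linarith)).trans h
  exact le_antisymm (dimH_Wpsiphi_le_s13 hτψ _) (le_dimH_Wpsiphi_s13 hn hτφ h)
end

section
/- Let n ≥ 2, let ψ(q) = q^{-τ_ψ} with 1/n ≤ τ_ψ < 2/(n-1), let ε > 0 and set f(q) = 1 - q^{-ε}. Then dim_H Exact_n(f, ψ) ≤ (n + 1 + (n-1)ε)/(1 + τ_ψ + ε), and this bound is strictly less than (n+1)/(1+τ_ψ). -/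
open MeasureTheory Filter Set

/-- `Exact_n(f, ψ)`: the set of `x ∈ [0,1]^n` such that `‖x - p/q‖ < ψ(q)/q` for
infinitely many `(p,q) ∈ ℤ^n × ℕ`, and `‖x - p/q‖ > f(q)·ψ(q)/q` for all `p ∈ ℤ^n`
and all sufficiently large `q ∈ ℕ`. -/
def ExactSet (n : ℕ) (f ψ : ℕ → ℝ) : Set (Fin n → ℝ) :=
  {x ∈ unitCube n |
    {pq : (Fin n → ℤ) × ℕ | 0 < pq.2 ∧
      ‖x - fun i => (pq.1 i : ℝ) / pq.2‖ < ψ pq.2 / pq.2}.Infinite ∧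
    ∀ᶠ q : ℕ in atTop, ∀ p : Fin n → ℤ,
      f q * (ψ q / q) < ‖x - fun i => (p i : ℝ) / q‖}

/-- A set all of whose points lie infinitely often in one of `#(F q)` sets of diameter at most
`δ q` has dimension at most `s` as soon as `∑ #(F q) δ(q)^s` converges. -/
theorem dimH_le_of_frequently_mem_cover {X κ : Type*} [EMetricSpace X] {E : Set X}
    (F : ℕ → Finset κ) (C : ℕ → κ → Set X) {δ : ℕ → ℝ} {s : NNReal}
    (hE : ∀ x ∈ E, ∃ᶠ q in atTop, ∃ c ∈ F q, x ∈ C q c)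
    (hpos : ∀ q, 0 ≤ δ q) (hanti : AntitoneOn δ (Ici 1)) (hlim : Tendsto δ atTop (nhds 0))
    (hdiam : ∀ q, ∀ c ∈ F q, Metric.ediam (C q c) ≤ ENNReal.ofReal (δ q))
    (hsum : Summable fun q => ((F q).card : ℝ) * δ q ^ (s : ℝ)) :
    dimH E ≤ s := by
  borelize X
  have key : Measure.hausdorffMeasure (s : ℝ) E ≤ 0 := by
    have hbound : ∀ N : ℕ, ∑' i : (Σ q : ℕ, F (q + N)),
        Metric.ediam (C (i.1 + N) i.2) ^ (s : ℝ) ≤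
        ∑' q : ℕ, ENNReal.ofReal (((F (q + N)).card : ℝ) * δ (q + N) ^ (s : ℝ)) := by
      intro N
      rw [ENNReal.tsum_sigma']
      refine ENNReal.tsum_le_tsum fun q => ?_
      rw [tsum_fintype]
      calc ∑ c : F (q + N), Metric.ediam (C (q + N) c) ^ (s : ℝ)
          ≤ ∑ _c : F (q + N), ENNReal.ofReal (δ (q + N) ^ (s : ℝ)) := by
            refine Finset.sum_le_sum fun c _ => ?_
            rw [← ENNReal.ofReal_rpow_of_nonneg (hpos _) s.coe_nonneg]
            exact ENNReal.rpow_le_rpow (hdiam _ c c.2) s.coe_nonneg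
        _ = _ := by
            rw [ENNReal.ofReal_mul (by positivity)]
            simp
    have htend : Tendsto (fun N : ℕ => ∑' q : ℕ,
        ENNReal.ofReal (((F (q + N)).card : ℝ) * δ (q + N) ^ (s : ℝ))) atTop (nhds 0) :=
      ENNReal.tendsto_sum_nat_add
        (fun q => ENNReal.ofReal (((F q).card : ℝ) * δ q ^ (s : ℝ))) hsum.tsum_ofReal_ne_top
    refine le_trans (Measure.hausdorffMeasure_le_liminf_tsum (ι := fun N : ℕ => Σ q : ℕ, F (q + N))
      (s : ℝ) E (l := atTop) (fun N => ENNReal.ofReal (δ N)) ?_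
      (fun N i => C (i.1 + N) i.2) ?_ ?_) (((liminf_le_liminf (Eventually.of_forall hbound))).trans
        htend.liminf_eq.le)
    · simpa using ENNReal.tendsto_ofReal hlim
    · filter_upwards [eventually_ge_atTop 1] with N hN i
      refine (hdiam _ _ i.2.2).trans (ENNReal.ofReal_le_ofReal ?_)
      exact hanti hN (show 1 ≤ i.1 + N by omega) (by omega)
    · refine Eventually.of_forall fun N x hx => ?_
      obtain ⟨q, hq, c, hc, hxc⟩ := frequently_atTop.1 (hE x hx) N
      obtain ⟨m, rfl⟩ := Nat.exists_eq_add_of_le' hq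
      exact mem_iUnion.2 ⟨⟨m, c, hc⟩, hxc⟩
  refine dimH_le_of_hausdorffMeasure_ne_top ?_
  simp [le_antisymm key bot_le]

/-- Integer numerators of rationals of denominator `q` lying in `[-1,2]^n`. -/
noncomputable def numerators (n q : ℕ) : Finset (Fin n → ℤ) :=
  Fintype.piFinset fun _ => Finset.Icc (-(q : ℤ)) (2 * q)

/-- Positions in `ℤ^n` of the unit cells that meet the shell `u - 1 < ‖z‖ < u`. -/
noncomputable def shellCells (n : ℕ) (u : ℝ) : Finset (Fin n → ℤ) :=
  Finset.univ.biUnion fun i => Fintype.piFinset fun j =>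
    if j = i then Finset.Icc ⌊-u⌋ ⌊1 - u⌋ ∪ Finset.Icc ⌊u - 1⌋ ⌊u⌋ else Finset.Icc ⌊-u⌋ ⌊u⌋

theorem card_numerators_le (n q : ℕ) (hq : 1 ≤ q) :
    ((numerators n q).card : ℝ) ≤ (4 * q : ℝ) ^ n := by
  have h : (numerators n q).card = (3 * q + 1) ^ n := by
    rw [numerators, Fintype.card_piFinset]
    simp only [Int.card_Icc, Finset.prod_const, Finset.card_univ, Fintype.card_fin]
    congr 1
    omega
  rw [h]
  push_cast
  have : (1 : ℝ) ≤ q := by exact_mod_cast hq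
  gcongr
  linarith

theorem card_shellCells_le (n : ℕ) {u : ℝ} (hu : 1 ≤ u) :
    ((shellCells n u).card : ℝ) ≤ n * (4 * (4 * u) ^ (n - 1)) := by
  have hA : (((Finset.Icc ⌊-u⌋ ⌊1 - u⌋ ∪ Finset.Icc ⌊u - 1⌋ ⌊u⌋).card : ℕ) : ℝ) ≤ 4 := by
    have h₁ : ⌊1 - u⌋ = ⌊-u⌋ + 1 := by
      rw [show 1 - u = -u + 1 by ring, Int.floor_add_one]
    have h₂ : ⌊u - 1⌋ = ⌊u⌋ - 1 := Int.floor_sub_one u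
    have h := Finset.card_union_le (Finset.Icc ⌊-u⌋ ⌊1 - u⌋) (Finset.Icc ⌊u - 1⌋ ⌊u⌋)
    simp only [Int.card_Icc] at h
    have h' : (Finset.Icc ⌊-u⌋ ⌊1 - u⌋ ∪ Finset.Icc ⌊u - 1⌋ ⌊u⌋).card ≤ 4 := by omega
    exact_mod_cast h'
  have hB : ((Finset.Icc ⌊-u⌋ ⌊u⌋).card : ℝ) ≤ 4 * u := by
    have h₁ : (0 : ℤ) ≤ ⌊u⌋ := Int.floor_nonneg.2 (by linarith)
    have h₂ : ⌊-u⌋ ≤ 0 := Int.floor_le_iff.2 (by push_cast; linarith)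
    have h₃ : (((Finset.Icc ⌊-u⌋ ⌊u⌋).card : ℤ) : ℝ) = ((⌊u⌋ + 1 - ⌊-u⌋ : ℤ) : ℝ) := by
      rw [Int.card_Icc, Int.toNat_of_nonneg (by omega)]
    have h₄ := Int.floor_le u
    have h₅ := Int.lt_floor_add_one (-u)
    push_cast at h₃
    linarith
  calc ((shellCells n u).card : ℝ)
      ≤ ∑ i : Fin n, ((Fintype.piFinset fun j : Fin n => if j = i then
          Finset.Icc ⌊-u⌋ ⌊1 - u⌋ ∪ Finset.Icc ⌊u - 1⌋ ⌊u⌋ else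
          Finset.Icc ⌊-u⌋ ⌊u⌋).card : ℝ) := by
        exact_mod_cast Finset.card_biUnion_le
    _ ≤ ∑ _i : Fin n, 4 * (4 * u) ^ (n - 1) := by
        refine Finset.sum_le_sum fun i _ => ?_
        rw [Fintype.card_piFinset, Nat.cast_prod, ← Finset.mul_prod_erase _ _ (Finset.mem_univ i),
          if_pos rfl, Finset.prod_congr rfl fun j hj => by rw [if_neg (Finset.ne_of_mem_erase hj)],
          Finset.prod_const, Finset.card_erase_of_mem (Finset.mem_univ i), Finset.card_univ,
          Fintype.card_fin]
        gcongr
    _ = _ := by simp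

theorem floor_mem_shellCells {n : ℕ} {u : ℝ} (hu : 1 ≤ u) {z : Fin n → ℝ}
    (h₁ : u - 1 < ‖z‖) (h₂ : ‖z‖ < u) : (fun j => ⌊z j⌋) ∈ shellCells n u := by
  have hz : ∀ j, |z j| < u := fun j => (norm_le_pi_norm z j).trans_lt h₂
  obtain ⟨i, hi⟩ : ∃ i, u - 1 < |z i| := by
    by_contra! h
    exact h₁.not_ge ((pi_norm_le_iff_of_nonneg (by linarith)).2 h)
  simp only [shellCells, Finset.mem_biUnion, Finset.mem_univ, true_and, Fintype.mem_piFinset]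
  refine ⟨i, fun j => ?_⟩
  obtain ⟨hl, hr⟩ := abs_lt.1 (hz j)
  split_ifs with hji
  · subst hji
    rw [Finset.mem_union, Finset.mem_Icc, Finset.mem_Icc]
    rcases lt_abs.1 hi with h | h
    · exact Or.inr ⟨Int.floor_mono h.le, Int.floor_mono hr.le⟩
    · exact Or.inl ⟨Int.floor_mono hl.le, Int.floor_mono (by linarith)⟩
  · exact Finset.mem_Icc.2 ⟨Int.floor_mono hl.le, Int.floor_mono hr.le⟩

/-- The cube of side `δ` at position `c.2` of the grid of mesh `δ` based at `c.1 / q`. -/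
def gridCell (n : ℕ) (δ : ℝ) (q : ℕ) (c : (Fin n → ℤ) × (Fin n → ℤ)) : Set (Fin n → ℝ) :=
  Set.univ.pi fun j => Icc ((c.1 j : ℝ) / q + c.2 j * δ) ((c.1 j : ℝ) / q + (c.2 j + 1) * δ)

theorem ediam_gridCell_le (n : ℕ) (δ : ℝ) (q : ℕ) (c : (Fin n → ℤ) × (Fin n → ℤ)) :
    Metric.ediam (gridCell n δ q c) ≤ ENNReal.ofReal δ := by
  refine Metric.ediam_pi_le_of_le fun j => ?_
  rw [Real.ediam_Icc]
  exact ENNReal.ofReal_le_ofReal (by linarith)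

theorem mem_gridCell_floor {n : ℕ} {δ : ℝ} (hδ : 0 < δ) (q : ℕ) (p : Fin n → ℤ)
    (x : Fin n → ℝ) : x ∈ gridCell n δ q (p, fun j => ⌊(x j - p j / q) / δ⌋) := by
  refine fun j _ => ⟨?_, ?_⟩
  · have := (le_div_iff₀ hδ).1 (Int.floor_le ((x j - p j / q) / δ))
    simp only
    linarith
  · have := (div_lt_iff₀ hδ).1 (Int.lt_floor_add_one ((x j - p j / q) / δ))
    simp only
    linarith

theorem mem_numerators {n q : ℕ} (hq : 0 < q) {x : Fin n → ℝ} (hx : x ∈ unitCube n)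
    {p : Fin n → ℤ} (h : ‖x - fun i => (p i : ℝ) / q‖ ≤ 1) : p ∈ numerators n q := by
  have hq' : (0 : ℝ) < q := by exact_mod_cast hq
  refine Fintype.mem_piFinset.2 fun j => Finset.mem_Icc.2 ?_
  obtain ⟨hx₀, hx₁⟩ := hx j (mem_univ j)
  obtain ⟨hl, hr⟩ := abs_le.1 ((norm_le_pi_norm _ j).trans h)
  simp only [Pi.sub_apply] at hl hr
  constructor
  · have : -1 ≤ (p j : ℝ) / q := by linarith
    rw [le_div_iff₀ hq'] at this
    exact_mod_cast (by linarith : (-(q : ℝ)) ≤ p j)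
  · have : (p j : ℝ) / q ≤ 2 := by linarith
    rw [div_le_iff₀ hq'] at this
    exact_mod_cast this

theorem frequently_exists_of_mem_exactSet {n : ℕ} {f ψ : ℕ → ℝ}
    (hψ : ∀ q : ℕ, 0 < q → ψ q / q ≤ 1) {x : Fin n → ℝ} (hx : x ∈ ExactSet n f ψ) :
    ∃ᶠ q : ℕ in atTop, ∃ p ∈ numerators n q, f q * (ψ q / q) < ‖x - fun i => (p i : ℝ) / q‖ ∧
      ‖x - fun i => (p i : ℝ) / q‖ < ψ q / q := by
  obtain ⟨hcube, hinf, hev⟩ := hx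
  refine fun hcon => hinf ?_
  obtain ⟨N, hN⟩ := eventually_atTop.1 (hev.and hcon)
  refine (((Finset.range N).biUnion fun q => numerators n q ×ˢ {q}).finite_toSet).subset ?_
  rintro ⟨p, q⟩ ⟨hq, hlt⟩
  have hp := mem_numerators hq hcube (hlt.le.trans (hψ q hq))
  have hqN : q < N := by
    by_contra! hle
    exact (hN q hle).2 ⟨p, hp, (hN q hle).1 p, hlt⟩
  simpa using And.intro hp hqN

theorem frequently_mem_gridCell {n : ℕ} {τ ε : ℝ} (hτ : 0 ≤ τ) (hε : 0 ≤ ε) {x : Fin n → ℝ}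
    (hx : x ∈ ExactSet n (fun q => 1 - (q : ℝ) ^ (-ε)) (fun q => (q : ℝ) ^ (-τ))) :
    ∃ᶠ q : ℕ in atTop, ∃ c ∈ numerators n q ×ˢ shellCells n ((q : ℝ) ^ ε),
      x ∈ gridCell n ((q : ℝ) ^ (-(1 + τ + ε))) q c := by
  have hψ : ∀ q : ℕ, 0 < q → (q : ℝ) ^ (-τ) / q ≤ 1 := by
    intro q hq
    have h1 : (1 : ℝ) ≤ q := by exact_mod_cast hq
    exact div_le_one_of_le₀ ((Real.rpow_le_one_of_one_le_of_nonpos h1 (by linarith)).trans h1)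
      (by linarith)
  refine ((frequently_exists_of_mem_exactSet hψ hx).and_eventually
    (eventually_ge_atTop 1)).mono ?_
  rintro q ⟨⟨p, hp, hlow, hupp⟩, hq⟩
  have h1 : (1 : ℝ) ≤ q := by exact_mod_cast hq
  have h0 : (0 : ℝ) < q := by linarith
  set δ : ℝ := (q : ℝ) ^ (-(1 + τ + ε)) with hδ_def
  have hδ : 0 < δ := Real.rpow_pos_of_pos h0 _
  have hr : (q : ℝ) ^ (-τ) / q = (q : ℝ) ^ ε * δ := by
    rw [hδ_def, ← Real.rpow_add h0, ← Real.rpow_sub_one h0.ne']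
    congr 1
    ring
  have hone : (q : ℝ) ^ (-ε) * (q : ℝ) ^ ε = 1 := by
    rw [← Real.rpow_add h0]
    simp
  rw [hr] at hlow hupp
  refine ⟨(p, fun j => ⌊(x j - p j / q) / δ⌋), Finset.mem_product.2 ⟨hp, ?_⟩,
    mem_gridCell_floor hδ q p x⟩
  have hnorm : ‖fun j => (x j - p j / q) / δ‖ = ‖x - fun i => (p i : ℝ) / q‖ / δ := by
    have : (fun j => (x j - p j / q) / δ) = δ⁻¹ • (x - fun i => (p i : ℝ) / q) := by
      ext j
      simp [div_eq_inv_mul]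
    rw [this, norm_smul, Real.norm_of_nonneg (inv_nonneg.2 hδ.le), div_eq_inv_mul]
  refine floor_mem_shellCells (Real.one_le_rpow h1 hε) ?_ ?_
  · rw [hnorm, lt_div_iff₀ hδ]
    calc ((q : ℝ) ^ ε - 1) * δ
        = ((q : ℝ) ^ ε - (q : ℝ) ^ (-ε) * (q : ℝ) ^ ε) * δ := by rw [hone]
      _ = (1 - (q : ℝ) ^ (-ε)) * ((q : ℝ) ^ ε * δ) := by ring
      _ < _ := hlow
  · rwa [hnorm, div_lt_iff₀ hδ]

theorem summable_card_mul_rpow {n : ℕ} (hn : 1 ≤ n) {τ ε s : ℝ} (hε : 0 ≤ ε)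
    (hs : (n : ℝ) + 1 + ((n : ℝ) - 1) * ε < (1 + τ + ε) * s) :
    Summable fun q : ℕ => ((numerators n q ×ˢ shellCells n ((q : ℝ) ^ ε)).card : ℝ) *
      ((q : ℝ) ^ (-(1 + τ + ε))) ^ s := by
  have hsum : Summable fun q : ℕ => (4 ^ n * (n * (4 * 4 ^ (n - 1))) : ℝ) *
      (q : ℝ) ^ ((n : ℝ) + ((n : ℝ) - 1) * ε - (1 + τ + ε) * s) :=
    (Real.summable_nat_rpow.2 (by linarith)).mul_left _
  refine (summable_nat_add_iff 1).1 (Summable.of_nonneg_of_le (fun q => by positivity) (fun q => ?_)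
    ((summable_nat_add_iff 1).2 hsum))
  generalize hm : q + 1 = m
  have hm1 : 1 ≤ m := by omega
  have h1 : (1 : ℝ) ≤ m := by exact_mod_cast hm1
  have h0 : (0 : ℝ) < m := by linarith
  rw [Finset.card_product, Nat.cast_mul]
  calc ((numerators n m).card : ℝ) * (shellCells n ((m : ℝ) ^ ε)).card *
        ((m : ℝ) ^ (-(1 + τ + ε))) ^ s
      ≤ (4 * m : ℝ) ^ n * (n * (4 * (4 * (m : ℝ) ^ ε) ^ (n - 1))) *
        ((m : ℝ) ^ (-(1 + τ + ε))) ^ s := by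
        gcongr
        · exact card_numerators_le n m hm1
        · exact card_shellCells_le n (Real.one_le_rpow h1 hε)
    _ = (4 ^ n * (n * (4 * 4 ^ (n - 1))) : ℝ) *
        ((m : ℝ) ^ n * ((m : ℝ) ^ ε) ^ (n - 1) * ((m : ℝ) ^ (-(1 + τ + ε))) ^ s) := by
        rw [mul_pow, mul_pow]
        ring
    _ = _ := by
        rw [← Real.rpow_natCast (m : ℝ) n, ← Real.rpow_mul_natCast h0.le, ← Real.rpow_mul h0.le,
          ← Real.rpow_add h0, ← Real.rpow_add h0]
        push_cast [Nat.cast_sub hn]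
        congr 2
        ring

theorem stmt14 (n : ℕ) (hn : 2 ≤ n) (τψ : ℝ) (h1 : (1 : ℝ) / n ≤ τψ)
    (h2 : τψ < 2 / ((n : ℝ) - 1)) (ε : ℝ) (hε : 0 < ε) :
    dimH (ExactSet n (fun q => 1 - (q : ℝ) ^ (-ε)) (fun q => (q : ℝ) ^ (-τψ))) ≤
        ENNReal.ofReal (((n : ℝ) + 1 + ((n : ℝ) - 1) * ε) / (1 + τψ + ε)) ∧
      ((n : ℝ) + 1 + ((n : ℝ) - 1) * ε) / (1 + τψ + ε) < ((n : ℝ) + 1) / (1 + τψ) := by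
  have hn' : (2 : ℝ) ≤ n := by exact_mod_cast hn
  have hτ : 0 ≤ τψ := le_trans (by positivity) h1
  have ha : 0 < 1 + τψ + ε := by positivity
  constructor
  · refine ENNReal.le_of_forall_pos_le_add fun η hη _ => ?_
    have hS : 0 ≤ ((n : ℝ) + 1 + ((n : ℝ) - 1) * ε) / (1 + τψ + ε) :=
      div_nonneg (by nlinarith) ha.le
    rw [← ENNReal.ofNNReal_toNNReal, ← ENNReal.coe_add]
    refine dimH_le_of_frequently_mem_cover
      (fun q => numerators n q ×ˢ shellCells n ((q : ℝ) ^ ε))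
      (fun q => gridCell n ((q : ℝ) ^ (-(1 + τψ + ε))) q)
      (δ := fun q => (q : ℝ) ^ (-(1 + τψ + ε)))
      (fun x hx => frequently_mem_gridCell hτ hε.le hx) (fun q => by positivity) ?_ ?_
      (fun q c _ => ediam_gridCell_le n _ q c) ?_
    · intro a ha' b _ hab
      have ha₁ : (0 : ℝ) < a := by exact_mod_cast (show 0 < a from ha')
      exact Real.rpow_le_rpow_of_nonpos ha₁ (by exact_mod_cast hab) (by linarith)
    · exact (tendsto_rpow_neg_atTop ha).comp tendsto_natCast_atTop_atTop
    · refine summable_card_mul_rpow (by omega) hε.le ?_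
      rw [NNReal.coe_add, Real.coe_toNNReal _ hS, mul_add, mul_div_cancel₀ _ ha.ne']
      have : 0 < (1 + τψ + ε) * (η : ℝ) := mul_pos ha hη
      linarith
  · rw [lt_div_iff₀ (by linarith)] at h2
    rw [div_lt_div_iff₀ ha (by linarith)]
    nlinarith [mul_pos hε (sub_pos.2 h2)]
end
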